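/- Let d > 4 and C0 > 0. There exists β0 > 0 (depending only on d) such that for every β ∈ (0, β0] the limit A = lim_{n→∞} c_n μ^{−n} exists and is positive, and there exists a constant K (depending only on d and C0, not on n, r, β) such that for every integer r ≥ 3 and every integer n with 1 ≤ n ≤ C0 V^{1/2}, one has |c_n^𝕋 − A μ^n| ≤ K β A μ^n ( n^{−(d−4)/2} + n²/V ). -/

import Mathlib

open scoped BigOperators

/-- A unit step in `ℤ^d`: a coordinate direction together with a sign. -/
def wsawStep (d : ℕ) (e : Fin d × Bool) : Fin d → ℤ :=
  fun i => if i = e.1 then (if e.2 then 1 else -1) else 0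

/-- The position after `k` steps of the walk on `ℤ^d` with step sequence `s`.
(An `n`-step nearest-neighbour walk on `ℤ^d` started at `0` is the same thing as a
sequence of `n` unit steps.) -/
def wsawPos {d n : ℕ} (s : Fin n → Fin d × Bool) (k : ℕ) : Fin d → ℤ :=
  ∑ j ∈ Finset.univ.filter (fun j : Fin n => (j : ℕ) < k), wsawStep d (s j)

/-- The weakly self-avoiding walk weight `∏_{0 ≤ s < t ≤ n} (1 + β U_{st}(ω))`
of the `ℤ^d` walk with step sequence `s`. -/
noncomputable def wsawWeight {d : ℕ} (β : ℝ) (n : ℕ) (s : Fin n → Fin d × Bool) : ℝ :=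
  ∏ p ∈ (Finset.range (n + 1) ×ˢ Finset.range (n + 1)).filter (fun p => p.1 < p.2),
    (1 + β * (if wsawPos s p.1 = wsawPos s p.2 then (-1 : ℝ) else 0))

/-- The two-point partition function `c_n(x)` on `ℤ^d`. -/
noncomputable def cZx (d : ℕ) (β : ℝ) (n : ℕ) (x : Fin d → ℤ) : ℝ :=
  ∑ s ∈ Finset.univ.filter (fun s : Fin n → Fin d × Bool => wsawPos s n = x),
    wsawWeight β n s

/-- The partition function `c_n = Σ_x c_n(x)` on `ℤ^d`. -/
noncomputable def cZ (d : ℕ) (β : ℝ) (n : ℕ) : ℝ :=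
  ∑ s : Fin n → Fin d × Bool, wsawWeight β n s

/-- The position after `k` steps of the torus walk with step sequence `s`:
the mod-`r` projection of the `ℤ^d` position (for `r ≥ 3`, `n`-step torus walks
started at `0` correspond bijectively to step sequences). -/
def wsawPosT {d : ℕ} (r : ℕ) {n : ℕ} (s : Fin n → Fin d × Bool) (k : ℕ) : Fin d → ZMod r :=
  fun i => ((wsawPos s k i : ℤ) : ZMod r)

/-- The weakly self-avoiding walk weight of the torus walk with step sequence `s`. -/
noncomputable def wsawWeightT {d : ℕ} (r : ℕ) (β : ℝ) (n : ℕ) (s : Fin n → Fin d × Bool) : ℝ :=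
  ∏ p ∈ (Finset.range (n + 1) ×ˢ Finset.range (n + 1)).filter (fun p => p.1 < p.2),
    (1 + β * (if wsawPosT r s p.1 = wsawPosT r s p.2 then (-1 : ℝ) else 0))

/-- The torus partition function `c_n^𝕋`. -/
noncomputable def cT (d r : ℕ) (β : ℝ) (n : ℕ) : ℝ :=
  ∑ s : Fin n → Fin d × Bool, wsawWeightT r β n s

/-- `μ` is the growth constant: `μ = lim_{n→∞} c_n^{1/n}`. -/
def HasGrowthConst (d : ℕ) (β μ : ℝ) : Prop :=
  Filter.Tendsto (fun n : ℕ => (cZ d β n) ^ ((n : ℝ)⁻¹)) Filter.atTop (nhds μ)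

/-- The susceptibility `χ(z)` on `ℤ^d`, for complex `z`. -/
noncomputable def chi (d : ℕ) (β : ℝ) (z : ℂ) : ℂ := ∑' n : ℕ, (cZ d β n : ℂ) * z ^ n

/-- The susceptibility `χ(z)` on `ℤ^d`, for real `z`. -/
noncomputable def chiR (d : ℕ) (β : ℝ) (z : ℝ) : ℝ := ∑' n : ℕ, cZ d β n * z ^ n

/-- The torus susceptibility `χ^𝕋(z)`, for complex `z`. -/
noncomputable def chiT (d r : ℕ) (β : ℝ) (z : ℂ) : ℂ := ∑' n : ℕ, (cT d r β n : ℂ) * z ^ n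

/-- The torus susceptibility `χ^𝕋(z)`, for real `z`. -/
noncomputable def chiTR (d r : ℕ) (β : ℝ) (z : ℝ) : ℝ := ∑' n : ℕ, cT d r β n * z ^ n

/-- The sup norm `‖x‖_∞` of `x ∈ ℤ^d`, as a real number. -/
noncomputable def nInf {d : ℕ} (x : Fin d → ℤ) : ℝ :=
  ((Finset.univ.sup fun i => (x i).natAbs : ℕ) : ℝ)

/-- `⟨x⟩ = max {1, ‖x‖_∞}`. -/
noncomputable def vee {d : ℕ} (x : Fin d → ℤ) : ℝ := max 1 (nInf x)

/-- The two-point function `G_z(x) = Σ_n c_n(x) z^n` on `ℤ^d`. -/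
noncomputable def Gpt (d : ℕ) (β z : ℝ) (x : Fin d → ℤ) : ℝ := ∑' n : ℕ, cZx d β n x * z ^ n

/-- The bubble diagram `B_z = G_z * G_z`. -/
noncomputable def Bpt (d : ℕ) (β z : ℝ) (x : Fin d → ℤ) : ℝ :=
  ∑' y : Fin d → ℤ, Gpt d β z (x - y) * Gpt d β z y

/-- The triangle diagram `T_z = G_z * G_z * G_z`. -/
noncomputable def Tpt (d : ℕ) (β z : ℝ) (x : Fin d → ℤ) : ℝ :=
  ∑' y : Fin d → ℤ, Bpt d β z (x - y) * Gpt d β z y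

/-- The representative in `[-r/2, r/2) ∩ ℤ` of `x ∈ ℤ/rℤ`. -/
def repC (r : ℕ) (x : ZMod r) : ℤ :=
  if 2 * (x.val : ℤ) < (r : ℤ) then (x.val : ℤ) else (x.val : ℤ) - (r : ℤ)

namespace Wsaw

/-- The constant in the telescoping comparison of power sums. -/
noncomputable def teleConst (s : ℝ) : ℝ := (5 / 2) ^ s / (s - 1)

lemma teleConst_pos {s : ℝ} (hs : 1 < s) : 0 < teleConst s := by
  unfold teleConst
  have : 0 < s - 1 := by linarith
  positivity

lemma mul_rpow_neg_le_sub {s x η : ℝ} (hs : 1 < s) (hx : 1 ≤ x) (h0 : 0 ≤ η) (h1 : η ≤ 3 / 2) :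
    η * x ^ (-s) ≤ teleConst s * (x ^ (1 - s) - (x + η) ^ (1 - s)) := by
  have hx0 : 0 < x := by linarith
  have hy0 : 0 < x + η := by linarith
  have hs1 : 0 < s - 1 := by linarith
  have key : (s - 1) * (η / (x + η)) ≤ ((x + η) / x) ^ (s - 1) - 1 := by
    have h1 : 1 - ((x + η) / x)⁻¹ ≤ Real.log ((x + η) / x) :=
      Real.one_sub_inv_le_log_of_pos (by positivity)
    have h2 : 1 - ((x + η) / x)⁻¹ = η / (x + η) := by
      field_simp
      ring
    rw [h2] at h1
    have h3 : ((x + η) / x) ^ (s - 1) = Real.exp (Real.log ((x + η) / x) * (s - 1)) :=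
      Real.rpow_def_of_pos (by positivity) _
    have h4 := Real.add_one_le_exp (Real.log ((x + η) / x) * (s - 1))
    rw [h3]
    nlinarith
  have e1 : x ^ (1 - s) = (x + η) ^ (1 - s) * ((x + η) / x) ^ (s - 1) := by
    rw [Real.div_rpow hy0.le hx0.le, show (1 - s) = -(s - 1) by ring, Real.rpow_neg hx0.le,
      Real.rpow_neg hy0.le]
    have : (x + η) ^ (s - 1) ≠ 0 := (Real.rpow_pos_of_pos hy0 _).ne'
    field_simp
  have e2 : (x + η) ^ (-s) = (x + η) ^ (1 - s) / (x + η) := by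
    rw [show -s = (1 - s) - 1 by ring, Real.rpow_sub_one hy0.ne']
  have hle : (5 / 2 * x) ^ (-s) ≤ (x + η) ^ (-s) :=
    Real.rpow_le_rpow_of_nonpos hy0 (by linarith) (by linarith)
  rw [Real.mul_rpow (by norm_num) hx0.le, Real.rpow_neg (by norm_num : (0:ℝ) ≤ 5 / 2)] at hle
  have hp : (0:ℝ) < (5 / 2) ^ s := by positivity
  have hle' : x ^ (-s) ≤ (5 / 2) ^ s * (x + η) ^ (-s) := by
    rw [inv_mul_eq_div, div_le_iff₀ hp] at hle
    linarith
  have hq : 0 < (x + η) ^ (1 - s) := Real.rpow_pos_of_pos hy0 _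
  have : (s - 1) * (η * (x + η) ^ (-s)) ≤ x ^ (1 - s) - (x + η) ^ (1 - s) := by
    rw [e1, e2]
    have := mul_le_mul_of_nonneg_left key hq.le
    calc _ = (x + η) ^ (1 - s) * ((s - 1) * (η / (x + η))) := by ring
      _ ≤ _ := this
      _ = _ := by ring
  calc η * x ^ (-s) ≤ η * ((5 / 2) ^ s * (x + η) ^ (-s)) := by gcongr
    _ = (5 / 2) ^ s / (s - 1) * ((s - 1) * (η * (x + η) ^ (-s))) := by field_simp
    _ ≤ _ := by unfold teleConst; gcongr

lemma sum_mul_rpow_le {s η : ℝ} (hs : 1 < s) (h0 : 0 ≤ η) (h1 : η ≤ 3 / 2) (n : ℕ) :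
    ∑ j ∈ Finset.range n, η * (1 + η * j) ^ (-s) ≤ teleConst s := by
  have key : ∑ j ∈ Finset.range n, η * (1 + η * j) ^ (-s)
      ≤ teleConst s * (1 - (1 + η * n) ^ (1 - s)) := by
    induction n with
    | zero => simp
    | succ n ih =>
      rw [Finset.sum_range_succ]
      have := mul_rpow_neg_le_sub hs (x := 1 + η * n)
        (by nlinarith [Nat.cast_nonneg (α := ℝ) n]) h0 h1
      have e : 1 + η * n + η = 1 + η * ((n + 1 : ℕ) : ℝ) := by push_cast; ring
      rw [e] at this
      linarith
  have : 0 ≤ (1 + η * (n : ℝ)) ^ (1 - s) := by positivity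
  nlinarith [teleConst_pos hs]

lemma sum_Ico_rpow_le {s : ℝ} (hs : 0 < s) (n N : ℕ) :
    ∑ m ∈ Finset.Ico n N, ((m : ℝ) + 1) ^ (-(s + 1))
      ≤ teleConst (s + 1) * ((n : ℝ) + 1) ^ (-s) := by
  have h0 : 0 ≤ teleConst (s + 1) * ((n : ℝ) + 1) ^ (-s) :=
    mul_nonneg (teleConst_pos (by linarith)).le (by positivity)
  rcases le_or_gt n N with h | h
  · have key : ∑ m ∈ Finset.Ico n N, ((m : ℝ) + 1) ^ (-(s + 1))
        ≤ teleConst (s + 1) * (((n : ℝ) + 1) ^ (-s) - ((N : ℝ) + 1) ^ (-s)) := by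
      induction N, h using Nat.le_induction with
      | base => simp
      | succ N hN ih =>
        rw [Finset.sum_Ico_succ_top hN]
        have := mul_rpow_neg_le_sub (s := s + 1) (by linarith) (x := (N : ℝ) + 1) (η := 1)
          (by linarith [Nat.cast_nonneg (α := ℝ) N]) (by norm_num) (by norm_num)
        rw [one_mul, show 1 - (s + 1) = -s by ring] at this
        push_cast
        linarith
    have : 0 ≤ ((N : ℝ) + 1) ^ (-s) := by positivity
    nlinarith [teleConst_pos (s := s + 1) (by linarith)]
  · rw [Finset.Ico_eq_empty (by omega)]
    simpa using h0

lemma summable_rpow_neg {s : ℝ} (hs : 1 < s) :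
    Summable fun m : ℕ => ((m : ℝ) + 1) ^ (-s) := by
  have := (summable_nat_add_iff 1).2 (Real.summable_nat_rpow.2 (by linarith : -s < -1))
  simpa using this

lemma tsum_rpow_tail_le {s : ℝ} (hs : 0 < s) (n : ℕ) :
    ∑' m : ℕ, (((m + n : ℕ) : ℝ) + 1) ^ (-(s + 1)) ≤ teleConst (s + 1) * ((n : ℝ) + 1) ^ (-s) := by
  refine Real.tsum_le_of_sum_range_le (fun m => by positivity) fun N => ?_
  have := sum_Ico_rpow_le hs n (n + N)
  rw [Finset.sum_Ico_eq_sum_range] at this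
  simpa [add_comm] using this

lemma sum_rpow_le {s : ℝ} (hs : 1 < s) (n : ℕ) :
    ∑ m ∈ Finset.range n, ((m : ℝ) + 1) ^ (-s) ≤ teleConst s := by
  have := sum_Ico_rpow_le (s := s - 1) (by linarith) 0 n
  simpa using this

lemma exists_one_add_rpow_le_exp (s : ℝ) (hs : 0 < s) :
    ∃ C : ℝ, 1 ≤ C ∧ ∀ x : ℝ, 0 ≤ x → Real.exp (-(x / 3)) ≤ C * (1 + x) ^ (-s) := by
  refine ⟨(max 1 (3 * s)) ^ s, Real.one_le_rpow (le_max_left _ _) hs.le, fun x hx => ?_⟩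
  have hm : 1 ≤ max 1 (3 * s) := le_max_left _ _
  have hm' : 3 * s ≤ max 1 (3 * s) := le_max_right _ _
  have h1 : 1 + x ≤ max 1 (3 * s) * Real.exp (x / (3 * s)) := by
    have := Real.add_one_le_exp (x / (3 * s))
    have e : (3 * s) * (x / (3 * s)) = x := by field_simp
    have : 0 ≤ x / (3 * s) := by positivity
    nlinarith
  have h2 : (1 + x) ^ s ≤ (max 1 (3 * s)) ^ s * Real.exp (x / 3) := by
    calc (1 + x) ^ s ≤ (max 1 (3 * s) * Real.exp (x / (3 * s))) ^ s := by gcongr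
      _ = _ := by
        rw [Real.mul_rpow (by positivity) (by positivity), ← Real.exp_mul]
        congr 2
        field_simp
  rw [Real.rpow_neg (by positivity), Real.exp_neg, ← div_eq_mul_inv, le_div_iff₀ (by positivity),
    inv_mul_le_iff₀ (by positivity)]
  linarith

end Wsaw

namespace Wsaw

open Finset.HasAntidiagonal (antidiagonal mem_antidiagonal)

lemma sum_antidiagonal_fst (f : ℕ → ℝ) (n : ℕ) :
    ∑ ij ∈ antidiagonal n, f ij.1 = ∑ i ∈ Finset.range (n + 1), f i :=
  Finset.Nat.sum_antidiagonal_eq_sum_range_succ (fun i _ => f i) n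

lemma sum_antidiagonal_snd (f : ℕ → ℝ) (n : ℕ) :
    ∑ ij ∈ antidiagonal n, f ij.2 = ∑ i ∈ Finset.range (n + 1), f i := by
  rw [← sum_antidiagonal_fst, ← Finset.Nat.sum_antidiagonal_swap]
  rfl

/-- The decay profile appearing in the deconvolution of the scalar recursion. -/
noncomputable def psi (s η : ℝ) (n : ℕ) : ℝ := ((n : ℝ) + 1) ^ (-s) + η * (1 + η * n) ^ (-s)

lemma psi_nonneg {s η : ℝ} (h0 : 0 ≤ η) (n : ℕ) : 0 ≤ psi s η n := by
  unfold psi; positivity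

lemma one_add_mul_rpow_double {s η : ℝ} (hs : 0 < s) (h0 : 0 ≤ η) {j n : ℕ} (h : n ≤ 2 * j) :
    (1 + η * j) ^ (-s) ≤ 2 ^ s * (1 + η * n) ^ (-s) := by
  have h' : (n : ℝ) ≤ 2 * j := by exact_mod_cast h
  have h1 : (2 * (1 + η * j)) ^ (-s) ≤ (1 + η * n) ^ (-s) :=
    Real.rpow_le_rpow_of_nonpos (by positivity) (by nlinarith) (by linarith)
  rw [Real.mul_rpow (by norm_num) (by positivity), Real.rpow_neg (by norm_num),
    inv_mul_le_iff₀ (by positivity)] at h1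
  exact h1

lemma add_one_rpow_double {s : ℝ} (hs : 0 < s) {j n : ℕ} (h : n ≤ 2 * j) :
    ((j : ℝ) + 1) ^ (-s) ≤ 2 ^ s * ((n : ℝ) + 1) ^ (-s) := by
  have := one_add_mul_rpow_double hs zero_le_one h
  rwa [one_mul, one_mul, add_comm, add_comm (1 : ℝ)] at this

lemma psi_double {s η : ℝ} (hs : 0 < s) (h0 : 0 ≤ η) {j n : ℕ} (h : n ≤ 2 * j) :
    psi s η j ≤ 2 ^ s * psi s η n := by
  have h1 := add_one_rpow_double hs h
  have h2 := mul_le_mul_of_nonneg_left (one_add_mul_rpow_double hs h0 h) h0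
  unfold psi
  linarith

lemma sum_psi_le {s η : ℝ} (hs : 1 < s) (h0 : 0 ≤ η) (h1 : η ≤ 3 / 2) (n : ℕ) :
    ∑ j ∈ Finset.range n, psi s η j ≤ 2 * teleConst s := by
  unfold psi
  rw [Finset.sum_add_distrib]
  linarith [sum_rpow_le hs n, sum_mul_rpow_le hs h0 h1 n]

lemma sum_antidiagonal_psi_mul_le {s η : ℝ} (hs : 1 < s) (h0 : 0 ≤ η) (h1 : η ≤ 3 / 2) (n : ℕ) :
    ∑ ij ∈ antidiagonal n, psi s η ij.1 * psi s η ij.2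
      ≤ (2 ^ s * (4 * teleConst s)) * psi s η n := by
  have key : ∀ ij ∈ antidiagonal n, psi s η ij.1 * psi s η ij.2
      ≤ 2 ^ s * psi s η n * (psi s η ij.1 + psi s η ij.2) := by
    intro ij hij
    have hij := mem_antidiagonal.1 hij
    have a := psi_nonneg (s := s) h0 ij.1
    have b := psi_nonneg (s := s) h0 ij.2
    have c : 0 ≤ 2 ^ s * psi s η n := mul_nonneg (by positivity) (psi_nonneg h0 n)
    rcases le_total ij.1 ij.2 with h | h
    · have := psi_double (s := s) (by linarith) h0 (show n ≤ 2 * ij.2 by omega)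
      nlinarith
    · have := psi_double (s := s) (by linarith) h0 (show n ≤ 2 * ij.1 by omega)
      nlinarith
  refine (Finset.sum_le_sum key).trans ?_
  rw [← Finset.mul_sum, Finset.sum_add_distrib,
    sum_antidiagonal_fst, sum_antidiagonal_snd]
  have hp : 0 ≤ 2 ^ s * psi s η n := mul_nonneg (by positivity) (psi_nonneg h0 n)
  have := sum_psi_le hs h0 h1 (n + 1)
  nlinarith

lemma abs_one_sub_pow_le {s η : ℝ} {C : ℝ} (hC : ∀ x : ℝ, 0 ≤ x → Real.exp (-(x / 3)) ≤ C * (1 + x) ^ (-s))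
    (h0 : 0 ≤ η) (h1 : η ≤ 3 / 2) (j : ℕ) : |1 - η| ^ j ≤ C * (1 + η * j) ^ (-s) := by
  have a : |1 - η| ≤ Real.exp (-(η / 3)) := by
    have := Real.add_one_le_exp (-(η / 3))
    refine le_trans ?_ this
    rw [abs_le]; constructor <;> linarith
  calc |1 - η| ^ j ≤ Real.exp (-(η / 3)) ^ j := by gcongr
    _ = Real.exp (-(η * j / 3)) := by rw [← Real.exp_nat_mul]; ring_nf
    _ ≤ _ := hC _ (by positivity)

lemma abs_one_sub_pow_sub_le {l : ℝ} (hl : |l| ≤ 1) (k : ℕ) : |1 - l ^ k| ≤ k * (1 - l) := by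
  have h := abs_le.1 hl
  induction k with
  | zero => simp
  | succ k ih =>
    have e : 1 - l ^ (k + 1) = (1 - l ^ k) + l ^ k * (1 - l) := by ring
    rw [e]
    refine (abs_add_le _ _).trans ?_
    rw [abs_mul, abs_pow, abs_of_nonneg (by linarith : 0 ≤ 1 - l)]
    have : |l| ^ k ≤ 1 := pow_le_one₀ (abs_nonneg _) hl
    push_cast
    nlinarith

end Wsaw

namespace Wsaw

open Finset.HasAntidiagonal (antidiagonal mem_antidiagonal)

/-- Coefficients obeying the decay needed for the deconvolution. -/
structure SmallCoeff (s b : ℝ) (p : ℕ → ℝ) : Prop where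
  zero : p 0 = 0
  one : p 1 = 0
  bound : ∀ m, |p m| ≤ b * ((m : ℝ) + 1) ^ (-(s + 1))

lemma SmallCoeff.summable {s b : ℝ} {p : ℕ → ℝ} (hs : 0 < s) (h : SmallCoeff s b p) :
    Summable p :=
  Summable.of_norm_bounded ((summable_rpow_neg (by linarith : 1 < s + 1)).mul_left b) h.bound

lemma SmallCoeff.abs_tail_le {s b : ℝ} {p : ℕ → ℝ} (hs : 0 < s) (hb : 0 ≤ b)
    (h : SmallCoeff s b p) (n : ℕ) :
    |∑' m, p (m + n)| ≤ b * (teleConst (s + 1) * ((n : ℝ) + 1) ^ (-s)) := by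
  have hsum : Summable fun m : ℕ => b * (((m + n : ℕ) : ℝ) + 1) ^ (-(s + 1)) :=
    (((summable_nat_add_iff n).2 (summable_rpow_neg (by linarith : 1 < s + 1)))).mul_left b
  have h1 := tsum_of_norm_bounded (f := fun m => p (m + n)) hsum.hasSum
    (fun m => h.bound (m + n))
  rw [tsum_mul_left] at h1
  exact h1.trans (mul_le_mul_of_nonneg_left (tsum_rpow_tail_le hs n) hb)

/-- The error coefficients `(1 - θX - p(X)) / (1 - (θ + p(1)) X)`. -/
noncomputable def errCoeff (θ : ℝ) (p : ℕ → ℝ) (n : ℕ) : ℝ :=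
  (θ + ∑' m, p m) ^ (n + 1) - θ * (θ + ∑' m, p m) ^ n
    - ∑ m ∈ Finset.range (n + 2), p m * (θ + ∑' m, p m) ^ (n + 1 - m)

lemma errCoeff_eq {s b θ : ℝ} {p : ℕ → ℝ} (hs : 0 < s) (h : SmallCoeff s b p) (n : ℕ) :
    errCoeff θ p n = (∑ m ∈ Finset.range (n + 2),
        p m * ((θ + ∑' m, p m) ^ n - (θ + ∑' m, p m) ^ (n + 1 - m)))
      + (θ + ∑' m, p m) ^ n * ∑' m, p (m + (n + 2)) := by
  have e := (h.summable hs).sum_add_tsum_nat_add (n + 2)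
  unfold errCoeff
  simp only [mul_sub, Finset.sum_sub_distrib]
  rw [← Finset.sum_mul]
  set l := θ + ∑' m, p m with hl
  have : l ^ (n + 1) - θ * l ^ n = l ^ n * ∑' m, p m := by rw [pow_succ, hl]; ring
  rw [this, ← e]
  ring

lemma abs_errCoeff_term_le {s b η C l : ℝ} {p : ℕ → ℝ} (hs : 1 < s) (hb : 0 ≤ b)
    (hC1 : 1 ≤ C) (hC : ∀ x : ℝ, 0 ≤ x → Real.exp (-(x / 3)) ≤ C * (1 + x) ^ (-s))
    (h : SmallCoeff s b p) (h0 : 0 ≤ η) (h1 : η ≤ 3 / 2) (hl : l = 1 - η)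
    {n m : ℕ} (hm : m < n + 2) (hm' : 2 * m < n + 2) :
    |p m * (l ^ n - l ^ (n + 1 - m))| ≤
      (b * C * 2 ^ s * (η * (1 + η * ((n + 1 : ℕ) : ℝ)) ^ (-s))) * ((m : ℝ) + 1) ^ (-s) := by
  have habs : |l| ≤ 1 := by rw [hl, abs_le]; constructor <;> linarith
  rcases Nat.lt_or_ge m 1 with h0' | hm1
  · obtain rfl : m = 0 := by omega
    rw [h.zero, zero_mul, abs_zero]
    positivity
  have e : l ^ n - l ^ (n + 1 - m) = -(l ^ (n + 1 - m) * (1 - l ^ (m - 1))) := by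
    rw [mul_sub, ← pow_add, show n + 1 - m + (m - 1) = n by omega]
    ring
  rw [e, abs_mul, abs_neg, abs_mul, abs_pow]
  have a1 : |1 - l ^ (m - 1)| ≤ ((m : ℝ) + 1) * η := by
    have := abs_one_sub_pow_sub_le habs (m - 1)
    rw [Nat.cast_sub hm1, hl] at this
    rw [hl]
    push_cast at this
    nlinarith
  have a2 : |l| ^ (n + 1 - m) ≤ C * (2 ^ s * (1 + η * ((n + 1 : ℕ) : ℝ)) ^ (-s)) := by
    rw [hl]
    refine (abs_one_sub_pow_le hC h0 h1 _).trans ?_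
    gcongr
    exact one_add_mul_rpow_double (by linarith) h0 (by omega)
  have a3 := h.bound m
  have e2 : ((m : ℝ) + 1) ^ (-(s + 1)) * ((m : ℝ) + 1) = ((m : ℝ) + 1) ^ (-s) := by
    rw [← Real.rpow_add_one (by positivity)]; ring_nf
  calc |p m| * (|l| ^ (n + 1 - m) * |1 - l ^ (m - 1)|)
      ≤ (b * ((m : ℝ) + 1) ^ (-(s + 1))) * ((C * (2 ^ s * (1 + η * ((n + 1 : ℕ) : ℝ)) ^ (-s))) *
        (((m : ℝ) + 1) * η)) := by gcongr
    _ = _ := by rw [← e2]; ring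

lemma abs_errCoeff_le {s b θ C : ℝ} {p : ℕ → ℝ} (hs : 1 < s) (hb : 0 ≤ b)
    (hC1 : 1 ≤ C) (hC : ∀ x : ℝ, 0 ≤ x → Real.exp (-(x / 3)) ≤ C * (1 + x) ^ (-s))
    (h : SmallCoeff s b p) (h0 : 0 ≤ 1 - θ - ∑' m, p m) (h1 : 1 - θ - ∑' m, p m ≤ 3 / 2) (n : ℕ) :
    |errCoeff θ p n| ≤ (C * 2 ^ s * teleConst s + 3 * (teleConst (s + 1) * 2 ^ s)) * b *
      psi s (1 - θ - ∑' m, p m) (n + 1) := by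
  rw [errCoeff_eq (by linarith) h]
  set η := 1 - θ - ∑' m, p m with hη
  set l := θ + ∑' m, p m
  have hl : l = 1 - η := by rw [hη]; ring
  have habs : |l| ≤ 1 := by rw [hl, abs_le]; constructor <;> linarith
  have hpow : ∀ k : ℕ, |l ^ k| ≤ 1 := fun k => by
    rw [abs_pow]; exact pow_le_one₀ (abs_nonneg _) habs
  have ht := teleConst_pos (s := s) (by linarith)
  have ht1 := teleConst_pos (s := s + 1) (by linarith)
  have tail : |l ^ n * ∑' m, p (m + (n + 2))|
      ≤ b * (teleConst (s + 1) * (2 ^ s * (((n + 1 : ℕ) : ℝ) + 1) ^ (-s))) := by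
    rw [abs_mul]
    refine (mul_le_of_le_one_left (abs_nonneg _) (hpow n)).trans
      ((h.abs_tail_le (by linarith) hb _).trans ?_)
    gcongr
    exact add_one_rpow_double (by linarith) (by omega)
  have near : |∑ m ∈ (Finset.range (n + 2)).filter (fun m => 2 * m < n + 2),
      p m * (l ^ n - l ^ (n + 1 - m))| ≤
      (b * C * 2 ^ s * (η * (1 + η * ((n + 1 : ℕ) : ℝ)) ^ (-s))) * teleConst s := by
    refine (Finset.abs_sum_le_sum_abs _ _).trans ?_
    refine (Finset.sum_le_sum (g := fun m : ℕ =>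
      (b * C * 2 ^ s * (η * (1 + η * ((n + 1 : ℕ) : ℝ)) ^ (-s))) * ((m : ℝ) + 1) ^ (-s))
      fun m hm => ?_).trans ?_
    · rw [Finset.mem_filter, Finset.mem_range] at hm
      exact abs_errCoeff_term_le hs hb hC1 hC h h0 h1 hl hm.1 hm.2
    · rw [← Finset.mul_sum]
      gcongr
      exact (Finset.sum_le_sum_of_subset_of_nonneg (Finset.filter_subset _ _)
        (fun i _ _ => by positivity)).trans (sum_rpow_le hs _)
  have far : |∑ m ∈ (Finset.range (n + 2)).filter (fun m => ¬ 2 * m < n + 2),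
      p m * (l ^ n - l ^ (n + 1 - m))| ≤
      2 * (b * (teleConst (s + 1) * (2 ^ s * (((n + 1 : ℕ) : ℝ) + 1) ^ (-s)))) := by
    refine (Finset.abs_sum_le_sum_abs _ _).trans ?_
    refine (Finset.sum_le_sum (g := fun m : ℕ => 2 * (b * ((m : ℝ) + 1) ^ (-(s + 1))))
      fun m hm => ?_).trans ?_
    · rw [abs_mul]
      have := h.bound m
      have a2 : |l ^ n - l ^ (n + 1 - m)| ≤ 2 := by
        refine (abs_sub _ _).trans ?_
        linarith [hpow n, hpow (n + 1 - m)]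
      nlinarith [abs_nonneg (p m)]
    · rw [← Finset.mul_sum, ← Finset.mul_sum]
      gcongr
      refine (Finset.sum_le_sum_of_subset_of_nonneg (t := Finset.Ico ((n + 2) / 2) (n + 2))
        (fun m hm => ?_) (fun i _ _ => by positivity)).trans ((sum_Ico_rpow_le (by linarith) _ _).trans ?_)
      · rw [Finset.mem_filter, Finset.mem_range] at hm
        rw [Finset.mem_Ico]
        omega
      · gcongr
        exact add_one_rpow_double (by linarith) (by omega)
  rw [← Finset.sum_filter_add_sum_filter_not _ (fun m => 2 * m < n + 2)]
  refine (abs_add_le _ _).trans ((add_le_add (abs_add_le _ _) le_rfl).trans ?_)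
  have x1 : 0 ≤ (((n + 1 : ℕ) : ℝ) + 1) ^ (-s) := by positivity
  have x2 : 0 ≤ η * (1 + η * ((n + 1 : ℕ) : ℝ)) ^ (-s) := by positivity
  unfold psi
  have y1 : 0 ≤ C * 2 ^ s * teleConst s * b * (((n + 1 : ℕ) : ℝ) + 1) ^ (-s) := by positivity
  have y2 : 0 ≤ 3 * (teleConst (s + 1) * 2 ^ s) * b *
    (η * (1 + η * ((n + 1 : ℕ) : ℝ)) ^ (-s)) := by positivity
  nlinarith

end Wsaw

namespace Wsaw

open Finset.HasAntidiagonal (antidiagonal mem_antidiagonal)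
open PowerSeries in
lemma mk_pow_mul_one_sub (l : ℝ) :
    (mk fun n => l ^ n) * (1 - C l * X) = 1 := by
  ext n
  rw [mul_sub, mul_one, ← mul_assoc, map_sub, coeff_mk]
  cases n with
  | zero => simp
  | succ n => simp [coeff_succ_mul_X, coeff_one, pow_succ]

/-- A renewal-type recursion with one-step coefficient `θ` and remaining coefficients `p`. -/
structure ScalarRec (θ : ℝ) (p f : ℕ → ℝ) : Prop where
  intro ::
  zero : f 0 = 1
  succ : ∀ n, f (n + 1) = θ * f n + ∑ ij ∈ antidiagonal (n + 1), p ij.1 * f ij.2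

open PowerSeries in
lemma ScalarRec.mk_mul {θ : ℝ} {p f : ℕ → ℝ} (hp : p 0 = 0) (h : ScalarRec θ p f) :
    mk f * (1 - C θ * X - mk p) = 1 := by
  ext n
  rw [mul_sub, mul_sub, mul_one, ← mul_assoc, mul_comm (mk f) (mk p)]
  cases n with
  | zero => simp [h.zero, hp]
  | succ n =>
    simp only [map_sub, coeff_mk, coeff_succ_mul_X, coeff_mul_C, coeff_one,
      Nat.succ_ne_zero, if_false]
    simp only [coeff_mul, coeff_mk]
    rw [h.succ n]
    ring

open PowerSeries in
lemma mk_errCoeff {θ : ℝ} {p : ℕ → ℝ} (hp : p 0 = 0) :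
    (1 - C θ * X - mk p) * (mk fun n => (θ + ∑' m, p m) ^ n) = 1 + X * mk (errCoeff θ p) := by
  ext n
  have e : C θ * X * (mk fun n => (θ + ∑' m, p m) ^ n)
      = (mk fun n => (θ + ∑' m, p m) ^ n) * C θ * X := by ring
  rw [sub_mul, sub_mul, one_mul, e]
  cases n with
  | zero => simp [hp]
  | succ n =>
    simp only [map_sub, map_add, coeff_mk, coeff_succ_mul_X, coeff_succ_X_mul, coeff_mul_C,
      coeff_one, Nat.succ_ne_zero, if_false]
    simp only [coeff_mul, coeff_mk]
    rw [Finset.Nat.sum_antidiagonal_eq_sum_range_succ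
      (fun i j => p i * (θ + ∑' m, p m) ^ j)]
    unfold errCoeff
    ring

open PowerSeries in
lemma mk_eq_one_add_X_mul {f : ℕ → ℝ} (h : f 0 = 1) (l : ℝ) :
    mk f * (1 - C l * X) = 1 + X * mk (fun n => f (n + 1) - l * f n) := by
  ext n
  rw [mul_sub, mul_one, ← mul_assoc]
  cases n with
  | zero => simp [h]
  | succ n =>
    simp only [map_sub, map_add, coeff_mk, coeff_succ_mul_X, coeff_succ_X_mul, coeff_mul_C,
      coeff_one, Nat.succ_ne_zero, if_false]
    ring

open PowerSeries in
lemma ScalarRec.diff_mul_err {θ : ℝ} {p f : ℕ → ℝ} (hp : p 0 = 0) (h : ScalarRec θ p f) :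
    mk (fun n => f (n + 1) - (θ + ∑' m, p m) * f n) + mk (errCoeff θ p)
      + X * (mk (fun n => f (n + 1) - (θ + ∑' m, p m) * f n) * mk (errCoeff θ p)) = 0 := by
  have h1 := h.mk_mul hp
  have h2 := mk_errCoeff (θ := θ) hp
  have h3 := mk_eq_one_add_X_mul h.zero (θ + ∑' m, p m)
  have h4 := mk_pow_mul_one_sub (θ + ∑' m, p m)
  refine mul_left_cancel₀ (X_ne_zero (R := ℝ)) ?_
  have : (1 + X * mk (fun n => f (n + 1) - (θ + ∑' m, p m) * f n))
      * (1 + X * mk (errCoeff θ p)) = 1 := by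
    rw [← h3, ← h2]
    calc _ = (mk f * (1 - C θ * X - mk p)) * ((mk fun n => (θ + ∑' m, p m) ^ n) *
        (1 - C (θ + ∑' m, p m) * X)) := by ring
      _ = 1 := by rw [h1, h4, one_mul]
  linear_combination this

open PowerSeries in
lemma ScalarRec.eq_pow_add {f : ℕ → ℝ} (h : f 0 = 1) (l : ℝ) (n : ℕ) :
    f (n + 1) = l ^ (n + 1) +
      ∑ ij ∈ antidiagonal n, (f (ij.1 + 1) - l * f ij.1) * l ^ ij.2 := by
  have h3 := mk_eq_one_add_X_mul h l
  have h4 := mk_pow_mul_one_sub l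
  have : mk f = (mk fun n => l ^ n) + X * (mk (fun n => f (n + 1) - l * f n)
      * (mk fun n => l ^ n)) := by
    calc mk f = (mk f * (1 - C l * X)) * mk fun n => l ^ n := by
          rw [mul_assoc, mul_comm (1 - C l * X), h4, mul_one]
      _ = _ := by rw [h3]; ring
  have := congrArg (coeff (n + 1)) this
  rw [map_add, coeff_succ_X_mul, coeff_mul] at this
  simpa using this

lemma ScalarRec.diff_zero {θ : ℝ} {p f : ℕ → ℝ} (hp : p 0 = 0) (h : ScalarRec θ p f) :
    f 1 - (θ + ∑' m, p m) * f 0 = - errCoeff θ p 0 := by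
  have := congrArg (PowerSeries.coeff 0) (h.diff_mul_err hp)
  simp only [map_add, PowerSeries.coeff_mk, PowerSeries.coeff_zero_X_mul, map_zero] at this
  linarith

lemma ScalarRec.diff_succ {θ : ℝ} {p f : ℕ → ℝ} (hp : p 0 = 0) (h : ScalarRec θ p f) (n : ℕ) :
    f (n + 2) - (θ + ∑' m, p m) * f (n + 1) = - errCoeff θ p (n + 1)
      - ∑ ij ∈ antidiagonal n, (f (ij.1 + 1) - (θ + ∑' m, p m) * f ij.1) * errCoeff θ p ij.2 := by
  have := congrArg (PowerSeries.coeff (n + 1)) (h.diff_mul_err hp)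
  simp only [map_add, PowerSeries.coeff_mk, PowerSeries.coeff_succ_X_mul,
    map_zero] at this
  simp only [PowerSeries.coeff_mul, PowerSeries.coeff_mk] at this
  linarith

lemma sum_antidiagonal_psi_succ_le {s η : ℝ} (hs : 1 < s) (h0 : 0 ≤ η) (h1 : η ≤ 3 / 2) (n : ℕ) :
    ∑ ij ∈ antidiagonal n, psi s η (ij.1 + 1) * psi s η (ij.2 + 1)
      ≤ (2 ^ s * (4 * teleConst s)) * psi s η (n + 2) := by
  refine le_trans ?_ (sum_antidiagonal_psi_mul_le hs h0 h1 (n + 2))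
  rw [Finset.Nat.sum_antidiagonal_succ, Finset.Nat.sum_antidiagonal_succ']
  have := psi_nonneg (s := s) h0
  have a := mul_nonneg (this 0) (this (n + 2))
  have b := mul_nonneg (this (n + 2)) (this 0)
  linarith

lemma ScalarRec.abs_diff_le {s C1 b θ : ℝ} {p f : ℕ → ℝ} (hs : 1 < s) (hb : 0 ≤ b) (hC1 : 0 ≤ C1)
    (hp : p 0 = 0) (h : ScalarRec θ p f)
    (h0 : 0 ≤ 1 - θ - ∑' m, p m) (h1 : 1 - θ - ∑' m, p m ≤ 3 / 2)
    (hE : ∀ n, |errCoeff θ p n| ≤ C1 * b * psi s (1 - θ - ∑' m, p m) (n + 1))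
    (hsmall : 2 * (C1 * (2 ^ s * (4 * teleConst s))) * b ≤ 1) (n : ℕ) :
    |f (n + 1) - (θ + ∑' m, p m) * f n| ≤ 2 * (C1 * b) * psi s (1 - θ - ∑' m, p m) (n + 1) := by
  set η := 1 - θ - ∑' m, p m with hη
  have hψ := psi_nonneg (s := s) h0
  have hCb : 0 ≤ C1 * b := mul_nonneg hC1 hb
  induction n using Nat.strong_induction_on with
  | _ n ih =>
    cases n with
    | zero =>
      rw [h.diff_zero hp, abs_neg]
      refine (hE 0).trans ?_
      nlinarith [hψ 1, mul_nonneg hCb (hψ (0 + 1))]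
    | succ n =>
      rw [h.diff_succ hp]
      refine (abs_sub _ _).trans ?_
      rw [abs_neg]
      have key : |∑ ij ∈ antidiagonal n, (f (ij.1 + 1) - (θ + ∑' m, p m) * f ij.1) *
          errCoeff θ p ij.2| ≤ C1 * b * psi s η (n + 2) := by
        refine (Finset.abs_sum_le_sum_abs _ _).trans ?_
        refine (Finset.sum_le_sum (g := fun ij : ℕ × ℕ => 2 * (C1 * b) * (C1 * b) *
          (psi s η (ij.1 + 1) * psi s η (ij.2 + 1))) fun ij hij => ?_).trans ?_
        · have hij := mem_antidiagonal.1 hij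
          rw [abs_mul]
          have a := ih ij.1 (by omega)
          have a' := hE ij.2
          have := mul_le_mul a a' (abs_nonneg _) ((abs_nonneg _).trans a)
          linarith
        · rw [← Finset.mul_sum]
          have := sum_antidiagonal_psi_succ_le hs h0 h1 n
          have t := mul_le_mul_of_nonneg_left this (by positivity : 0 ≤ 2 * (C1 * b) * (C1 * b))
          refine t.trans ?_
          have t2 := mul_le_mul_of_nonneg_right hsmall (mul_nonneg hCb (hψ (n + 2)))
          nlinarith
      have := hE (n + 1)
      rw [show n + 1 + 1 = n + 2 by omega] at *
      linarith

lemma psi_mul_sum_pow_le {s η : ℝ} (hs : 1 < s) (h0 : 0 ≤ η) (h1 : η ≤ 3 / 2) (n : ℕ) :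
    psi s η (n + 1) * ∑ j ∈ Finset.range (n + 1), (1 + η * j) ^ (-s)
      ≤ ((3 / 2) ^ (s - 1) * (1 + teleConst s) + teleConst s)
        * (1 + η * ((n + 1 : ℕ) : ℝ)) ^ (-s) := by
  set S := ∑ j ∈ Finset.range (n + 1), (1 + η * j) ^ (-s) with hS
  have hT := teleConst_pos hs
  have S0 : 0 ≤ S := Finset.sum_nonneg fun i _ => by positivity
  have S1 : S ≤ n + 1 := by
    have : S ≤ ∑ j ∈ Finset.range (n + 1), (1 : ℝ) := Finset.sum_le_sum fun i _ =>
      Real.rpow_le_one_of_one_le_of_nonpos (by nlinarith [Nat.cast_nonneg (α := ℝ) i]) (by linarith)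
    simpa using this
  have S2 : η * S ≤ teleConst s := by
    rw [hS, Finset.mul_sum]; exact sum_mul_rpow_le hs h0 h1 _
  set x := 1 + η * ((n + 1 : ℕ) : ℝ) with hx
  have hx0 : 0 < x := by positivity
  have hxs : 0 < x ^ (-s) := by positivity
  set y := (((n + 1 : ℕ) : ℝ) + 1) with hy
  have hy0 : 0 < y := by positivity
  have key : y ^ (-s) * S ≤ (3 / 2) ^ (s - 1) * (1 + teleConst s) * x ^ (-s) := by
    have t1 : x / y ≤ 3 / 2 := by
      rw [div_le_iff₀ hy0, hx, hy]
      nlinarith [Nat.cast_nonneg (α := ℝ) (n + 1)]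
    have t2 : y ^ (-s) = (x / y) ^ (s - 1) * (x / y) * x ^ (-s) := by
      rw [← Real.rpow_add_one (by positivity), sub_add_cancel, Real.div_rpow hx0.le hy0.le,
        Real.rpow_neg hx0.le, Real.rpow_neg hy0.le]
      field_simp
    have t3 : x / y * S ≤ 1 + teleConst s := by
      rw [div_mul_eq_mul_div, div_le_iff₀ hy0, hx, hy]
      push_cast
      nlinarith [Nat.cast_nonneg (α := ℝ) n]
    have t4 : (x / y) ^ (s - 1) ≤ (3 / 2) ^ (s - 1) :=
      Real.rpow_le_rpow (by positivity) t1 (by linarith)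
    rw [t2]
    calc _ = (x / y) ^ (s - 1) * (x / y * S) * x ^ (-s) := by ring
      _ ≤ _ := by gcongr
  have e : psi s η (n + 1) * S = y ^ (-s) * S + η * S * x ^ (-s) := by
    unfold psi; ring
  rw [e]
  nlinarith

end Wsaw

namespace Wsaw

open Finset.HasAntidiagonal (antidiagonal mem_antidiagonal)

lemma sum_range_psi_succ_le {s η : ℝ} (hs : 1 < s) (h0 : 0 ≤ η) (h1 : η ≤ 3 / 2) (n : ℕ) :
    ∑ j ∈ Finset.range n, psi s η (j + 1) ≤ 2 * teleConst s := by
  refine le_trans ?_ (sum_psi_le hs h0 h1 (n + 1))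
  rw [Finset.sum_range_succ']
  linarith [psi_nonneg (s := s) h0 0]

/-- Uniform control of a renewal-type recursion with small, summable memory. -/
theorem ScalarRec.exists_bound {s : ℝ} (hs : 1 < s) : ∃ C b0 : ℝ, 1 ≤ C ∧ 0 < b0 ∧
    ∀ (b θ : ℝ) (p f : ℕ → ℝ), 0 ≤ b → b ≤ b0 → SmallCoeff s b p → ScalarRec θ p f →
      0 ≤ 1 - θ - ∑' m, p m → 1 - θ - ∑' m, p m ≤ 3 / 2 → ∀ n : ℕ,
      |f n| ≤ 1 + C * b ∧ |f n| ≤ C * (1 + (1 - θ - ∑' m, p m) * n) ^ (-s) ∧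
      |f (n + 1) - (θ + ∑' m, p m) * f n| ≤ C * b * psi s (1 - θ - ∑' m, p m) (n + 1) := by
  obtain ⟨CE, hCE1, hCE⟩ := exists_one_add_rpow_le_exp s (by linarith)
  have hT := teleConst_pos (s := s) (by linarith)
  have hT1 := teleConst_pos (s := s + 1) (by linarith)
  set C1 := CE * 2 ^ s * teleConst s + 3 * (teleConst (s + 1) * 2 ^ s) with hC1
  have hC1pos : 0 < C1 := by positivity
  set P := (3 / 2 : ℝ) ^ (s - 1) * (1 + teleConst s) + teleConst s with hP
  have hPpos : 0 < P := by positivity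
  set b0 := (2 * (C1 * (2 ^ s * (4 * teleConst s))))⁻¹ with hb0
  have hb0pos : 0 < b0 := by positivity
  set C2 := CE + 2 * C1 * b0 * (CE * 2 ^ s * (2 * teleConst s) + 2 ^ s * CE * P) with hC2
  refine ⟨C2 + 4 * C1 * teleConst s + 2 * C1, b0, ?_, hb0pos, ?_⟩
  · have : 0 ≤ 2 * C1 * b0 * (CE * 2 ^ s * (2 * teleConst s) + 2 ^ s * CE * P) := by positivity
    have : 0 < C1 * teleConst s := by positivity
    linarith
  intro b θ p f hb hbb hp hf h0 h1 n
  set η := 1 - θ - ∑' m, p m with hη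
  have hψ := psi_nonneg (s := s) h0
  have hC2pos : 0 < C2 := by
    rw [hC2]; positivity
  have hsmall : 2 * (C1 * (2 ^ s * (4 * teleConst s))) * b ≤ 1 := by
    calc _ ≤ 2 * (C1 * (2 ^ s * (4 * teleConst s))) * b0 := by gcongr
      _ = 1 := by rw [hb0]; field_simp
  have hdiff := hf.abs_diff_le hs hb hC1pos.le hp.zero h0 h1
    (abs_errCoeff_le hs hb hCE1 hCE hp h0 h1) hsmall
  set l := θ + ∑' m, p m with hl
  have hl' : l = 1 - η := by rw [hη, hl]; ring
  have hpow : ∀ k : ℕ, |l| ^ k ≤ 1 := fun k => pow_le_one₀ (abs_nonneg _)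
    (by rw [hl', abs_le]; constructor <;> linarith)
  have hpow' : ∀ k : ℕ, |l| ^ k ≤ CE * (1 + η * k) ^ (-s) := fun k => by
    rw [hl']; exact abs_one_sub_pow_le hCE h0 h1 k
  have hx : ∀ k : ℕ, 0 ≤ (1 + η * (k : ℝ)) ^ (-s) := fun k => by positivity
  refine ⟨?_, ?_, ?_⟩
  · have : |f n| ≤ 1 + 4 * C1 * teleConst s * b := by
      cases n with
      | zero => rw [hf.zero, abs_one]; have : 0 ≤ 4 * C1 * teleConst s * b := by positivity
                linarith
      | succ n =>
        rw [ScalarRec.eq_pow_add hf.zero l n]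
        refine (abs_add_le _ _).trans ?_
        rw [abs_pow]
        refine add_le_add (hpow _) ((Finset.abs_sum_le_sum_abs _ _).trans ?_)
        refine (Finset.sum_le_sum (g := fun ij : ℕ × ℕ => 2 * (C1 * b) * psi s η (ij.1 + 1))
          fun ij _ => ?_).trans ?_
        · rw [abs_mul, abs_pow]
          exact (mul_le_of_le_one_right (abs_nonneg _) (hpow _)).trans (hdiff _)
        · rw [← Finset.mul_sum, sum_antidiagonal_fst (fun i => psi s η (i + 1))]
          have := mul_le_mul_of_nonneg_left (sum_range_psi_succ_le hs h0 h1 (n + 1))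
            (by positivity : 0 ≤ 2 * (C1 * b))
          linarith
    refine this.trans ?_
    have : 0 ≤ (C2 + 2 * C1) * b := by positivity
    linarith
  · have : |f n| ≤ C2 * (1 + η * n) ^ (-s) := by
      cases n with
      | zero =>
        rw [hf.zero, abs_one]
        simp only [CharP.cast_eq_zero, mul_zero, add_zero, Real.one_rpow, mul_one]
        have : 0 ≤ 2 * C1 * b0 * (CE * 2 ^ s * (2 * teleConst s) + 2 ^ s * CE * P) := by
          positivity
        linarith
      | succ n =>
        rw [ScalarRec.eq_pow_add hf.zero l n]
        refine (abs_add_le _ _).trans ?_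
        rw [abs_pow, hC2, add_mul]
        refine add_le_add (hpow' _) ((Finset.abs_sum_le_sum_abs _ _).trans ?_)
        set X := (1 + η * ((n + 1 : ℕ) : ℝ)) ^ (-s) with hX
        refine (Finset.sum_le_sum (g := fun ij : ℕ × ℕ => 2 * (C1 * b) *
          ((CE * 2 ^ s * X) * psi s η (ij.1 + 1)
            + (2 ^ s * psi s η (n + 1) * CE) * (1 + η * ij.2) ^ (-s))) fun ij hij => ?_).trans ?_
        · have hij := mem_antidiagonal.1 hij
          rw [abs_mul, abs_pow]
          have a := hdiff ij.1
          have a' := hpow' ij.2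
          have t := mul_le_mul a a' (pow_nonneg (abs_nonneg _) _) ((abs_nonneg _).trans a)
          refine t.trans ?_
          rw [mul_assoc]
          gcongr
          have X0 : 0 ≤ X := by positivity
          have Y1 : 0 ≤ (CE * 2 ^ s * X) * psi s η (ij.1 + 1) := mul_nonneg (by positivity) (hψ _)
          have Y2 : 0 ≤ (2 ^ s * psi s η (n + 1) * CE) * (1 + η * (ij.2 : ℝ)) ^ (-s) :=
            mul_nonneg (mul_nonneg (mul_nonneg (by positivity) (hψ _)) (by positivity)) (hx _)
          rcases le_total (ij.1 + 1) ij.2 with h | h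
          · have := one_add_mul_rpow_double (s := s) (by linarith) h0
              (show n + 1 ≤ 2 * ij.2 by omega)
            have := mul_le_mul_of_nonneg_left this
              (mul_nonneg (by positivity : 0 ≤ CE) (hψ (ij.1 + 1)))
            linarith
          · have := psi_double (s := s) (by linarith) h0
              (show n + 1 ≤ 2 * (ij.1 + 1) by omega)
            have := mul_le_mul_of_nonneg_left this
              (mul_nonneg (by positivity : 0 ≤ CE) (hx ij.2))
            linarith
        · rw [← Finset.mul_sum, Finset.sum_add_distrib, ← Finset.mul_sum, ← Finset.mul_sum,
            sum_antidiagonal_fst (fun i => psi s η (i + 1)),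
            sum_antidiagonal_snd (fun i => (1 + η * (i : ℝ)) ^ (-s))]
          have u1 := mul_le_mul_of_nonneg_left (sum_range_psi_succ_le hs h0 h1 (n + 1))
            (by positivity : 0 ≤ CE * 2 ^ s * X)
          have u2 := mul_le_mul_of_nonneg_left (psi_mul_sum_pow_le hs h0 h1 n)
            (by positivity : 0 ≤ 2 ^ s * CE)
          calc _ ≤ 2 * (C1 * b) * ((CE * 2 ^ s * (2 * teleConst s) + 2 ^ s * CE * P) * X) := by
                gcongr
                linarith
            _ ≤ 2 * (C1 * b0) * ((CE * 2 ^ s * (2 * teleConst s) + 2 ^ s * CE * P) * X) := by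
                gcongr
            _ = _ := by ring
    refine this.trans ?_
    have := hx n
    gcongr
    have : 0 ≤ 4 * C1 * teleConst s + 2 * C1 := by positivity
    linarith
  · refine (hdiff n).trans ?_
    have := hψ (n + 1)
    rw [← mul_assoc]
    gcongr
    have : 0 ≤ 4 * C1 * teleConst s := by positivity
    linarith

end Wsaw

namespace Wsaw

section Lace

variable {X : Type*} [DecidableEq X]

/-- The factor `1 + β U_{ab}` of a path. -/
noncomputable def wI (β : ℝ) (ω : ℕ → X) (a b : ℕ) : ℝ := 1 - β * if ω a = ω b then 1 else 0

/-- The interaction of a path over `[t, n]`. -/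
noncomputable def wK (β : ℝ) (ω : ℕ → X) (t n : ℕ) : ℝ :=
  ∏ b ∈ Finset.Ioc t n, ∏ a ∈ Finset.Ico t b, wI β ω a b

/-- The interaction between `[p, t)` and `(t, n]`. -/
noncomputable def wC (β : ℝ) (ω : ℕ → X) (p t n : ℕ) : ℝ :=
  ∏ b ∈ Finset.Ioc t n, ∏ a ∈ Finset.Ico p t, wI β ω a b

/-- The contribution of the first time `b` after `t` closing a connection to `[p, t)`. -/
noncomputable def wY (β : ℝ) (ω : ℕ → X) (p t b : ℕ) : ℝ :=
  wC β ω p t (b - 1) * (∏ a ∈ Finset.Ico p t, wI β ω a b - 1) * wK β ω t b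

/-- The irreducible part of the interaction, as a sum over chains of connections. -/
noncomputable def wV (β : ℝ) (ω : ℕ → X) (p t m : ℕ) : ℝ :=
  wY β ω p t m + ∑ b ∈ (Finset.Ioo t m).attach, wY β ω p t b * wV β ω t b m
termination_by m - t
decreasing_by
  have := Finset.mem_Ioo.1 b.2
  omega

/-- A nonnegative majorant of the irreducible part, with a prescribed intersection point. -/
noncomputable def wTheta (β : ℝ) (ω : ℕ → X) (t m : ℕ) (u : X) : ℝ :=
  (β * if ω m = u then 1 else 0) * wK β ω t m +
    ∑ b ∈ (Finset.Ioo t m).attach, (β * if ω b = u then 1 else 0) * wK β ω t b *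
      ∑ a ∈ Finset.Ico t b, wTheta β ω b m (ω a)
termination_by m - t
decreasing_by
  have := Finset.mem_Ioo.1 b.2
  omega

lemma wV_eq (β : ℝ) (ω : ℕ → X) (p t m : ℕ) :
    wV β ω p t m = wY β ω p t m + ∑ b ∈ Finset.Ioo t m, wY β ω p t b * wV β ω t b m := by
  rw [wV, Finset.sum_attach (Finset.Ioo t m) (fun b => wY β ω p t b * wV β ω t b m)]

lemma wTheta_eq (β : ℝ) (ω : ℕ → X) (t m : ℕ) (u : X) :
    wTheta β ω t m u = (β * if ω m = u then 1 else 0) * wK β ω t m +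
      ∑ b ∈ Finset.Ioo t m, (β * if ω b = u then 1 else 0) * wK β ω t b *
        ∑ a ∈ Finset.Ico t b, wTheta β ω b m (ω a) := by
  rw [wTheta, Finset.sum_attach (Finset.Ioo t m) (fun b => (β * if ω b = u then 1 else 0) *
    wK β ω t b * ∑ a ∈ Finset.Ico t b, wTheta β ω b m (ω a))]

variable {β : ℝ}

lemma wI_nonneg (hβ1 : β ≤ 1) (ω : ℕ → X) (a b : ℕ) : 0 ≤ wI β ω a b := by
  unfold wI; split_ifs <;> linarith

lemma wI_le_one (hβ : 0 ≤ β) (ω : ℕ → X) (a b : ℕ) : wI β ω a b ≤ 1 := by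
  unfold wI; split_ifs <;> linarith

lemma wK_nonneg (hβ1 : β ≤ 1) (ω : ℕ → X) (t n : ℕ) : 0 ≤ wK β ω t n :=
  Finset.prod_nonneg fun _ _ => Finset.prod_nonneg fun _ _ => wI_nonneg hβ1 _ _ _

lemma wK_le_one (hβ : 0 ≤ β) (hβ1 : β ≤ 1) (ω : ℕ → X) (t n : ℕ) : wK β ω t n ≤ 1 :=
  Finset.prod_le_one (fun _ _ => Finset.prod_nonneg fun _ _ => wI_nonneg hβ1 _ _ _) fun _ _ =>
    Finset.prod_le_one (fun _ _ => wI_nonneg hβ1 _ _ _) fun _ _ => wI_le_one hβ _ _ _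

lemma wC_nonneg (hβ1 : β ≤ 1) (ω : ℕ → X) (p t n : ℕ) : 0 ≤ wC β ω p t n :=
  Finset.prod_nonneg fun _ _ => Finset.prod_nonneg fun _ _ => wI_nonneg hβ1 _ _ _

lemma wC_le_one (hβ : 0 ≤ β) (hβ1 : β ≤ 1) (ω : ℕ → X) (p t n : ℕ) : wC β ω p t n ≤ 1 :=
  Finset.prod_le_one (fun _ _ => Finset.prod_nonneg fun _ _ => wI_nonneg hβ1 _ _ _) fun _ _ =>
    Finset.prod_le_one (fun _ _ => wI_nonneg hβ1 _ _ _) fun _ _ => wI_le_one hβ _ _ _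

lemma wK_split (ω : ℕ → X) {t b n : ℕ} (htb : t ≤ b) (hbn : b ≤ n) :
    wK β ω t n = wK β ω t b * (wK β ω b n * wC β ω t b n) := by
  unfold wK wC
  rw [← Finset.prod_mul_distrib, ← Finset.prod_Ioc_consecutive _ htb hbn]
  congr 1
  refine Finset.prod_congr rfl fun c hc => ?_
  rw [mul_comm, Finset.prod_Ico_consecutive _ htb (Finset.mem_Ioc.1 hc).1.le]

lemma wK_le_mul (hβ : 0 ≤ β) (hβ1 : β ≤ 1) (ω : ℕ → X) {t b n : ℕ} (htb : t ≤ b) (hbn : b ≤ n) :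
    wK β ω t n ≤ wK β ω t b * wK β ω b n := by
  rw [wK_split ω htb hbn]
  exact mul_le_mul_of_nonneg_left (mul_le_of_le_one_right (wK_nonneg hβ1 _ _ _)
    (wC_le_one hβ hβ1 _ _ _ _)) (wK_nonneg hβ1 _ _ _)

lemma prod_Ioc_shift (f : ℕ → ℝ) (t n j : ℕ) :
    ∏ b ∈ Finset.Ioc (t + j) (n + j), f b = ∏ b ∈ Finset.Ioc t n, f (b + j) := by
  rw [← Finset.image_add_right_Ioc, Finset.prod_image fun _ _ _ _ h => by simpa using h]

lemma prod_Ico_shift (f : ℕ → ℝ) (t n j : ℕ) :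
    ∏ b ∈ Finset.Ico (t + j) (n + j), f b = ∏ b ∈ Finset.Ico t n, f (b + j) := by
  rw [← Finset.image_add_right_Ico, Finset.prod_image fun _ _ _ _ h => by simpa using h]

lemma sum_Ico_shift (f : ℕ → ℝ) (t n j : ℕ) :
    ∑ b ∈ Finset.Ico (t + j) (n + j), f b = ∑ b ∈ Finset.Ico t n, f (b + j) := by
  rw [← Finset.image_add_right_Ico, Finset.sum_image fun _ _ _ _ h => by simpa using h]

lemma sum_Ioo_shift (f : ℕ → ℝ) (t n j : ℕ) :
    ∑ b ∈ Finset.Ioo (t + j) (n + j), f b = ∑ b ∈ Finset.Ioo t n, f (b + j) := by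
  rw [← Finset.image_add_right_Ioo, Finset.sum_image fun _ _ _ _ h => by simpa using h]

lemma wK_shift {Y : Type*} [DecidableEq Y] {ω : ℕ → X} {ω' : ℕ → Y} {j t n : ℕ}
    (h : ∀ a b, t ≤ a → a ≤ n → t ≤ b → b ≤ n → (ω' (a + j) = ω' (b + j) ↔ ω a = ω b)) :
    wK β ω' (t + j) (n + j) = wK β ω t n := by
  unfold wK
  rw [prod_Ioc_shift]
  refine Finset.prod_congr rfl fun b hb => ?_
  rw [prod_Ico_shift]
  refine Finset.prod_congr rfl fun a ha => ?_
  have hb := Finset.mem_Ioc.1 hb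
  have ha := Finset.mem_Ico.1 ha
  simp only [wI, h a b ha.1 (by omega) hb.1.le hb.2]

lemma wTheta_shift {Y : Type*} [DecidableEq Y] {ω : ℕ → X} {ω' : ℕ → Y} {j t n : ℕ} {u : X} {u' : Y}
    (h : ∀ a b, t ≤ a → a ≤ n → t ≤ b → b ≤ n → (ω' (a + j) = ω' (b + j) ↔ ω a = ω b))
    (hu : ∀ b, t ≤ b → b ≤ n → (ω' (b + j) = u' ↔ ω b = u)) (htn : t ≤ n) :
    wTheta β ω' (t + j) (n + j) u' = wTheta β ω t n u := by
  induction hk : n - t using Nat.strong_induction_on generalizing t u u' with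
  | _ k ih =>
    rw [wTheta_eq, wTheta_eq, wK_shift h, sum_Ioo_shift]
    simp only [hu n htn le_rfl]
    congr 1
    refine Finset.sum_congr rfl fun b hb => ?_
    have hb := Finset.mem_Ioo.1 hb
    rw [wK_shift fun c d h1 h2 h3 h4 => h c d h1 (by omega) h3 (by omega), sum_Ico_shift]
    simp only [hu b hb.1.le hb.2.le]
    congr 1
    refine Finset.sum_congr rfl fun a ha => ?_
    have ha := Finset.mem_Ico.1 ha
    exact ih (n - b) (by omega) (fun c d h1 h2 h3 h4 => h c d (by omega) h2 (by omega) h4)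
      (fun c h1 h2 => h c a (by omega) h2 ha.1 (by omega)) hb.2.le rfl

lemma wC_congr {ω ω' : ℕ → X} {p t n : ℕ} (h : ∀ a ≤ n, ω' a = ω a) :
    wC β ω' p t n = wC β ω p t n := by
  unfold wC
  refine Finset.prod_congr rfl fun b hb => Finset.prod_congr rfl fun a ha => ?_
  have hb := Finset.mem_Ioc.1 hb
  have ha := Finset.mem_Ico.1 ha
  simp only [wI, h a (by omega), h b hb.2]

lemma wY_congr {ω ω' : ℕ → X} {p t n : ℕ} (htn : t ≤ n) (h : ∀ a ≤ n, ω' a = ω a) :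
    wY β ω' p t n = wY β ω p t n := by
  unfold wY
  have hK : wK β ω' t n = wK β ω t n := wK_shift (j := 0) fun a b _ h2 _ h4 => by
    simp only [add_zero, h a h2, h b h4]
  have hP : ∏ a ∈ Finset.Ico p t, wI β ω' a n = ∏ a ∈ Finset.Ico p t, wI β ω a n :=
    Finset.prod_congr rfl fun a ha => by
      have ha := Finset.mem_Ico.1 ha
      simp only [wI, h a (by omega), h n le_rfl]
  rw [hK, hP, wC_congr fun a ha => h a (by omega)]

lemma wV_congr {ω ω' : ℕ → X} {p t n : ℕ} (htn : t ≤ n) (h : ∀ a ≤ n, ω' a = ω a) :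
    wV β ω' p t n = wV β ω p t n := by
  induction hk : n - t using Nat.strong_induction_on generalizing p t with
  | _ k ih =>
    rw [wV_eq, wV_eq, wY_congr htn h]
    congr 1
    refine Finset.sum_congr rfl fun b hb => ?_
    have hb := Finset.mem_Ioo.1 hb
    rw [wY_congr hb.1.le fun a ha => h a (by omega), ih (n - b) (by omega) hb.2.le rfl]

lemma wC_telescope (ω : ℕ → X) {p t n : ℕ} (h : t ≤ n) :
    wC β ω p t n = 1 + ∑ b ∈ Finset.Ioc t n,
      wC β ω p t (b - 1) * (∏ a ∈ Finset.Ico p t, wI β ω a b - 1) := by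
  induction n, h using Nat.le_induction with
  | base => simp [wC]
  | succ n hn ih =>
    rw [Finset.sum_Ioc_succ_top hn, ← add_assoc, ← ih, Nat.add_sub_cancel]
    unfold wC
    rw [Finset.prod_Ioc_succ_top hn]
    ring

lemma wK_mul_wC_eq (ω : ℕ → X) {p t n : ℕ} (h : t ≤ n) :
    wK β ω t n * wC β ω p t n = wK β ω t n +
      ∑ b ∈ Finset.Ioc t n, wY β ω p t b * (wK β ω b n * wC β ω t b n) := by
  rw [wC_telescope ω h, mul_add, mul_one, Finset.mul_sum]
  congr 1
  refine Finset.sum_congr rfl fun b hb => ?_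
  have hb := Finset.mem_Ioc.1 hb
  rw [wK_split ω hb.1.le hb.2, wY]
  ring

/-- The pathwise lace identity. -/
lemma wK_mul_wC_eq_sum_wV (ω : ℕ → X) {p t n : ℕ} (h : t ≤ n) :
    wK β ω t n * wC β ω p t n = wK β ω t n +
      ∑ m ∈ Finset.Ioc t n, wV β ω p t m * wK β ω m n := by
  induction hk : n - t using Nat.strong_induction_on generalizing p t with
  | _ k ih =>
    rw [wK_mul_wC_eq ω h]
    congr 1
    have e1 : ∀ b ∈ Finset.Ioc t n, wY β ω p t b * (wK β ω b n * wC β ω t b n)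
        = wY β ω p t b * wK β ω b n +
          ∑ m ∈ Finset.Ioc b n, wY β ω p t b * (wV β ω t b m * wK β ω m n) := by
      intro b hb
      have hb := Finset.mem_Ioc.1 hb
      rw [ih (n - b) (by omega) hb.2 rfl, mul_add, Finset.mul_sum]
    rw [Finset.sum_congr rfl e1, Finset.sum_add_distrib]
    have e2 : ∀ m ∈ Finset.Ioc t n, wV β ω p t m * wK β ω m n = wY β ω p t m * wK β ω m n +
        ∑ b ∈ Finset.Ioo t m, wY β ω p t b * (wV β ω t b m * wK β ω m n) := by
      intro m _
      rw [wV_eq, add_mul, Finset.sum_mul]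
      simp only [mul_assoc]
    rw [Finset.sum_congr rfl e2, Finset.sum_add_distrib]
    congr 1
    refine Finset.sum_comm' fun x y => ?_
    simp only [Finset.mem_Ioc, Finset.mem_Ioo]
    omega

lemma one_sub_prod_le {ι : Type*} (s : Finset ι) (f : ι → ℝ) (h0 : ∀ i ∈ s, 0 ≤ f i)
    (h1 : ∀ i ∈ s, f i ≤ 1) : 1 - ∏ i ∈ s, f i ≤ ∑ i ∈ s, (1 - f i) := by
  classical
  induction s using Finset.induction_on with
  | empty => simp
  | insert a s ha ih =>
    rw [Finset.prod_insert ha, Finset.sum_insert ha]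
    have i := ih (fun i hi => h0 i (Finset.mem_insert_of_mem hi))
      (fun i hi => h1 i (Finset.mem_insert_of_mem hi))
    have p1 : ∏ i ∈ s, f i ≤ 1 := Finset.prod_le_one
      (fun i hi => h0 i (Finset.mem_insert_of_mem hi))
      (fun i hi => h1 i (Finset.mem_insert_of_mem hi))
    have a0 := h0 a (Finset.mem_insert_self _ _)
    have a1 := h1 a (Finset.mem_insert_self _ _)
    nlinarith

lemma abs_wY_le (hβ : 0 ≤ β) (hβ1 : β ≤ 1) (ω : ℕ → X) (p t b : ℕ) :
    |wY β ω p t b| ≤ ∑ a ∈ Finset.Ico p t, (β * if ω b = ω a then 1 else 0) * wK β ω t b := by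
  unfold wY
  rw [abs_mul, abs_mul, abs_of_nonneg (wC_nonneg hβ1 _ _ _ _), abs_of_nonneg (wK_nonneg hβ1 _ _ _),
    ← Finset.sum_mul]
  refine mul_le_mul_of_nonneg_right ?_ (wK_nonneg hβ1 _ _ _)
  refine (mul_le_of_le_one_left (abs_nonneg _) (wC_le_one hβ hβ1 _ _ _ _)).trans ?_
  rw [abs_sub_comm, abs_of_nonneg]
  · refine (one_sub_prod_le _ _ (fun _ _ => wI_nonneg hβ1 _ _ _)
      (fun _ _ => wI_le_one hβ _ _ _)).trans (le_of_eq ?_)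
    refine Finset.sum_congr rfl fun a _ => ?_
    simp [wI, eq_comm]
  · rw [sub_nonneg]
    exact Finset.prod_le_one (fun _ _ => wI_nonneg hβ1 _ _ _) (fun _ _ => wI_le_one hβ _ _ _)

lemma wTheta_nonneg (hβ : 0 ≤ β) (hβ1 : β ≤ 1) (ω : ℕ → X) (t m : ℕ) (u : X) :
    0 ≤ wTheta β ω t m u := by
  induction hk : m - t using Nat.strong_induction_on generalizing t u with
  | _ k ih =>
    rw [wTheta_eq]
    have i0 : ∀ b, 0 ≤ (β * if ω b = u then 1 else 0) := fun b => by split_ifs <;> simp [hβ]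
    refine add_nonneg (mul_nonneg (i0 m) (wK_nonneg hβ1 _ _ _))
      (Finset.sum_nonneg fun b hb => ?_)
    have hb := Finset.mem_Ioo.1 hb
    exact mul_nonneg (mul_nonneg (i0 b) (wK_nonneg hβ1 _ _ _)) (Finset.sum_nonneg fun a _ =>
      ih (m - b) (by omega) b _ rfl)

lemma abs_wV_le (hβ : 0 ≤ β) (hβ1 : β ≤ 1) (ω : ℕ → X) (p t m : ℕ) :
    |wV β ω p t m| ≤ ∑ a ∈ Finset.Ico p t, wTheta β ω t m (ω a) := by
  induction hk : m - t using Nat.strong_induction_on generalizing p t with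
  | _ k ih =>
    rw [wV_eq]
    simp only [wTheta_eq β ω t m]
    rw [Finset.sum_add_distrib]
    refine (abs_add_le _ _).trans (add_le_add (abs_wY_le hβ hβ1 _ _ _ _) ?_)
    rw [Finset.sum_comm]
    refine (Finset.abs_sum_le_sum_abs _ _).trans (Finset.sum_le_sum fun b hb => ?_)
    have hb := Finset.mem_Ioo.1 hb
    rw [abs_mul, ← Finset.sum_mul]
    exact mul_le_mul (abs_wY_le hβ hβ1 _ _ _ _) (ih (m - b) (by omega) t b rfl) (abs_nonneg _)
      ((abs_nonneg _).trans (abs_wY_le hβ hβ1 _ _ _ _))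

end Lace

end Wsaw

namespace Wsaw

open Finset.HasAntidiagonal (antidiagonal mem_antidiagonal)

variable {d : ℕ} {β : ℝ}

/-- The sum of `F` over all `n`-step walks from the origin. -/
noncomputable def walkSum (d n : ℕ) (F : (ℕ → Fin d → ℤ) → ℝ) : ℝ :=
  ∑ s : Fin n → Fin d × Bool, F (wsawPos s)

/-- Concatenation of an `m`-step path with another path. -/
def cat (m : ℕ) (ω η : ℕ → Fin d → ℤ) (k : ℕ) : Fin d → ℤ := if k ≤ m then ω k else ω m + η (k - m)

lemma wsawPos_zero {n : ℕ} (s : Fin n → Fin d × Bool) : wsawPos s 0 = 0 := by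
  simp [wsawPos]

lemma wsawPos_eq_sum {n : ℕ} (s : Fin n → Fin d × Bool) (k : ℕ) :
    wsawPos s k = ∑ j : Fin n, if (j : ℕ) < k then wsawStep d (s j) else 0 := by
  rw [wsawPos, Finset.sum_filter]

lemma wsawPos_append {m n : ℕ} (s : Fin m → Fin d × Bool) (t : Fin n → Fin d × Bool) :
    wsawPos (Fin.append s t) = cat m (wsawPos s) (wsawPos t) := by
  funext k
  unfold cat
  simp only [wsawPos_eq_sum, Fin.sum_univ_add, Fin.append_left, Fin.append_right,
    Fin.val_castAdd, Fin.val_natAdd]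
  split_ifs with h
  · rw [add_eq_left]
    exact Finset.sum_eq_zero fun j _ => if_neg (by omega)
  · congr 1
    · refine Finset.sum_congr rfl fun j _ => ?_
      rw [if_pos (by omega), if_pos j.2]
    · refine Finset.sum_congr rfl fun j _ => ?_
      congr 1
      exact propext (by omega)

lemma walkSum_add {m n N : ℕ} (h : m + n = N) (F : (ℕ → Fin d → ℤ) → ℝ) :
    walkSum d N F = walkSum d m fun ω => walkSum d n fun η => F (cat m ω η) := by
  subst h
  unfold walkSum
  rw [← (Fin.appendEquiv m n).sum_comp, Fintype.sum_prod_type]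
  refine Finset.sum_congr rfl fun s _ => Finset.sum_congr rfl fun t _ => ?_
  exact congrArg F (wsawPos_append s t)

lemma walkSum_congr {n : ℕ} {F G : (ℕ → Fin d → ℤ) → ℝ}
    (h : ∀ s : Fin n → Fin d × Bool, F (wsawPos s) = G (wsawPos s)) :
    walkSum d n F = walkSum d n G := Finset.sum_congr rfl fun s _ => h s

lemma walkSum_mono {n : ℕ} {F G : (ℕ → Fin d → ℤ) → ℝ}
    (h : ∀ s : Fin n → Fin d × Bool, F (wsawPos s) ≤ G (wsawPos s)) :
    walkSum d n F ≤ walkSum d n G := Finset.sum_le_sum fun s _ => h s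

lemma walkSum_nonneg {n : ℕ} {F : (ℕ → Fin d → ℤ) → ℝ}
    (h : ∀ s : Fin n → Fin d × Bool, 0 ≤ F (wsawPos s)) :
    0 ≤ walkSum d n F := Finset.sum_nonneg fun s _ => h s

lemma abs_walkSum_le {n : ℕ} (F : (ℕ → Fin d → ℤ) → ℝ) :
    |walkSum d n F| ≤ walkSum d n fun ω => |F ω| := Finset.abs_sum_le_sum_abs _ _

lemma walkSum_mul_left {n : ℕ} (c : ℝ) (F : (ℕ → Fin d → ℤ) → ℝ) :
    walkSum d n (fun ω => c * F ω) = c * walkSum d n F := (Finset.mul_sum _ _ _).symm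

lemma walkSum_mul_right {n : ℕ} (c : ℝ) (F : (ℕ → Fin d → ℤ) → ℝ) :
    walkSum d n (fun ω => F ω * c) = walkSum d n F * c := (Finset.sum_mul _ _ _).symm

lemma walkSum_add_fun {n : ℕ} (F G : (ℕ → Fin d → ℤ) → ℝ) :
    walkSum d n (fun ω => F ω + G ω) = walkSum d n F + walkSum d n G := Finset.sum_add_distrib

lemma walkSum_finset_sum {ι : Type*} {n : ℕ} (S : Finset ι) (F : ι → (ℕ → Fin d → ℤ) → ℝ) :
    walkSum d n (fun ω => ∑ i ∈ S, F i ω) = ∑ i ∈ S, walkSum d n (F i) := Finset.sum_comm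

lemma walkSum_zero (F : (ℕ → Fin d → ℤ) → ℝ) : walkSum d 0 F = F 0 := by
  unfold walkSum
  rw [Fintype.sum_unique]
  congr 1

lemma walkSum_one (F : (ℕ → Fin d → ℤ) → ℝ) :
    walkSum d 1 F = ∑ e : Fin d × Bool, F (fun k => if 0 < k then wsawStep d e else 0) := by
  unfold walkSum
  rw [← (Equiv.funUnique (Fin 1) (Fin d × Bool)).symm.sum_comp]
  refine Finset.sum_congr rfl fun e _ => ?_
  congr 1
  funext k
  simp [wsawPos_eq_sum]

lemma wsawPos_flip {n : ℕ} (s : Fin n → Fin d × Bool) :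
    wsawPos (fun j => ((s j).1, !(s j).2)) = - wsawPos s := by
  funext k
  rw [Pi.neg_apply, wsawPos_eq_sum, wsawPos_eq_sum, ← Finset.sum_neg_distrib]
  refine Finset.sum_congr rfl fun j _ => ?_
  split_ifs
  · funext i
    rcases s j with ⟨a, b⟩
    cases b
    all_goals
      simp only [wsawStep, Pi.neg_apply]
      split_ifs <;> simp_all
  · simp

lemma walkSum_neg {n : ℕ} (F : (ℕ → Fin d → ℤ) → ℝ) :
    walkSum d n (fun ω => F (-ω)) = walkSum d n F := by
  unfold walkSum
  have hinv : Function.Involutive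
      (fun (s : Fin n → Fin d × Bool) (j : Fin n) => ((s j).1, !(s j).2)) := fun s => by
    funext j; simp
  refine Eq.trans ?_ (Equiv.sum_comp hinv.toPerm fun s => F (wsawPos s))
  exact Finset.sum_congr rfl fun s _ => congrArg F (wsawPos_flip s).symm

lemma wsawStep_ne_zero (e : Fin d × Bool) : wsawStep d e ≠ 0 := by
  intro h
  have := congrFun h e.1
  simp only [wsawStep, Pi.zero_apply, if_true] at this
  split_ifs at this
  all_goals omega

lemma cat_of_le {m k : ℕ} (h : k ≤ m) (ω η : ℕ → Fin d → ℤ) : cat m ω η k = ω k := if_pos h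

lemma cat_add {m : ℕ} (ω : ℕ → Fin d → ℤ) {η : ℕ → Fin d → ℤ} (h : η 0 = 0) (k : ℕ) :
    cat m ω η (k + m) = ω m + η k := by
  unfold cat
  split_ifs with h'
  · obtain rfl : k = 0 := by omega
    simp [h]
  · simp

lemma wK_cat_left {m n : ℕ} (h : n ≤ m) (ω η : ℕ → Fin d → ℤ) :
    wK β (cat m ω η) 0 n = wK β ω 0 n :=
  wK_shift (j := 0) fun a b _ h2 _ h4 => by
    simp only [add_zero, cat_of_le (h2.trans h), cat_of_le (h4.trans h)]

lemma wK_cat_right {m n N : ℕ} (hN : n + m = N) (ω : ℕ → Fin d → ℤ) {η : ℕ → Fin d → ℤ}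
    (h : η 0 = 0) : wK β (cat m ω η) m N = wK β η 0 n := by
  subst hN
  have := wK_shift (β := β) (ω := η) (ω' := cat m ω η) (j := m) (t := 0) (n := n)
    fun a b _ _ _ _ => by rw [cat_add ω h, cat_add ω h, add_right_inj]
  rwa [zero_add] at this

/-- The endpoint functional `G ↦ ∑_x c_n(x) G(x)`. -/
noncomputable def cSum (d : ℕ) (β : ℝ) (n : ℕ) (G : (Fin d → ℤ) → ℝ) : ℝ :=
  walkSum d n fun ω => wK β ω 0 n * G (ω n)

/-- The endpoint functional of the irreducible part. -/
noncomputable def piSum (d : ℕ) (β : ℝ) (n : ℕ) (G : (Fin d → ℤ) → ℝ) : ℝ :=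
  if n < 2 then 0 else walkSum d n fun ω => wV β ω 0 1 n * G (ω n)

lemma prod_pairs_eq_wK {X : Type*} [DecidableEq X] (β : ℝ) (ω : ℕ → X) (n : ℕ) :
    ∏ p ∈ (Finset.range (n + 1) ×ˢ Finset.range (n + 1)).filter (fun p => p.1 < p.2),
      (1 + β * (if ω p.1 = ω p.2 then (-1 : ℝ) else 0)) = wK β ω 0 n := by
  unfold wK
  rw [Finset.prod_filter, Finset.prod_product_right, ← Finset.prod_subset
    (show Finset.Ioc 0 n ⊆ Finset.range (n + 1) from fun b hb => by
      have := Finset.mem_Ioc.1 hb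
      exact Finset.mem_range.2 (by omega))]
  · refine Finset.prod_congr rfl fun b hb => ?_
    have hb := Finset.mem_Ioc.1 hb
    rw [← Finset.prod_filter]
    refine Finset.prod_congr ?_ fun a _ => ?_
    · ext a
      simp only [Finset.mem_filter, Finset.mem_range, Finset.mem_Ico]
      omega
    · unfold wI
      split_ifs <;> ring
  · intro b hb hb'
    have h1 := Finset.mem_range.1 hb
    have h2 : b = 0 := by
      by_contra h
      exact hb' (Finset.mem_Ioc.2 (by omega))
    subst h2
    simp

lemma wsawWeight_eq {n : ℕ} (s : Fin n → Fin d × Bool) :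
    wsawWeight β n s = wK β (wsawPos s) 0 n :=
  prod_pairs_eq_wK β (wsawPos s) n

lemma cZ_eq_cSum (n : ℕ) : cZ d β n = cSum d β n fun _ => 1 := by
  unfold cZ cSum walkSum
  simp only [wsawWeight_eq, mul_one]

lemma cSum_mono (hβ1 : β ≤ 1) {n : ℕ} {G H : (Fin d → ℤ) → ℝ} (h : ∀ x, G x ≤ H x) :
    cSum d β n G ≤ cSum d β n H :=
  walkSum_mono fun _ => mul_le_mul_of_nonneg_left (h _) (wK_nonneg hβ1 _ _ _)

lemma cSum_nonneg (hβ1 : β ≤ 1) {n : ℕ} {G : (Fin d → ℤ) → ℝ} (h : ∀ x, 0 ≤ G x) :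
    0 ≤ cSum d β n G :=
  walkSum_nonneg fun _ => mul_nonneg (wK_nonneg hβ1 _ _ _) (h _)

lemma cSum_mul_left {n : ℕ} (c : ℝ) (G : (Fin d → ℤ) → ℝ) :
    cSum d β n (fun x => c * G x) = c * cSum d β n G := by
  unfold cSum
  rw [← walkSum_mul_left]
  exact walkSum_congr fun _ => by ring

lemma cSum_add_fun {n : ℕ} (G H : (Fin d → ℤ) → ℝ) :
    cSum d β n (fun x => G x + H x) = cSum d β n G + cSum d β n H := by
  unfold cSum
  rw [← walkSum_add_fun]
  exact walkSum_congr fun _ => by ring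

lemma cSum_finset_sum {ι : Type*} {n : ℕ} (S : Finset ι) (G : ι → (Fin d → ℤ) → ℝ) :
    cSum d β n (fun x => ∑ i ∈ S, G i x) = ∑ i ∈ S, cSum d β n (G i) := by
  unfold cSum
  rw [← walkSum_finset_sum]
  exact walkSum_congr fun _ => by rw [Finset.mul_sum]

lemma cSum_const {n : ℕ} (c : ℝ) : cSum d β n (fun _ => c) = c * cZ d β n := by
  rw [cZ_eq_cSum, ← cSum_mul_left]
  simp

lemma cSum_zero (G : (Fin d → ℤ) → ℝ) : cSum d β 0 G = G 0 := by
  unfold cSum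
  rw [walkSum_zero]
  simp [wK]

lemma cSum_add_le (hβ : 0 ≤ β) (hβ1 : β ≤ 1) {m n N : ℕ} (h : m + n = N) {G : (Fin d → ℤ) → ℝ}
    (hG : ∀ x, 0 ≤ G x) :
    cSum d β N G ≤ cSum d β m fun x => cSum d β n fun y => G (x + y) := by
  unfold cSum
  rw [walkSum_add h]
  refine walkSum_mono fun s => ?_
  rw [← walkSum_mul_left]
  refine walkSum_mono fun t => ?_
  have e : cat m (wsawPos s) (wsawPos t) N = wsawPos s m + wsawPos t n := by
    rw [← h, add_comm m n, cat_add _ (wsawPos_zero t)]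
  rw [e, ← mul_assoc]
  refine mul_le_mul_of_nonneg_right ?_ (hG _)
  refine (wK_le_mul hβ hβ1 _ (b := m) (by omega) (by omega)).trans (le_of_eq ?_)
  rw [wK_cat_left le_rfl, wK_cat_right (n := n) (by omega) _ (wsawPos_zero t)]

lemma wI_wsawPos_zero_one {n : ℕ} (s : Fin (n + 1) → Fin d × Bool) :
    wI β (wsawPos s) 0 1 = 1 := by
  have : wsawPos s 1 = wsawStep d (s 0) := by
    rw [wsawPos_eq_sum, Fin.sum_univ_succ]
    simp
  unfold wI
  rw [wsawPos_zero, this, if_neg (wsawStep_ne_zero _).symm]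
  ring

/-- The lace recursion for the endpoint functional. -/
lemma cSum_succ (n : ℕ) (G : (Fin d → ℤ) → ℝ) :
    cSum d β (n + 1) G = ∑ e : Fin d × Bool, cSum d β n (fun x => G (wsawStep d e + x)) +
      ∑ ij ∈ antidiagonal (n + 1), piSum d β ij.1 fun x => cSum d β ij.2 fun y => G (x + y) := by
  have e1 : cSum d β (n + 1) G = walkSum d (n + 1) fun ω =>
      wK β ω 1 (n + 1) * G (ω (n + 1)) +
        ∑ m ∈ Finset.Ioc 1 (n + 1), wV β ω 0 1 m * wK β ω m (n + 1) * G (ω (n + 1)) := by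
    refine walkSum_congr fun s => ?_
    rw [wK_split _ (zero_le_one) (by omega : 1 ≤ n + 1),
      wK_mul_wC_eq_sum_wV _ (by omega : 1 ≤ n + 1)]
    have : wK β (wsawPos s) 0 1 = 1 := by
      unfold wK
      rw [show Finset.Ioc 0 1 = {1} from rfl, Finset.prod_singleton,
        show Finset.Ico 0 1 = {0} from rfl, Finset.prod_singleton, wI_wsawPos_zero_one]
    rw [this, one_mul, add_mul, Finset.sum_mul]
  rw [e1, walkSum_add_fun, walkSum_finset_sum]
  congr 1
  · rw [walkSum_add (m := 1) (n := n) (by omega), walkSum_one]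
    refine Finset.sum_congr rfl fun e _ => walkSum_congr fun t => ?_
    rw [wK_cat_right (n := n) rfl _ (wsawPos_zero t), cat_add _ (wsawPos_zero t), if_pos one_pos]
  · rw [Finset.Nat.sum_antidiagonal_eq_sum_range_succ
      (fun i j => piSum d β i fun x => cSum d β j fun y => G (x + y))]
    symm
    rw [← Finset.sum_subset (s₁ := Finset.Ioc 1 (n + 1))]
    · refine Finset.sum_congr rfl fun m hm => ?_
      have hm := Finset.mem_Ioc.1 hm
      rw [piSum, if_neg (by omega), walkSum_add (m := m) (n := n + 1 - m) (N := n + 1) (by omega)]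
      refine walkSum_congr fun s => ?_
      unfold cSum
      rw [← walkSum_mul_left]
      refine walkSum_congr fun t => ?_
      have e : cat m (wsawPos s) (wsawPos t) (n + 1) = wsawPos s m + wsawPos t (n + 1 - m) := by
        have := cat_add (m := m) (wsawPos s) (wsawPos_zero t) (n + 1 - m)
        rwa [show n + 1 - m + m = n + 1 by omega] at this
      rw [wK_cat_right (n := n + 1 - m) (by omega) _ (wsawPos_zero t), e,
        wV_congr (by omega) fun a ha => cat_of_le ha _ _, mul_assoc]
    · intro m hm
      have := Finset.mem_Ioc.1 hm
      exact Finset.mem_range.2 (by omega)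
    · intro m hm hm'
      rw [piSum, if_pos]
      by_contra h
      exact hm' (Finset.mem_Ioc.2 ⟨by omega, by have := Finset.mem_range.1 hm; omega⟩)

end Wsaw

namespace Wsaw

open Finset.HasAntidiagonal (antidiagonal mem_antidiagonal)

/-- The decay profile of two-point functions. -/
noncomputable def dec (s : ℝ) (n : ℕ) : ℝ := ((n : ℝ) + 1) ^ (-(s + 1))

lemma dec_pos (s : ℝ) (n : ℕ) : 0 < dec s n := by unfold dec; positivity

lemma dec_mul (s : ℝ) (n : ℕ) : ((n : ℝ) + 1) * dec s n = ((n : ℝ) + 1) ^ (-s) := by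
  unfold dec
  rw [mul_comm, ← Real.rpow_add_one (by positivity)]
  ring_nf

lemma dec_le_mul {s c : ℝ} (hs : 0 < s) (hc : 0 < c) {m n : ℕ}
    (h : (n : ℝ) + 1 ≤ c * ((m : ℝ) + 1)) : dec s m ≤ c ^ (s + 1) * dec s n := by
  have h1 : (c * ((m : ℝ) + 1)) ^ (-(s + 1)) ≤ ((n : ℝ) + 1) ^ (-(s + 1)) :=
    Real.rpow_le_rpow_of_nonpos (by positivity) h (by linarith)
  rw [Real.mul_rpow hc.le (by positivity), Real.rpow_neg hc.le,
    inv_mul_le_iff₀ (by positivity)] at h1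
  exact h1

lemma sum_min_dec_le {s : ℝ} (hs : 1 < s) (N : ℕ) :
    ∑ x ∈ Finset.range N ×ˢ Finset.range N, min (dec s x.1) (dec s x.2) ≤ 2 * teleConst s := by
  have hanti : ∀ {m n : ℕ}, m ≤ n → dec s n ≤ dec s m := fun {m n} h =>
    Real.rpow_le_rpow_of_nonpos (by positivity) (by gcongr) (by linarith)
  have key : ∀ x : ℕ × ℕ, min (dec s x.1) (dec s x.2) ≤
      (if x.2 ≤ x.1 then dec s x.1 else 0) + (if x.1 ≤ x.2 then dec s x.2 else 0) := by
    intro x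
    have p1 := (dec_pos s x.1).le
    have p2 := (dec_pos s x.2).le
    rcases le_total x.1 x.2 with h | h
    · rw [if_pos h]
      have : 0 ≤ (if x.2 ≤ x.1 then dec s x.1 else 0) := by split_ifs <;> simp [p1]
      exact (min_le_right _ _).trans (by linarith)
    · rw [if_pos h]
      have : 0 ≤ (if x.1 ≤ x.2 then dec s x.2 else 0) := by split_ifs <;> simp [p2]
      exact (min_le_left _ _).trans (by linarith)
  have row : ∀ x : ℕ, ∑ y ∈ Finset.range N, (if y ≤ x then dec s x else 0) ≤
      ((x : ℝ) + 1) ^ (-s) := by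
    intro x
    rw [← Finset.sum_filter, Finset.sum_const, nsmul_eq_mul, ← dec_mul]
    refine mul_le_mul_of_nonneg_right ?_ (dec_pos s x).le
    have : ((Finset.range N).filter (fun y => y ≤ x)).card ≤ (Finset.range (x + 1)).card :=
      Finset.card_le_card fun y hy => by
        rw [Finset.mem_filter] at hy
        exact Finset.mem_range.2 (by omega)
    rw [Finset.card_range] at this
    exact_mod_cast this
  refine (Finset.sum_le_sum fun x _ => key x).trans ?_
  rw [Finset.sum_add_distrib, Finset.sum_product, Finset.sum_product_right]
  have := Finset.sum_le_sum fun x (_ : x ∈ Finset.range N) => row x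
  linarith [sum_rpow_le hs N]

lemma sum_comp_le_sum {ι κ : Type*} [DecidableEq κ] {S : Finset ι} {T : Finset κ} (e : ι → κ)
    (he : Set.InjOn e S) (hST : ∀ x ∈ S, e x ∈ T) (f : κ → ℝ) (hf : ∀ y, 0 ≤ f y) :
    ∑ x ∈ S, f (e x) ≤ ∑ y ∈ T, f y := by
  rw [← Finset.sum_image he]
  exact Finset.sum_le_sum_of_subset_of_nonneg (Finset.image_subset_iff.2 hST) fun y _ _ => hf y

/-- The index set of pairs of times `0 ≤ a < b`, `0 < b < L`. -/
def timePairs (L : ℕ) : Finset ((_ : ℕ) × ℕ) := (Finset.Ioo 0 L).sigma fun b => Finset.Ico 0 b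

lemma mem_timePairs {L : ℕ} {x : (_ : ℕ) × ℕ} : x ∈ timePairs L ↔ x.1 < L ∧ x.2 < x.1 := by
  unfold timePairs
  rw [Finset.mem_sigma, Finset.mem_Ioo, Finset.mem_Ico]
  omega

lemma sum_timePairs_le {s : ℝ} (hs : 1 < s) (L : ℕ) (e : (_ : ℕ) × ℕ → ℕ × ℕ)
    (he : Set.InjOn e (timePairs L)) (hST : ∀ x ∈ timePairs L, (e x).1 < L + 1 ∧ (e x).2 < L + 1) :
    ∑ x ∈ timePairs L, min (dec s (e x).1) (dec s (e x).2) ≤ 2 * teleConst s :=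
  (sum_comp_le_sum (T := Finset.range (L + 1) ×ˢ Finset.range (L + 1)) e he
    (fun x hx => by simpa using hST x hx) (fun y => min (dec s y.1) (dec s y.2))
    fun y => le_min (dec_pos s _).le (dec_pos s _).le).trans (sum_min_dec_le hs _)

lemma sum_timePairs_last_le {s : ℝ} (hs : 1 < s) (L : ℕ) :
    ∑ x ∈ timePairs L, min (dec s (x.1 - x.2)) (dec s (L - x.1)) ≤ 2 * teleConst s := by
  refine sum_timePairs_le hs L (fun x => (x.1 - x.2, L - x.1)) ?_ ?_
  · rintro ⟨b, a⟩ hx ⟨b', a'⟩ hx' h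
    have hx := mem_timePairs.1 hx
    have hx' := mem_timePairs.1 hx'
    simp only [Prod.mk.injEq] at *
    obtain rfl : b = b' := by omega
    obtain rfl : a = a' := by omega
    rfl
  · intro x hx
    have hx := mem_timePairs.1 hx
    omega

lemma sum_timePairs_first_le {s : ℝ} (hs : 1 < s) (L : ℕ) :
    ∑ x ∈ timePairs L, min (dec s x.2) (dec s (x.1 - x.2)) ≤ 2 * teleConst s := by
  refine sum_timePairs_le hs L (fun x => (x.2, x.1 - x.2)) ?_ ?_
  · rintro ⟨b, a⟩ hx ⟨b', a'⟩ hx' h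
    have hx := mem_timePairs.1 hx
    have hx' := mem_timePairs.1 hx'
    simp only [Prod.mk.injEq] at *
    obtain rfl : a = a' := by omega
    obtain rfl : b = b' := by omega
    rfl
  · intro x hx
    have hx := mem_timePairs.1 hx
    omega

lemma sum_timePairs_outer_le {s : ℝ} (hs : 1 < s) (L : ℕ) :
    ∑ x ∈ timePairs L, min (dec s x.2) (dec s (L - x.1)) ≤ 2 * teleConst s := by
  refine sum_timePairs_le hs L (fun x => (x.2, L - x.1)) ?_ ?_
  · rintro ⟨b, a⟩ hx ⟨b', a'⟩ hx' h
    have hx := mem_timePairs.1 hx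
    have hx' := mem_timePairs.1 hx'
    simp only [Prod.mk.injEq] at *
    obtain rfl : a = a' := by omega
    obtain rfl : b = b' := by omega
    rfl
  · intro x hx
    have hx := mem_timePairs.1 hx
    omega

lemma dec_mul_min_le {s : ℝ} (hs : 1 < s) {a i j L : ℕ} (h : a + i + j = L) :
    min (dec s a * dec s i) (min (dec s a * dec s j) (dec s i * dec s j)) ≤
      3 ^ (s + 1) * dec s L * (min (dec s a) (dec s i) + min (dec s a) (dec s j)
        + min (dec s i) (dec s j)) := by
  have pa := dec_pos s a
  have pi := dec_pos s i
  have pj := dec_pos s j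
  have m1 : 0 ≤ min (dec s a) (dec s i) := le_min pa.le pi.le
  have m2 : 0 ≤ min (dec s a) (dec s j) := le_min pa.le pj.le
  have m3 : 0 ≤ min (dec s i) (dec s j) := le_min pi.le pj.le
  have hL : 0 ≤ 3 ^ (s + 1) * dec s L := mul_nonneg (by positivity) (dec_pos s L).le
  have third : ∀ k : ℕ, L ≤ 3 * k → dec s k ≤ 3 ^ (s + 1) * dec s L := fun k hk =>
    dec_le_mul (by linarith) (by norm_num) (by
      have : (L : ℝ) ≤ 3 * k := by exact_mod_cast hk
      linarith)
  rw [mul_add, mul_add]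
  have n1 := mul_nonneg hL m1
  have n2 := mul_nonneg hL m2
  have n3 := mul_nonneg hL m3
  rcases (by omega : L ≤ 3 * a ∨ L ≤ 3 * i ∨ L ≤ 3 * j) with h | h | h
  · have := mul_le_mul_of_nonneg_right (third a h) m3
    have e : min (dec s a * dec s i) (min (dec s a * dec s j) (dec s i * dec s j))
        ≤ dec s a * min (dec s i) (dec s j) := by
      rw [mul_min_of_nonneg _ _ pa.le]
      exact le_min (min_le_left _ _) ((min_le_right _ _).trans (min_le_left _ _))
    linarith
  · have := mul_le_mul_of_nonneg_right (third i h) m2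
    have e : min (dec s a * dec s i) (min (dec s a * dec s j) (dec s i * dec s j))
        ≤ dec s i * min (dec s a) (dec s j) := by
      rw [mul_min_of_nonneg _ _ pi.le, mul_comm (dec s i) (dec s a)]
      exact le_min (min_le_left _ _) ((min_le_right _ _).trans (min_le_right _ _))
    linarith
  · have := mul_le_mul_of_nonneg_right (third j h) m1
    have e : min (dec s a * dec s i) (min (dec s a * dec s j) (dec s i * dec s j))
        ≤ dec s j * min (dec s a) (dec s i) := by
      rw [mul_min_of_nonneg _ _ pj.le, mul_comm (dec s j), mul_comm (dec s j)]
      exact le_min ((min_le_right _ _).trans (min_le_left _ _))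
        ((min_le_right _ _).trans (min_le_right _ _))
    linarith

lemma sum_timePairs_min_le {s : ℝ} (hs : 1 < s) (L : ℕ) :
    ∑ x ∈ timePairs L, min (dec s x.2 * dec s (x.1 - x.2))
      (min (dec s x.2 * dec s (L - x.1)) (dec s (x.1 - x.2) * dec s (L - x.1))) ≤
      6 * 3 ^ (s + 1) * teleConst s * dec s L := by
  refine (Finset.sum_le_sum fun x hx => dec_mul_min_le hs (L := L) (by
    have := mem_timePairs.1 hx; omega)).trans ?_
  rw [← Finset.mul_sum, Finset.sum_add_distrib, Finset.sum_add_distrib]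
  have hL : 0 ≤ 3 ^ (s + 1) * dec s L := mul_nonneg (by positivity) (dec_pos s L).le
  have := mul_le_mul_of_nonneg_left (add_le_add (add_le_add (sum_timePairs_first_le hs L)
    (sum_timePairs_outer_le hs L)) (sum_timePairs_last_le hs L)) hL
  linarith

end Wsaw

namespace Wsaw

open Finset.HasAntidiagonal (antidiagonal mem_antidiagonal)

variable {d : ℕ} {β z : ℝ} {ρ : (Fin d → ℤ) → ℝ}

/-- The endpoint functional `cSum` weighted by `ρ` and `z ^ n`. -/
noncomputable def tSum (β z : ℝ) (ρ : (Fin d → ℤ) → ℝ) (n : ℕ) (G : (Fin d → ℤ) → ℝ) : ℝ :=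
  z ^ n * cSum d β n fun x => ρ x * G x

/-- The weighted sum over walks of the majorant `wTheta`. -/
noncomputable def phi (β z : ℝ) (ρ : (Fin d → ℤ) → ℝ) (L : ℕ) (u : Fin d → ℤ) : ℝ :=
  z ^ L * walkSum d L fun ω => ρ (ω L) * wTheta β ω 0 L u

lemma tSum_mono (hβ1 : β ≤ 1) (hz : 0 ≤ z) (hρ : ∀ x, 0 ≤ ρ x) {n : ℕ} {G H : (Fin d → ℤ) → ℝ}
    (h : ∀ x, G x ≤ H x) : tSum β z ρ n G ≤ tSum β z ρ n H :=
  mul_le_mul_of_nonneg_left (cSum_mono hβ1 fun x => mul_le_mul_of_nonneg_left (h x) (hρ x))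
    (pow_nonneg hz _)

lemma tSum_nonneg (hβ1 : β ≤ 1) (hz : 0 ≤ z) (hρ : ∀ x, 0 ≤ ρ x) {n : ℕ} {G : (Fin d → ℤ) → ℝ}
    (h : ∀ x, 0 ≤ G x) : 0 ≤ tSum β z ρ n G :=
  mul_nonneg (pow_nonneg hz _) (cSum_nonneg hβ1 fun x => mul_nonneg (hρ x) (h x))

lemma tSum_mul_left {n : ℕ} (c : ℝ) (G : (Fin d → ℤ) → ℝ) :
    tSum β z ρ n (fun x => c * G x) = c * tSum β z ρ n G := by
  unfold tSum
  simp only [mul_left_comm _ c]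
  rw [cSum_mul_left, mul_left_comm]

lemma tSum_finset_sum {ι : Type*} {n : ℕ} (S : Finset ι) (G : ι → (Fin d → ℤ) → ℝ) :
    tSum β z ρ n (fun x => ∑ i ∈ S, G i x) = ∑ i ∈ S, tSum β z ρ n (G i) := by
  unfold tSum
  simp only [Finset.mul_sum]
  rw [cSum_finset_sum, Finset.mul_sum]

/-- Bounds on the weighted two-point function up to time `N`. -/
structure TwoPointBound (β z : ℝ) (ρ : (Fin d → ℤ) → ℝ) (s κ : ℝ) (N : ℕ) : Prop where
  total : ∀ n ≤ N, tSum β z ρ n (fun _ => 1) ≤ κ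
  point : ∀ n ≤ N, ∀ x, tSum β z ρ n (fun y => if y = x then 1 else 0) ≤ κ * dec s n

lemma TwoPointBound.le_sup {s κ : ℝ} {N : ℕ} (h : TwoPointBound β z ρ s κ N) (hβ1 : β ≤ 1)
    (hz : 0 ≤ z) (hρ : ∀ x, 0 ≤ ρ x) {n : ℕ} (hn : n ≤ N) {G : (Fin d → ℤ) → ℝ} {M : ℝ}
    (hM : 0 ≤ M) (hG : ∀ x, G x ≤ M) : tSum β z ρ n G ≤ κ * M := by
  calc tSum β z ρ n G ≤ tSum β z ρ n (fun _ => M * 1) :=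
        tSum_mono hβ1 hz hρ fun x => by simpa using hG x
    _ = M * tSum β z ρ n (fun _ => 1) := tSum_mul_left M fun _ => 1
    _ ≤ M * κ := mul_le_mul_of_nonneg_left (h.total n hn) hM
    _ = κ * M := mul_comm _ _

lemma TwoPointBound.le_sum {s κ : ℝ} {N : ℕ} (h : TwoPointBound β z ρ s κ N)
    {n : ℕ} (hn : n ≤ N) {G : (Fin d → ℤ) → ℝ} {B : ℝ} (hκ : 0 ≤ κ)
    (hG0 : ∀ x, 0 ≤ G x) (hG : ∀ F : Finset (Fin d → ℤ), ∑ x ∈ F, G x ≤ B) :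
    tSum β z ρ n G ≤ κ * dec s n * B := by
  let F : Finset (Fin d → ℤ) := Finset.univ.image fun w : Fin n → Fin d × Bool => wsawPos w n
  have hF : tSum β z ρ n G
      = tSum β z ρ n (fun y => ∑ x ∈ F, G x * if y = x then 1 else 0) := by
    unfold tSum cSum
    congr 1
    refine walkSum_congr fun w => ?_
    have hw : wsawPos w n ∈ F := Finset.mem_image_of_mem _ (Finset.mem_univ w)
    simp [Finset.sum_ite_eq, hw]
  rw [hF, tSum_finset_sum]
  calc ∑ x ∈ F, tSum β z ρ n (fun y => G x * if y = x then 1 else 0)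
      ≤ ∑ x ∈ F, G x * (κ * dec s n) := Finset.sum_le_sum fun x _ => by
        rw [tSum_mul_left]
        exact mul_le_mul_of_nonneg_left (h.point n hn x) (hG0 x)
    _ = κ * dec s n * ∑ x ∈ F, G x := by rw [← Finset.sum_mul, mul_comm]
    _ ≤ _ := mul_le_mul_of_nonneg_left (hG F) (mul_nonneg hκ (dec_pos _ _).le)

/-- The contribution to `phi` of a given pair of times. -/
noncomputable def loopSum (β z : ℝ) (ρ : (Fin d → ℤ) → ℝ) (a i j : ℕ) (u : Fin d → ℤ) : ℝ :=
  tSum β z ρ a fun v => tSum β z ρ i fun y => (if v + y = u then 1 else 0) * phi β z ρ j (-y)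

lemma phi_nonneg (hβ : 0 ≤ β) (hβ1 : β ≤ 1) (hz : 0 ≤ z) (hρ : ∀ x, 0 ≤ ρ x) (L : ℕ)
    (u : Fin d → ℤ) : 0 ≤ phi β z ρ L u :=
  mul_nonneg (pow_nonneg hz _) (walkSum_nonneg fun _ =>
    mul_nonneg (hρ _) (wTheta_nonneg hβ hβ1 _ _ _ _))

lemma walkSum_wTheta_le (hβ : 0 ≤ β) (hβ1 : β ≤ 1) (hz : 0 ≤ z) (hρ : ∀ x, 0 ≤ ρ x)
    (hρm : ∀ x y, ρ (x + y) ≤ 2 * (ρ x * ρ y)) {a b L : ℕ} (hab : a ≤ b) (hbL : b ≤ L)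
    (u : Fin d → ℤ) :
    z ^ L * walkSum d L (fun ω => ρ (ω L) *
      ((β * if ω b = u then 1 else 0) * wK β ω 0 b * wTheta β ω b L (ω a))) ≤
      4 * β * loopSum β z ρ a (b - a) (L - b) u := by
  obtain ⟨i, rfl⟩ := Nat.exists_eq_add_of_le hab
  obtain ⟨j, rfl⟩ := Nat.exists_eq_add_of_le hbL
  simp only [add_tsub_cancel_left]
  have hR : 4 * β * loopSum β z ρ a i j u = z ^ (a + i + j) * walkSum d a (fun ω =>
      walkSum d i fun η => walkSum d j fun ζ => 4 * β * ((wK β ω 0 a * ρ (ω a)) *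
        ((wK β η 0 i * ρ (η i)) * ((if ω a + η i = u then 1 else 0) *
          (ρ (ζ j) * wTheta β ζ 0 j (-η i)))))) := by
    simp only [loopSum, tSum, phi, cSum, walkSum_mul_left, pow_add]
    simp only [← walkSum_mul_left]
    refine walkSum_congr fun w => ?_
    refine walkSum_congr fun w' => ?_
    refine walkSum_congr fun w'' => ?_
    ring
  rw [hR, walkSum_add (m := a + i) (n := j) rfl, walkSum_add (m := a) (n := i) rfl]
  refine mul_le_mul_of_nonneg_left ?_ (pow_nonneg hz _)
  refine walkSum_mono fun w => walkSum_mono fun w' => walkSum_mono fun w'' => ?_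
  set ω := wsawPos w
  set η := wsawPos w'
  set ζ := wsawPos w''
  have hη : η 0 = 0 := wsawPos_zero w'
  have hζ : ζ 0 = 0 := wsawPos_zero w''
  have e1 : cat a ω η (a + i) = ω a + η i := by rw [add_comm a i, cat_add ω hη]
  have e2 : cat (a + i) (cat a ω η) ζ (a + i + j) = ω a + η i + ζ j := by
    rw [add_comm (a + i) j, cat_add _ hζ, e1]
  have e3 : cat (a + i) (cat a ω η) ζ (a + i) = ω a + η i := by rw [cat_of_le le_rfl, e1]
  have e4 : cat (a + i) (cat a ω η) ζ a = ω a := by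
    rw [cat_of_le (Nat.le_add_right _ _), cat_of_le le_rfl]
  have e5 : wK β (cat (a + i) (cat a ω η) ζ) 0 (a + i) ≤ wK β ω 0 a * wK β η 0 i := by
    rw [wK_cat_left le_rfl, ← wK_cat_left (β := β) le_rfl ω η,
      ← wK_cat_right (β := β) (add_comm i a) ω hη]
    exact wK_le_mul hβ hβ1 _ (Nat.zero_le _) (Nat.le_add_right _ _)
  have e6 : wTheta β (cat (a + i) (cat a ω η) ζ) (a + i) (a + i + j) (ω a)
      = wTheta β ζ 0 j (-η i) := by
    have := wTheta_shift (β := β) (ω := ζ) (ω' := cat (a + i) (cat a ω η) ζ) (j := a + i) (t := 0)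
      (n := j) (u := -η i) (u' := ω a)
      (fun k l _ _ _ _ => by rw [cat_add _ hζ, cat_add _ hζ, add_right_inj])
      (fun k _ _ => by
        rw [cat_add _ hζ, e1, add_assoc, add_eq_left, add_comm, eq_neg_iff_add_eq_zero])
      (Nat.zero_le _)
    rwa [zero_add, add_comm j] at this
  rw [e2, e3, e4, e6]
  have hΘ := wTheta_nonneg hβ hβ1 ζ 0 j (-η i)
  have h4 : ρ (ω a + η i + ζ j) ≤ 4 * (ρ (ω a) * ρ (η i) * ρ (ζ j)) := by
    have h1 := hρm (ω a + η i) (ζ j)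
    have h2 := mul_le_mul_of_nonneg_right (hρm (ω a) (η i)) (hρ (ζ j))
    linarith
  have h5 := mul_le_mul h4 e5 (wK_nonneg hβ1 _ _ _)
    (mul_nonneg zero_le_four (mul_nonneg (mul_nonneg (hρ _) (hρ _)) (hρ _)))
  have hq : 0 ≤ β * (if ω a + η i = u then 1 else 0) * wTheta β ζ 0 j (-η i) :=
    mul_nonneg (mul_nonneg hβ (by split_ifs <;> norm_num)) hΘ
  have := mul_le_mul_of_nonneg_right h5 hq
  linarith

lemma phi_le (hβ : 0 ≤ β) (hβ1 : β ≤ 1) (hz : 0 ≤ z) (hρ : ∀ x, 0 ≤ ρ x)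
    (hρm : ∀ x y, ρ (x + y) ≤ 2 * (ρ x * ρ y)) (L : ℕ) (u : Fin d → ℤ) :
    phi β z ρ L u ≤ β * tSum β z ρ L (fun y => if y = u then 1 else 0) +
      4 * β * ∑ x ∈ timePairs L, loopSum β z ρ x.2 (x.1 - x.2) (L - x.1) u := by
  have h : phi β z ρ L u = β * tSum β z ρ L (fun y => if y = u then 1 else 0) +
      ∑ x ∈ timePairs L, z ^ L * walkSum d L (fun ω => ρ (ω L) *
        ((β * if ω x.1 = u then 1 else 0) * wK β ω 0 x.1 * wTheta β ω x.1 L (ω x.2))) := by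
    rw [← Finset.mul_sum, ← walkSum_finset_sum]
    unfold phi tSum cSum
    rw [mul_left_comm, ← mul_add, ← walkSum_mul_left β, ← walkSum_add_fun]
    congr 1
    refine walkSum_congr fun w => ?_
    rw [wTheta_eq, timePairs, Finset.sum_sigma]
    simp only [Finset.mul_sum, mul_add]
    congr 1
    ring
  rw [h, Finset.mul_sum]
  refine add_le_add le_rfl (Finset.sum_le_sum fun x hx => ?_)
  have := mem_timePairs.1 hx
  exact walkSum_wTheta_le hβ hβ1 hz hρ hρm this.2.le this.1.le u

lemma loopSum_sup_le (hβ : 0 ≤ β) (hβ1 : β ≤ 1) (hz : 0 ≤ z) (hρ : ∀ x, 0 ≤ ρ x) {s κ B : ℝ}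
    {N : ℕ} (hκ : 0 ≤ κ) (hB : 0 ≤ B) (h : TwoPointBound β z ρ s κ N) {a i j : ℕ} (ha : a ≤ N)
    (hi : i ≤ N) (h1 : ∀ u, phi β z ρ j u ≤ B * dec s j)
    (h2 : ∀ F : Finset (Fin d → ℤ), ∑ x ∈ F, phi β z ρ j x ≤ B) (u : Fin d → ℤ) :
    loopSum β z ρ a i j u ≤ κ ^ 2 * B *
      min (dec s a * dec s i) (min (dec s a * dec s j) (dec s i * dec s j)) := by
  have hphi := phi_nonneg (d := d) hβ hβ1 hz hρ j
  have hneg : ∀ F : Finset (Fin d → ℤ), ∑ x ∈ F, phi β z ρ j (-x) ≤ B := fun F => by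
    rw [← Finset.sum_image (f := fun x => phi β z ρ j x) (g := fun x => -x) fun x _ y _ h =>
      neg_injective h]
    exact h2 _
  have hinner : ∀ F : Finset (Fin d → ℤ), ∑ v ∈ F, tSum β z ρ i (fun y =>
      (if v + y = u then 1 else 0) * phi β z ρ j (-y)) ≤ tSum β z ρ i fun y => phi β z ρ j (-y) := by
    intro F
    rw [← tSum_finset_sum]
    refine tSum_mono hβ1 hz hρ fun y => ?_
    rw [← Finset.sum_mul]
    refine mul_le_of_le_one_left (hphi _) ?_
    simp only [← eq_sub_iff_add_eq]
    rw [Finset.sum_ite_eq']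
    split_ifs <;> norm_num
  have hin0 : ∀ v, 0 ≤ tSum β z ρ i (fun y => (if v + y = u then 1 else 0) * phi β z ρ j (-y)) :=
    fun v => tSum_nonneg hβ1 hz hρ fun y => mul_nonneg (by split_ifs <;> norm_num) (hphi _)
  have hdj := (dec_pos s j).le
  have hdi := (dec_pos s i).le
  have hda := (dec_pos s a).le
  have b1 := h.le_sum ha hκ hin0 fun F => (hinner F).trans
    (h.le_sum hi hκ (fun x => hphi _) hneg)
  have b2 := h.le_sum ha hκ hin0 fun F => (hinner F).trans
    (h.le_sup hβ1 hz hρ hi (mul_nonneg hB hdj) fun x => h1 _)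
  have b3 := h.le_sup hβ1 hz hρ ha (M := κ * dec s i * (B * dec s j)) (by positivity)
    fun v => h.le_sum hi hκ (G := fun y => (if v + y = u then 1 else 0) * phi β z ρ j (-y))
      (fun y => mul_nonneg (by split_ifs <;> norm_num) (hphi _)) fun F => by
        calc ∑ y ∈ F, (if v + y = u then 1 else 0) * phi β z ρ j (-y)
            ≤ ∑ y ∈ F, (if y = u - v then 1 else 0) * (B * dec s j) :=
              Finset.sum_le_sum fun y _ => by
                simp only [eq_sub_iff_add_eq, add_comm y v]
                exact mul_le_mul_of_nonneg_left (h1 _) (by split_ifs <;> norm_num)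
          _ ≤ B * dec s j := by
            rw [← Finset.sum_mul, Finset.sum_ite_eq']
            exact mul_le_of_le_one_left (by positivity) (by split_ifs <;> norm_num)
  have hc : 0 ≤ κ ^ 2 * B := by positivity
  rw [mul_min_of_nonneg _ _ hc, mul_min_of_nonneg _ _ hc]
  refine le_min (b1.trans (le_of_eq (by ring))) (le_min (b2.trans (le_of_eq (by ring)))
    (b3.trans (le_of_eq (by ring))))

lemma sum_loopSum_le (hβ : 0 ≤ β) (hβ1 : β ≤ 1) (hz : 0 ≤ z) (hρ : ∀ x, 0 ≤ ρ x) {s κ B : ℝ}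
    {N : ℕ} (hκ : 0 ≤ κ) (hB : 0 ≤ B) (h : TwoPointBound β z ρ s κ N) {a i j : ℕ} (ha : a ≤ N)
    (hi : i ≤ N) (h1 : ∀ u, phi β z ρ j u ≤ B * dec s j)
    (h2 : ∀ F : Finset (Fin d → ℤ), ∑ x ∈ F, phi β z ρ j x ≤ B) (F : Finset (Fin d → ℤ)) :
    ∑ u ∈ F, loopSum β z ρ a i j u ≤ κ ^ 2 * B * min (dec s i) (dec s j) := by
  have hphi := phi_nonneg (d := d) hβ hβ1 hz hρ j
  have hneg : ∀ F : Finset (Fin d → ℤ), ∑ x ∈ F, phi β z ρ j (-x) ≤ B := fun F => by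
    rw [← Finset.sum_image (f := fun x => phi β z ρ j x) (g := fun x => -x) fun x _ y _ h =>
      neg_injective h]
    exact h2 _
  have hdj := (dec_pos s j).le
  have hdi := (dec_pos s i).le
  have hsum : ∑ u ∈ F, loopSum β z ρ a i j u ≤
      tSum β z ρ a fun _ => tSum β z ρ i fun y => phi β z ρ j (-y) := by
    unfold loopSum
    rw [← tSum_finset_sum]
    refine tSum_mono hβ1 hz hρ fun v => ?_
    rw [← tSum_finset_sum]
    refine tSum_mono hβ1 hz hρ fun y => ?_
    rw [← Finset.sum_mul, Finset.sum_ite_eq]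
    exact mul_le_of_le_one_left (hphi _) (by split_ifs <;> norm_num)
  have hc : 0 ≤ κ ^ 2 * B := by positivity
  have b0 : 0 ≤ tSum β z ρ i fun y => phi β z ρ j (-y) :=
    tSum_nonneg hβ1 hz hρ fun y => hphi _
  have b1 := hsum.trans (h.le_sup hβ1 hz hρ ha b0 fun _ => le_rfl)
  have b2 := mul_le_mul_of_nonneg_left (h.le_sum hi hκ (fun x => hphi _) hneg) hκ
  have b3 := mul_le_mul_of_nonneg_left
    (h.le_sup hβ1 hz hρ hi (mul_nonneg hB hdj) fun x => h1 (-x)) hκ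
  rw [mul_min_of_nonneg _ _ hc]
  exact le_min (b1.trans (b2.trans (le_of_eq (by ring)))) (b1.trans (b3.trans (le_of_eq (by ring))))

lemma phi_bound (hβ : 0 ≤ β) (hβ1 : β ≤ 1) (hz : 0 ≤ z) (hρ : ∀ x, 0 ≤ ρ x)
    (hρm : ∀ x y, ρ (x + y) ≤ 2 * (ρ x * ρ y)) {s κ : ℝ} (hs : 1 < s) {N : ℕ} (hκ : 0 ≤ κ)
    (hsmall : 48 * 3 ^ (s + 1) * teleConst s * κ ^ 2 * β ≤ 1)
    (h : TwoPointBound β z ρ s κ N) (L : ℕ) (hL : L ≤ N) :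
    (∀ u, phi β z ρ L u ≤ 2 * β * κ * dec s L) ∧
      ∀ F : Finset (Fin d → ℤ), ∑ x ∈ F, phi β z ρ L x ≤ 2 * β * κ := by
  have hT := (teleConst_pos hs).le
  have hB : 0 ≤ 2 * β * κ := by positivity
  have h3 : (1 : ℝ) ≤ 3 ^ (s + 1) := Real.one_le_rpow (by norm_num) (by linarith)
  induction L using Nat.strong_induction_on with
  | _ L ih =>
    refine ⟨fun u => ?_, fun F => ?_⟩
    · refine (phi_le hβ hβ1 hz hρ hρm L u).trans ?_
      have e1 := mul_le_mul_of_nonneg_left (h.point L hL u) hβ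
      have e2 : ∑ x ∈ timePairs L, loopSum β z ρ x.2 (x.1 - x.2) (L - x.1) u ≤
          κ ^ 2 * (2 * β * κ) * (6 * 3 ^ (s + 1) * teleConst s * dec s L) := by
        refine le_trans ?_ (mul_le_mul_of_nonneg_left (sum_timePairs_min_le hs L) (by positivity))
        rw [Finset.mul_sum]
        refine Finset.sum_le_sum fun x hx => ?_
        have hx := mem_timePairs.1 hx
        have := ih (L - x.1) (by omega) (by omega)
        exact loopSum_sup_le hβ hβ1 hz hρ hκ hB h (by omega) (by omega) this.1 this.2 u
      have e3 := mul_le_mul_of_nonneg_left e2 (show 0 ≤ 4 * β by positivity)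
      have e4 := mul_le_mul_of_nonneg_right hsmall
        (mul_nonneg (mul_nonneg hβ hκ) (dec_pos s L).le)
      linarith
    · refine (Finset.sum_le_sum fun u _ => phi_le hβ hβ1 hz hρ hρm L u).trans ?_
      rw [Finset.sum_add_distrib, ← Finset.mul_sum, ← Finset.mul_sum, Finset.sum_comm,
        ← tSum_finset_sum]
      have e1 := mul_le_mul_of_nonneg_left (h.le_sup hβ1 hz hρ hL zero_le_one
        (G := fun y => ∑ i ∈ F, if y = i then 1 else 0) fun y => by
          rw [Finset.sum_ite_eq]; split_ifs <;> norm_num) hβ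
      have e2 : ∑ x ∈ timePairs L, ∑ u ∈ F, loopSum β z ρ x.2 (x.1 - x.2) (L - x.1) u ≤
          κ ^ 2 * (2 * β * κ) * (2 * teleConst s) := by
        refine le_trans ?_ (mul_le_mul_of_nonneg_left (sum_timePairs_last_le hs L) (by positivity))
        rw [Finset.mul_sum]
        refine Finset.sum_le_sum fun x hx => ?_
        have hx := mem_timePairs.1 hx
        have := ih (L - x.1) (by omega) (by omega)
        exact sum_loopSum_le hβ hβ1 hz hρ hκ hB h (by omega) (by omega) this.1 this.2 F
      have e3 := mul_le_mul_of_nonneg_left e2 (show 0 ≤ 4 * β by positivity)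
      have e4 := mul_le_mul_of_nonneg_right hsmall (mul_nonneg hβ hκ)
      have e5 : 0 ≤ (3 ^ (s + 1) - 1) * (teleConst s * κ ^ 2 * β * (β * κ)) :=
        mul_nonneg (by linarith) (by positivity)
      have e6 : 0 ≤ teleConst s * κ ^ 2 * β * (β * κ) := by positivity
      linarith

end Wsaw

namespace Wsaw

variable {d : ℕ} {β z : ℝ}

/-- The total mass, weighted by `ρ` and `z ^ m`, of the absolute value of the lace coefficient. -/
noncomputable def piAbs (β z : ℝ) (ρ : (Fin d → ℤ) → ℝ) (m : ℕ) : ℝ :=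
  if m < 2 then 0 else z ^ m * walkSum d m fun ω => |wV β ω 0 1 m| * ρ (ω m)

/-- The squared Euclidean norm. -/
noncomputable def sqn (x : Fin d → ℤ) : ℝ := ∑ i, (x i : ℝ) ^ 2

lemma sqn_nonneg (x : Fin d → ℤ) : 0 ≤ sqn x := Finset.sum_nonneg fun _ _ => sq_nonneg _

lemma sqn_zero : sqn (0 : Fin d → ℤ) = 0 := by simp [sqn]

lemma sqn_add_le (x y : Fin d → ℤ) : sqn (x + y) ≤ 2 * sqn x + 2 * sqn y := by
  unfold sqn
  rw [Finset.mul_sum, Finset.mul_sum, ← Finset.sum_add_distrib]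
  refine Finset.sum_le_sum fun i _ => ?_
  rw [Pi.add_apply]
  push_cast
  nlinarith [sq_nonneg ((x i : ℝ) - y i)]

lemma sqn_wsawStep (e : Fin d × Bool) : sqn (wsawStep d e) = 1 := by
  unfold sqn wsawStep
  rw [Finset.sum_eq_single e.1]
  · rcases e with ⟨i, b⟩
    cases b <;> simp
  · intro i _ hi
    simp [hi]
  · simp

lemma piAbs_mono (hz : 0 ≤ z) {ρ ρ' : (Fin d → ℤ) → ℝ} (h : ∀ x, ρ x ≤ ρ' x) (m : ℕ) :
    piAbs β z ρ m ≤ piAbs β z ρ' m := by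
  unfold piAbs
  split_ifs
  · exact le_rfl
  · exact mul_le_mul_of_nonneg_left (walkSum_mono fun _ =>
      mul_le_mul_of_nonneg_left (h _) (abs_nonneg _)) (pow_nonneg hz _)

lemma piAbs_mul_left (c : ℝ) (ρ : (Fin d → ℤ) → ℝ) (m : ℕ) :
    piAbs β z (fun x => c * ρ x) m = c * piAbs β z ρ m := by
  unfold piAbs
  split_ifs
  · simp
  · rw [mul_left_comm c, ← walkSum_mul_left c]
    simp only [mul_left_comm]

lemma abs_piSum_mul_le (hz : 0 ≤ z) {G ρ : (Fin d → ℤ) → ℝ} (h : ∀ x, |G x| ≤ ρ x) (m : ℕ) :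
    |z ^ m * piSum d β m G| ≤ piAbs β z ρ m := by
  unfold piAbs piSum
  split_ifs
  · simp
  · rw [abs_mul, abs_of_nonneg (pow_nonneg hz m)]
    refine mul_le_mul_of_nonneg_left ((abs_walkSum_le _).trans (walkSum_mono fun _ => ?_))
      (pow_nonneg hz _)
    rw [abs_mul]
    exact mul_le_mul_of_nonneg_left (h _) (abs_nonneg _)

lemma piAbs_succ_le (hβ : 0 ≤ β) (hβ1 : β ≤ 1) (hz : 0 ≤ z) {ρ : (Fin d → ℤ) → ℝ}
    (hρ : ∀ x, 0 ≤ ρ x) (hρm : ∀ x y, ρ (x + y) ≤ 2 * (ρ x * ρ y)) {L : ℕ} (hL : 1 ≤ L) :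
    piAbs β z ρ (L + 1) ≤
      ∑ e : Fin d × Bool, z * (2 * ρ (wsawStep d e)) * phi β z ρ L (-wsawStep d e) := by
  unfold piAbs
  rw [if_neg (by omega), walkSum_add (m := 1) (n := L) (by omega), walkSum_one, Finset.mul_sum]
  refine Finset.sum_le_sum fun e _ => ?_
  unfold phi
  rw [show z * (2 * ρ (wsawStep d e)) * (z ^ L * walkSum d L fun ω => ρ (ω L) *
    wTheta β ω 0 L (-wsawStep d e)) = z ^ (L + 1) * ((2 * ρ (wsawStep d e)) * walkSum d L fun ω =>
      ρ (ω L) * wTheta β ω 0 L (-wsawStep d e)) by ring, ← walkSum_mul_left (2 * ρ (wsawStep d e))]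
  refine mul_le_mul_of_nonneg_left (walkSum_mono fun w => ?_) (pow_nonneg hz _)
  set ω : ℕ → Fin d → ℤ := fun k => if 0 < k then wsawStep d e else 0
  set η := wsawPos w
  have hη : η 0 = 0 := wsawPos_zero w
  have hω : ω 1 = wsawStep d e := by simp [ω]
  have e1 : cat 1 ω η (L + 1) = wsawStep d e + η L := by rw [cat_add ω hη, hω]
  have e2 : cat 1 ω η 0 = 0 := by rw [cat_of_le (Nat.zero_le _)]; simp [ω]
  have e3 : wTheta β (cat 1 ω η) 1 (L + 1) 0 = wTheta β η 0 L (-wsawStep d e) := by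
    have := wTheta_shift (β := β) (ω := η) (ω' := cat 1 ω η) (j := 1) (t := 0) (n := L)
      (u := -wsawStep d e) (u' := 0)
      (fun k l _ _ _ _ => by rw [cat_add _ hη, cat_add _ hη, add_right_inj])
      (fun k _ _ => by rw [cat_add _ hη, hω, add_comm, eq_neg_iff_add_eq_zero]) (Nat.zero_le _)
    rwa [zero_add] at this
  have e4 := abs_wV_le hβ hβ1 (cat 1 ω η) 0 1 (L + 1)
  rw [Finset.sum_Ico_eq_sum_range, Finset.sum_range_one, add_zero, e2, e3] at e4
  rw [e1]
  have := mul_le_mul e4 (hρm (wsawStep d e) (η L)) (hρ _) (wTheta_nonneg hβ hβ1 _ _ _ _)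
  linarith

lemma piAbs_le (hβ : 0 ≤ β) (hβ1 : β ≤ 1) (hz : 0 ≤ z) (hz2 : (d : ℝ) * z ≤ 1)
    {ρ : (Fin d → ℤ) → ℝ} (hρ : ∀ x, 0 ≤ ρ x) (hρm : ∀ x y, ρ (x + y) ≤ 2 * (ρ x * ρ y))
    (hρe : ∀ e, ρ (wsawStep d e) ≤ 2) {s κ : ℝ} (hs : 1 < s) {N : ℕ} (hκ : 0 ≤ κ)
    (hsmall : 48 * 3 ^ (s + 1) * teleConst s * κ ^ 2 * β ≤ 1)
    (h : TwoPointBound β z ρ s κ N) {m : ℕ} (hm : m ≤ N + 1) :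
    piAbs β z ρ m ≤ 16 * 2 ^ (s + 1) * κ * β * dec s m := by
  have h0 : ∀ m, 0 ≤ 16 * 2 ^ (s + 1) * κ * β * dec s m := fun m => by
    have := (dec_pos s m).le
    positivity
  rcases lt_or_ge m 2 with h2 | h2
  · unfold piAbs
    rw [if_pos h2]
    exact h0 m
  obtain ⟨L, rfl⟩ : ∃ L, m = L + 1 := ⟨m - 1, by omega⟩
  have hphi := (phi_bound hβ hβ1 hz hρ hρm hs hκ hsmall h L (by omega)).1
  have hd : dec s L ≤ 2 ^ (s + 1) * dec s (L + 1) :=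
    dec_le_mul (by linarith) two_pos (by push_cast; nlinarith [Nat.cast_nonneg (α := ℝ) L])
  calc piAbs β z ρ (L + 1)
      ≤ ∑ e : Fin d × Bool, z * (2 * ρ (wsawStep d e)) * phi β z ρ L (-wsawStep d e) :=
        piAbs_succ_le hβ hβ1 hz hρ hρm (by omega)
    _ ≤ ∑ e : Fin d × Bool, z * (2 * 2) * (2 * β * κ * dec s L) := by
        refine Finset.sum_le_sum fun e _ => mul_le_mul ?_ (hphi _)
          (phi_nonneg hβ hβ1 hz hρ L _) (by positivity)
        exact mul_le_mul_of_nonneg_left (by linarith [hρe e]) hz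
    _ = 16 * κ * β * dec s L * (d * z) := by
        rw [Finset.sum_const, Finset.card_univ, Fintype.card_prod, Fintype.card_fin,
          Fintype.card_bool, nsmul_eq_mul]
        push_cast
        ring
    _ ≤ 16 * κ * β * (2 ^ (s + 1) * dec s (L + 1)) * 1 := by
        have := (dec_pos s L).le
        have := (dec_pos s (L + 1)).le
        have : 0 ≤ (d : ℝ) * z := by positivity
        gcongr
    _ = _ := by ring

/-- The bootstrap hypothesis on the two-point functions at `z`. -/
structure Boot (d : ℕ) (β z s K : ℝ) : Prop where
  total : ∀ n, z ^ n * cSum d β n (fun _ => 1) ≤ K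
  moment : ∀ n, z ^ n * cSum d β n sqn ≤ K * n
  point : ∀ n x, z ^ n * cSum d β n (fun y => if y = x then 1 else 0) ≤ K * dec s n

lemma cSum_comm {a b : ℕ} (H : (Fin d → ℤ) → (Fin d → ℤ) → ℝ) :
    cSum d β a (fun v => cSum d β b fun w => H v w) =
      cSum d β b (fun w => cSum d β a fun v => H v w) := by
  unfold cSum walkSum
  simp only [Finset.mul_sum]
  rw [Finset.sum_comm]
  exact Finset.sum_congr rfl fun _ _ => Finset.sum_congr rfl fun _ _ => by ring

lemma Boot.sqn_point {s K : ℝ} (h : Boot d β z s K) (hβ : 0 ≤ β) (hβ1 : β ≤ 1) (hz : 0 ≤ z)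
    (hs : 1 < s) (hK : 0 ≤ K) (n : ℕ) (x : Fin d → ℤ) :
    z ^ n * cSum d β n (fun y => if y = x then sqn y else 0) ≤
      2 * 2 ^ (s + 1) * K ^ 2 * (n * dec s n) := by
  obtain ⟨a, b, hab, ha, hb⟩ : ∃ a b, a + b = n ∧ n + 1 ≤ 2 * (a + 1) ∧ n + 1 ≤ 2 * (b + 1) :=
    ⟨n / 2, n - n / 2, by omega, by omega, by omega⟩
  have key : ∀ a b, n + 1 ≤ 2 * (b + 1) → z ^ a * cSum d β a (fun v => z ^ b * cSum d β b (fun w =>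
      2 * sqn v * if v + w = x then 1 else 0)) ≤ 2 * 2 ^ (s + 1) * K ^ 2 * (a * dec s n) := by
    intro a b hb
    have hd : dec s b ≤ 2 ^ (s + 1) * dec s n :=
      dec_le_mul (by linarith) two_pos (by exact_mod_cast hb)
    calc _ ≤ z ^ a * cSum d β a (fun v => (2 * (K * (2 ^ (s + 1) * dec s n))) * sqn v) := by
          refine mul_le_mul_of_nonneg_left (cSum_mono hβ1 fun v => ?_) (pow_nonneg hz _)
          rw [cSum_mul_left]
          have h1 := h.point b (x - v)
          simp only [eq_sub_iff_add_eq, add_comm _ v] at h1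
          have h2 := mul_le_mul_of_nonneg_left (h1.trans (mul_le_mul_of_nonneg_left hd hK))
            (mul_nonneg zero_le_two (sqn_nonneg v))
          linarith
      _ = 2 * (K * (2 ^ (s + 1) * dec s n)) * (z ^ a * cSum d β a sqn) := by
          rw [cSum_mul_left]; ring
      _ ≤ 2 * (K * (2 ^ (s + 1) * dec s n)) * (K * a) :=
          mul_le_mul_of_nonneg_left (h.moment a) (by have := (dec_pos s n).le; positivity)
      _ = _ := by ring
  have h1 := key a b hb
  have h2 := key b a ha
  have hsum : z ^ n * cSum d β n (fun y => if y = x then sqn y else 0) ≤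
      z ^ a * cSum d β a (fun v => z ^ b * cSum d β b (fun w =>
        2 * sqn v * if v + w = x then 1 else 0)) +
      z ^ b * cSum d β b (fun w => z ^ a * cSum d β a (fun v =>
        2 * sqn w * if w + v = x then 1 else 0)) := by
    rw [cSum_mul_left, cSum_mul_left, cSum_comm (a := b),
      show ∀ A B : ℝ, z ^ a * (z ^ b * A) + z ^ b * (z ^ a * B) = z ^ n * (A + B) from fun A B => by
        rw [← hab, pow_add]; ring, ← cSum_add_fun]
    refine mul_le_mul_of_nonneg_left ((cSum_add_le hβ hβ1 hab fun y => ?_).trans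
      (cSum_mono hβ1 fun v => ?_)) (pow_nonneg hz _)
    · split_ifs
      · exact sqn_nonneg _
      · exact le_rfl
    · rw [← cSum_add_fun]
      refine cSum_mono hβ1 fun w => ?_
      rw [add_comm w v]
      split_ifs
      · linarith [sqn_add_le v w]
      · simp
  have hn : (n : ℝ) = a + b := by rw [← hab]; push_cast; ring
  rw [hn]
  linarith

lemma Boot.twoPointBound {s K : ℝ} (h : Boot d β z s K) (hβ : 0 ≤ β) (hβ1 : β ≤ 1) (hz : 0 ≤ z)
    (hs : 1 < s) (hK : 0 ≤ K) {N : ℕ} (hN : 1 ≤ N) :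
    TwoPointBound (d := d) β z (fun x => 1 + sqn x / N) s (2 * K + 2 * 2 ^ (s + 1) * K ^ 2) N := by
  have hN0 : (0 : ℝ) < N := by exact_mod_cast hN
  have hK2 : 0 ≤ 2 * 2 ^ (s + 1) * K ^ 2 := by positivity
  refine ⟨fun n hn => ?_, fun n hn x => ?_⟩
  · have hn' : (n : ℝ) ≤ N := by exact_mod_cast hn
    have e : tSum β z (fun x : Fin d → ℤ => 1 + sqn x / N) n (fun _ => 1) =
        z ^ n * cSum d β n (fun _ => 1) + (N : ℝ)⁻¹ * (z ^ n * cSum d β n sqn) := by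
      unfold tSum
      simp only [mul_one]
      rw [cSum_add_fun, mul_left_comm, ← cSum_mul_left (N : ℝ)⁻¹ sqn]
      simp only [div_eq_inv_mul]
      ring
    rw [e]
    have h1 := h.total n
    have h2 := mul_le_mul_of_nonneg_left (h.moment n) (inv_nonneg.2 hN0.le)
    have h3 : (N : ℝ)⁻¹ * (K * n) ≤ K := by
      rw [inv_mul_le_iff₀ hN0]
      nlinarith
    linarith
  · have hn' : (n : ℝ) ≤ N := by exact_mod_cast hn
    have e : tSum β z (fun x : Fin d → ℤ => 1 + sqn x / N) n (fun y => if y = x then 1 else 0) =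
        z ^ n * cSum d β n (fun y => if y = x then 1 else 0) +
          (N : ℝ)⁻¹ * (z ^ n * cSum d β n (fun y => if y = x then sqn y else 0)) := by
      unfold tSum
      rw [mul_left_comm (N : ℝ)⁻¹, ← cSum_mul_left (N : ℝ)⁻¹, ← mul_add, ← cSum_add_fun]
      congr 2
      funext y
      by_cases hy : y = x <;> simp [hy, div_eq_inv_mul]
    rw [e]
    have h1 := h.point n x
    have h2 := mul_le_mul_of_nonneg_left (h.sqn_point hβ hβ1 hz hs hK n x) (inv_nonneg.2 hN0.le)
    have hd := (dec_pos s n).le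
    have h3 : (N : ℝ)⁻¹ * (2 * 2 ^ (s + 1) * K ^ 2 * (n * dec s n)) ≤
        2 * 2 ^ (s + 1) * K ^ 2 * dec s n := by
      rw [inv_mul_le_iff₀ hN0]
      have := mul_le_mul_of_nonneg_left hn' (mul_nonneg hK2 hd)
      linarith
    have h4 := mul_nonneg hK hd
    linarith

/-- The constant relating the bootstrap bound to the lace coefficients. -/
noncomputable def laceConst (s K : ℝ) : ℝ := 2 * K + 2 * 2 ^ (s + 1) * K ^ 2

lemma Boot.piAbs_le {s K : ℝ} (h : Boot d β z s K) (hβ : 0 ≤ β) (hβ1 : β ≤ 1) (hz : 0 ≤ z)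
    (hz2 : (d : ℝ) * z ≤ 1) (hs : 1 < s) (hK : 0 ≤ K)
    (hsmall : 48 * 3 ^ (s + 1) * teleConst s * laceConst s K ^ 2 * β ≤ 1) (m : ℕ) :
    piAbs β z (fun _ : Fin d → ℤ => 1) m ≤ 16 * 2 ^ (s + 1) * laceConst s K * β * dec s m ∧
      piAbs β z (sqn : (Fin d → ℤ) → ℝ) m ≤
        m * (16 * 2 ^ (s + 1) * laceConst s K * β * dec s m) := by
  have hκ : 0 ≤ laceConst s K := by unfold laceConst; positivity
  rcases lt_or_ge m 2 with h2 | h2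
  · have := (dec_pos s m).le
    unfold piAbs
    rw [if_pos h2, if_pos h2]
    exact ⟨by positivity, by positivity⟩
  have hm : (0 : ℝ) < m := by exact_mod_cast (by omega : 0 < m)
  have hm1 : (1 : ℝ) ≤ m := by exact_mod_cast (by omega : 1 ≤ m)
  have hq : ∀ x : Fin d → ℤ, 0 ≤ sqn x / m := fun x => div_nonneg (sqn_nonneg x) hm.le
  have key := Wsaw.piAbs_le hβ hβ1 hz hz2 (ρ := fun x : Fin d → ℤ => 1 + sqn x / m)
    (fun x => by linarith [hq x])
    (fun x y => by
      have := sqn_add_le x y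
      have h1 : sqn (x + y) / m ≤ 2 * (sqn x / m) + 2 * (sqn y / m) := by
        rw [div_le_iff₀ hm]
        have e : ∀ w : Fin d → ℤ, sqn w / m * m = sqn w := fun w => div_mul_cancel₀ _ hm.ne'
        linarith [e x, e y]
      nlinarith [mul_nonneg (hq x) (hq y)])
    (fun e => by
      rw [sqn_wsawStep]
      have : (1 : ℝ) / m ≤ 1 := by rw [div_le_iff₀ hm]; linarith
      linarith) hs hκ hsmall (h.twoPointBound hβ hβ1 hz hs hK (N := m) (by omega))
    (m := m) (by omega)
  refine ⟨(piAbs_mono hz (fun x => by linarith [hq x]) m).trans key, ?_⟩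
  calc piAbs β z (sqn : (Fin d → ℤ) → ℝ) m
      ≤ piAbs β z (fun x : Fin d → ℤ => m * (1 + sqn x / m)) m :=
        piAbs_mono hz (fun x => by rw [mul_add, mul_div_cancel₀ _ hm.ne']; linarith) m
    _ = m * piAbs β z (fun x : Fin d → ℤ => 1 + sqn x / m) m := piAbs_mul_left _ _ _
    _ ≤ _ := mul_le_mul_of_nonneg_left key hm.le

end Wsaw

namespace Wsaw

open Finset.HasAntidiagonal (antidiagonal mem_antidiagonal)

section Moment

open PowerSeries in
lemma ScalarRec.mk_moment {θ : ℝ} {p r f M : ℕ → ℝ} (hp : p 0 = 0) (hr : r 0 = 0)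
    (h : ScalarRec θ p f) (hM0 : M 0 = 0)
    (hM : ∀ n, M (n + 1) = θ * M n + ∑ ij ∈ antidiagonal (n + 1), p ij.1 * M ij.2 +
      (θ * f n + ∑ ij ∈ antidiagonal (n + 1), r ij.1 * f ij.2)) :
    mk M = (C θ * X + mk r) * (mk f * mk f) := by
  have e : mk M * (1 - C θ * X - mk p) = (C θ * X + mk r) * mk f := by
    have e1 : C θ * X * mk f = mk f * C θ * X := by ring
    rw [mul_sub, mul_sub, mul_one, ← mul_assoc, mul_comm (mk M) (mk p), add_mul, e1]
    ext n
    cases n with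
    | zero => simp [hM0, hp, hr]
    | succ n =>
      simp only [map_sub, map_add, coeff_mk, coeff_succ_mul_X, coeff_mul_C]
      simp only [coeff_mul, coeff_mk]
      rw [hM n]
      ring
  calc mk M = mk M * (mk f * (1 - C θ * X - mk p)) := by rw [h.mk_mul hp, mul_one]
    _ = mk M * (1 - C θ * X - mk p) * mk f := by ring
    _ = _ := by rw [e]; ring

lemma ScalarRec.abs_moment_le {θ : ℝ} {p r f M : ℕ → ℝ} (hp : p 0 = 0) (hr : r 0 = 0)
    (h : ScalarRec θ p f) (hM0 : M 0 = 0)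
    (hM : ∀ n, M (n + 1) = θ * M n + ∑ ij ∈ antidiagonal (n + 1), p ij.1 * M ij.2 +
      (θ * f n + ∑ ij ∈ antidiagonal (n + 1), r ij.1 * f ij.2)) {A : ℝ} (hA : ∀ n, |f n| ≤ A)
    (n : ℕ) : |M n| ≤ A ^ 2 * (|θ| + ∑ m ∈ Finset.range (n + 1), |r m|) * n := by
  have hA0 : 0 ≤ A := (abs_nonneg _).trans (hA 0)
  have hsq : ∀ k, |PowerSeries.coeff k (PowerSeries.mk f * PowerSeries.mk f)| ≤ A ^ 2 * (k + 1) := by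
    intro k
    rw [PowerSeries.coeff_mul]
    simp only [PowerSeries.coeff_mk]
    calc |∑ x ∈ antidiagonal k, f x.1 * f x.2| ≤ ∑ x ∈ antidiagonal k, A ^ 2 :=
          (Finset.abs_sum_le_sum_abs _ _).trans (Finset.sum_le_sum fun x _ => by
            rw [abs_mul, sq]
            exact mul_le_mul (hA _) (hA _) (abs_nonneg _) hA0)
      _ = _ := by
        rw [Finset.sum_const, Finset.Nat.card_antidiagonal, nsmul_eq_mul]
        push_cast
        ring
  cases n with
  | zero => simp [hM0]
  | succ n =>
    have e := congrArg (PowerSeries.coeff (n + 1)) (h.mk_moment hp hr hM0 hM)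
    rw [PowerSeries.coeff_mk] at e
    rw [e, add_mul, map_add, mul_assoc, PowerSeries.coeff_C_mul, PowerSeries.coeff_succ_X_mul,
      PowerSeries.coeff_mul _ (PowerSeries.mk r)]
    simp only [PowerSeries.coeff_mk]
    have h1 : |θ * PowerSeries.coeff n (PowerSeries.mk f * PowerSeries.mk f)| ≤
        A ^ 2 * |θ| * (n + 1) := by
      rw [abs_mul]
      have := mul_le_mul_of_nonneg_left (hsq n) (abs_nonneg θ)
      linarith
    have h2 : |∑ x ∈ antidiagonal (n + 1), r x.1 *
        PowerSeries.coeff x.2 (PowerSeries.mk f * PowerSeries.mk f)| ≤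
        ∑ m ∈ Finset.range (n + 1 + 1), |r m| * (A ^ 2 * (n + 1)) := by
      refine (Finset.abs_sum_le_sum_abs _ _).trans ?_
      rw [← sum_antidiagonal_fst (fun m => |r m| * (A ^ 2 * ((n : ℝ) + 1)))]
      refine Finset.sum_le_sum fun x hx => ?_
      rw [abs_mul]
      rcases Nat.eq_zero_or_pos x.1 with h0 | h0
      · simp [h0, hr]
      · refine mul_le_mul_of_nonneg_left ((hsq _).trans (mul_le_mul_of_nonneg_left ?_
          (sq_nonneg A))) (abs_nonneg _)
        have hx := mem_antidiagonal.1 hx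
        have : x.2 ≤ n := by omega
        have : (x.2 : ℝ) ≤ n := by exact_mod_cast this
        linarith
    rw [← Finset.sum_mul] at h2
    push_cast
    have := abs_add_le (θ * PowerSeries.coeff n (PowerSeries.mk f * PowerSeries.mk f))
      (∑ x ∈ antidiagonal (n + 1), r x.1 *
        PowerSeries.coeff x.2 (PowerSeries.mk f * PowerSeries.mk f))
    linarith

end Moment

variable {d : ℕ} {β z : ℝ}

lemma cSum_neg_fun {n : ℕ} (G : (Fin d → ℤ) → ℝ) :
    cSum d β n (fun x => G (-x)) = cSum d β n G := by
  unfold cSum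
  rw [← walkSum_neg]
  refine walkSum_congr fun w => ?_
  simp only [Pi.neg_apply, neg_neg]
  congr 1
  exact wK_shift (j := 0) fun a b _ _ _ _ => by simp

lemma cSum_odd {n : ℕ} {G : (Fin d → ℤ) → ℝ} (hG : ∀ x, G (-x) = -G x) : cSum d β n G = 0 := by
  have h := cSum_neg_fun (β := β) (n := n) G
  have h2 := cSum_mul_left (β := β) (n := n) (-1) G
  simp only [hG] at h
  simp only [neg_mul, one_mul] at h2
  linarith

lemma piSum_mul_right {n : ℕ} (c : ℝ) (G : (Fin d → ℤ) → ℝ) :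
    piSum d β n (fun x => G x * c) = piSum d β n G * c := by
  unfold piSum
  split_ifs
  · simp
  · rw [← walkSum_mul_right]
    simp only [mul_assoc]

lemma piSum_add_fun {n : ℕ} (G H : (Fin d → ℤ) → ℝ) :
    piSum d β n (fun x => G x + H x) = piSum d β n G + piSum d β n H := by
  unfold piSum
  split_ifs
  · simp
  · rw [← walkSum_add_fun]
    simp only [mul_add]

/-- The pairing of a momentum with a lattice point. -/
noncomputable def dotp (k : Fin d → ℝ) (x : Fin d → ℤ) : ℝ := ∑ i, k i * x i

lemma dotp_add (k : Fin d → ℝ) (x y : Fin d → ℤ) : dotp k (x + y) = dotp k x + dotp k y := by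
  simp [dotp, mul_add, Finset.sum_add_distrib]

lemma dotp_neg (k : Fin d → ℝ) (x : Fin d → ℤ) : dotp k (-x) = -dotp k x := by
  simp [dotp]

lemma dotp_wsawStep (k : Fin d → ℝ) (e : Fin d × Bool) :
    dotp k (wsawStep d e) = if e.2 then k e.1 else -k e.1 := by
  unfold dotp wsawStep
  rw [Finset.sum_eq_single e.1]
  · rcases e with ⟨i, b⟩
    cases b <;> simp
  · intro i _ hi
    simp [hi]
  · simp

lemma sum_cos_dotp_wsawStep (k : Fin d → ℝ) :
    ∑ e : Fin d × Bool, Real.cos (dotp k (wsawStep d e)) = 2 * ∑ i, Real.cos (k i) := by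
  rw [Fintype.sum_prod_type, Finset.mul_sum]
  refine Finset.sum_congr rfl fun i _ => ?_
  simp [dotp_wsawStep, two_mul]

lemma cSum_cos_add {n : ℕ} (k : Fin d → ℝ) (α : ℝ) :
    cSum d β n (fun y => Real.cos (α + dotp k y)) =
      Real.cos α * cSum d β n (fun y => Real.cos (dotp k y)) := by
  have h : cSum d β n (fun y => Real.sin (dotp k y)) = 0 :=
    cSum_odd fun x => by rw [dotp_neg, Real.sin_neg]
  simp only [Real.cos_add, sub_eq_add_neg, ← neg_mul]
  rw [cSum_add_fun, cSum_mul_left, cSum_mul_left, h, mul_zero, add_zero]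

/-- The Fourier transform of the two-point function. -/
noncomputable def fHat (β z : ℝ) (k : Fin d → ℝ) (n : ℕ) : ℝ :=
  z ^ n * cSum d β n fun x => Real.cos (dotp k x)

/-- The Fourier transform of the lace coefficient. -/
noncomputable def pHat (β z : ℝ) (k : Fin d → ℝ) (m : ℕ) : ℝ :=
  z ^ m * piSum d β m fun x => Real.cos (dotp k x)

lemma scalarRec_fHat (k : Fin d → ℝ) :
    ScalarRec (2 * z * ∑ i, Real.cos (k i)) (pHat β z k) (fHat β z k) := by
  refine ⟨?_, fun n => ?_⟩
  · simp [fHat, cSum_zero, dotp]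
  · unfold fHat pHat
    rw [cSum_succ]
    simp only [dotp_add, cSum_cos_add, piSum_mul_right]
    rw [← Finset.sum_mul, sum_cos_dotp_wsawStep, mul_add, Finset.mul_sum (antidiagonal (n + 1))]
    congr 1
    · ring
    · refine Finset.sum_congr rfl fun ij hij => ?_
      rw [← mem_antidiagonal.1 hij, pow_add]
      ring

lemma cSum_sqn_add {n : ℕ} (x : Fin d → ℤ) :
    cSum d β n (fun y => sqn (x + y)) =
      sqn x * cSum d β n (fun _ => 1) + 1 * cSum d β n sqn := by
  have h : cSum d β n (fun y => ∑ i, 2 * (x i : ℝ) * y i) = 0 :=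
    cSum_odd fun y => by simp
  have e : ∀ y : Fin d → ℤ, sqn (x + y) = sqn x * 1 + sqn y + ∑ i, 2 * (x i : ℝ) * y i := by
    intro y
    unfold sqn
    rw [mul_one, ← Finset.sum_add_distrib, ← Finset.sum_add_distrib]
    refine Finset.sum_congr rfl fun i _ => ?_
    rw [Pi.add_apply]
    push_cast
    ring
  simp only [e]
  rw [cSum_add_fun, h, cSum_add_fun, cSum_mul_left]
  ring

lemma scalarRec_total :
    ScalarRec (2 * d * z) (fun m => z ^ m * piSum d β m fun _ => 1)
      (fun n => z ^ n * cSum d β n fun _ => 1) := by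
  have h := scalarRec_fHat (β := β) (z := z) (0 : Fin d → ℝ)
  unfold fHat pHat at h
  simp only [dotp, Pi.zero_apply, zero_mul, Finset.sum_const_zero, Real.cos_zero,
    Finset.sum_const, Finset.card_univ, Fintype.card_fin, nsmul_eq_mul, mul_one] at h
  rwa [mul_assoc, mul_comm (d : ℝ), ← mul_assoc]

lemma moment_succ (n : ℕ) :
    z ^ (n + 1) * cSum d β (n + 1) sqn = 2 * d * z * (z ^ n * cSum d β n sqn) +
      ∑ ij ∈ antidiagonal (n + 1),
        (z ^ ij.1 * piSum d β ij.1 fun _ => 1) * (z ^ ij.2 * cSum d β ij.2 sqn) +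
      (2 * d * z * (z ^ n * cSum d β n fun _ => 1) + ∑ ij ∈ antidiagonal (n + 1),
        (z ^ ij.1 * piSum d β ij.1 sqn) * (z ^ ij.2 * cSum d β ij.2 fun _ => 1)) := by
  rw [cSum_succ]
  simp only [cSum_sqn_add, piSum_add_fun, piSum_mul_right, sqn_wsawStep]
  rw [Finset.sum_const, Finset.card_univ, Fintype.card_prod, Fintype.card_fin,
    Fintype.card_bool, nsmul_eq_mul, mul_add, Finset.mul_sum, Finset.sum_congr rfl
      (fun ij hij => show z ^ (n + 1) * (piSum d β ij.1 sqn * cSum d β ij.2 (fun _ => 1) +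
        piSum d β ij.1 (fun _ => 1) * cSum d β ij.2 sqn) =
        (z ^ ij.1 * piSum d β ij.1 fun _ => 1) * (z ^ ij.2 * cSum d β ij.2 sqn) +
        (z ^ ij.1 * piSum d β ij.1 sqn) * (z ^ ij.2 * cSum d β ij.2 fun _ => 1) by
          rw [← mem_antidiagonal.1 hij, pow_add]; ring), Finset.sum_add_distrib]
  push_cast
  ring

/-- The Fourier symbol of the lattice Laplacian. -/
noncomputable def symb (k : Fin d → ℝ) : ℝ := ∑ i, (1 - Real.cos (k i))

lemma abs_sin_nat_mul_le (n : ℕ) (θ : ℝ) : |Real.sin (n * θ)| ≤ n * |Real.sin θ| := by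
  induction n with
  | zero => simp
  | succ n ih =>
    push_cast
    rw [add_mul, one_mul, Real.sin_add]
    refine (abs_add_le _ _).trans ?_
    rw [abs_mul, abs_mul]
    have h1 := mul_le_of_le_one_right (abs_nonneg (Real.sin (n * θ))) (Real.abs_cos_le_one θ)
    have h2 := mul_le_of_le_one_left (abs_nonneg (Real.sin θ)) (Real.abs_cos_le_one (n * θ))
    linarith

lemma abs_sin_int_mul_le (n : ℤ) (θ : ℝ) : |Real.sin (n * θ)| ≤ |(n : ℝ)| * |Real.sin θ| := by
  rcases Int.natAbs_eq n with h | h <;> rw [h]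
  · simpa using abs_sin_nat_mul_le n.natAbs θ
  · simpa using abs_sin_nat_mul_le n.natAbs θ

lemma abs_sin_sum_le {ι : Type*} (S : Finset ι) (f : ι → ℝ) :
    |Real.sin (∑ i ∈ S, f i)| ≤ ∑ i ∈ S, |Real.sin (f i)| := by
  classical
  induction S using Finset.induction_on with
  | empty => simp
  | insert a S ha ih =>
    rw [Finset.sum_insert ha, Finset.sum_insert ha, Real.sin_add]
    refine (abs_add_le _ _).trans ?_
    rw [abs_mul, abs_mul]
    have h1 := mul_le_of_le_one_right (abs_nonneg (Real.sin (f a)))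
      (Real.abs_cos_le_one (∑ i ∈ S, f i))
    have h2 := mul_le_of_le_one_left (abs_nonneg (Real.sin (∑ i ∈ S, f i)))
      (Real.abs_cos_le_one (f a))
    linarith

lemma one_sub_cos_eq (θ : ℝ) : 1 - Real.cos θ = 2 * Real.sin (θ / 2) ^ 2 := by
  have h := Real.cos_sq_add_sin_sq (θ / 2)
  have h2 := Real.cos_two_mul (θ / 2)
  rw [mul_div_cancel₀ _ two_ne_zero] at h2
  linarith

lemma one_sub_cos_dotp_le (k : Fin d → ℝ) (x : Fin d → ℤ) :
    1 - Real.cos (dotp k x) ≤ sqn x * symb k := by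
  have h1 : |Real.sin (dotp k x / 2)| ≤ ∑ i, |(x i : ℝ)| * |Real.sin (k i / 2)| := by
    have e : dotp k x / 2 = ∑ i, (x i : ℝ) * (k i / 2) := by
      unfold dotp
      rw [Finset.sum_div]
      exact Finset.sum_congr rfl fun i _ => by ring
    rw [e]
    exact (abs_sin_sum_le _ _).trans (Finset.sum_le_sum fun i _ => abs_sin_int_mul_le _ _)
  have h2 := Finset.sum_mul_sq_le_sq_mul_sq Finset.univ (fun i => |(x i : ℝ)|)
    (fun i => |Real.sin (k i / 2)|)
  simp only [sq_abs] at h2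
  have h3 : symb k = 2 * ∑ i, Real.sin (k i / 2) ^ 2 := by
    unfold symb
    rw [Finset.mul_sum]
    exact Finset.sum_congr rfl fun i _ => one_sub_cos_eq _
  have h4 := pow_le_pow_left₀ (abs_nonneg _) h1 2
  rw [sq_abs] at h4
  rw [one_sub_cos_eq, h3]
  unfold sqn
  linarith

lemma symb_nonneg (k : Fin d → ℝ) : 0 ≤ symb k :=
  Finset.sum_nonneg fun i _ => by linarith [Real.cos_le_one (k i)]

lemma parity_wsawPos {n : ℕ} (w : Fin n → Fin d × Bool) :
    ∃ j : ℤ, ∑ i, wsawPos w n i = n + 2 * j := by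
  have h : ∀ e : Fin d × Bool, ∃ j : ℤ, ∑ i, wsawStep d e i = 1 + 2 * j := by
    rintro ⟨a, b⟩
    unfold wsawStep
    rw [Finset.sum_ite_eq']
    cases b
    · exact ⟨-1, by simp⟩
    · exact ⟨0, by simp⟩
  choose J hJ using h
  refine ⟨∑ j, J (w j), ?_⟩
  rw [wsawPos_eq_sum]
  simp only [Fin.is_lt, if_true, Finset.sum_apply]
  rw [Finset.sum_comm, Finset.sum_congr rfl fun j _ => hJ (w j), Finset.sum_add_distrib,
    ← Finset.mul_sum]
  simp

lemma abs_fHat_add_pi (k : Fin d → ℝ) (n : ℕ) :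
    |fHat β z (fun i => k i + Real.pi) n| = |fHat β z k n| := by
  have h : fHat β z (fun i => k i + Real.pi) n = (-1) ^ n * fHat β z k n := by
    unfold fHat cSum
    rw [mul_left_comm, ← walkSum_mul_left ((-1) ^ n)]
    congr 1
    refine walkSum_congr fun w => ?_
    obtain ⟨j, hj⟩ := parity_wsawPos w
    have e : dotp (fun i => k i + Real.pi) (wsawPos w n) =
        dotp k (wsawPos w n) + n * Real.pi + j * (2 * Real.pi) := by
      have hj' : ∑ i, (wsawPos w n i : ℝ) = n + 2 * j := by exact_mod_cast hj
      unfold dotp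
      simp only [add_mul, Finset.sum_add_distrib]
      rw [← Finset.mul_sum, hj']
      ring
    beta_reduce
    rw [e, Real.cos_add_int_mul_two_pi, Real.cos_add_nat_mul_pi]
    ring
  rw [h, abs_mul, abs_pow, abs_neg, abs_one, one_pow, one_mul]

end Wsaw

namespace Wsaw

open Finset.HasAntidiagonal (antidiagonal mem_antidiagonal)

variable {d : ℕ} {β z s K : ℝ}

/-- The conclusion of the scalar renewal analysis with constants `C` and `b0`. -/
def RecBound (s C b0 : ℝ) : Prop :=
  ∀ b θ p f, 0 ≤ b → b ≤ b0 → SmallCoeff s b p → ScalarRec θ p f → 0 ≤ 1 - θ - ∑' m, p m →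
    1 - θ - ∑' m, p m ≤ 3 / 2 → ∀ n : ℕ, |f n| ≤ 1 + C * b ∧
      |f n| ≤ C * (1 + (1 - θ - ∑' m, p m) * n) ^ (-s) ∧
      |f (n + 1) - (θ + ∑' m, p m) * f n| ≤ C * b * psi s (1 - θ - ∑' m, p m) (n + 1)

/-- The size of the lace coefficients. -/
noncomputable def laceB (s K β : ℝ) : ℝ := 16 * 2 ^ (s + 1) * laceConst s K * β

/-- The sum of `(m + 1) ^ (-s)`. -/
noncomputable def zetaSum (s : ℝ) : ℝ := ∑' m : ℕ, ((m : ℝ) + 1) ^ (-s)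

/-- The total of the lace coefficients at zero momentum. -/
noncomputable def piTotal (d : ℕ) (β z : ℝ) : ℝ := ∑' m, z ^ m * piSum d β m fun _ => 1

lemma laceB_nonneg (hK : 0 ≤ K) (hβ : 0 ≤ β) : 0 ≤ laceB s K β := by
  unfold laceB laceConst; positivity

/-- Decay of the lace coefficients, together with standing assumptions on the parameters. -/
structure Good (d : ℕ) (β z s K : ℝ) : Prop where
  beta_nonneg : 0 ≤ β
  beta_le : β ≤ 1
  one_le : 1 ≤ 2 * d * z
  one_lt : 1 < s
  K_nonneg : 0 ≤ K
  small' : 2 * d * (laceB s K β * zetaSum s) ≤ 1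
  pi_le : ∀ m, piAbs β z (fun _ : Fin d → ℤ => 1) m ≤ laceB s K β * dec s m ∧
    piAbs β z (sqn : (Fin d → ℤ) → ℝ) m ≤ m * (laceB s K β * dec s m)

namespace Good

variable (h : Good d β z s K)
include h

lemma z_pos : 0 < z := by
  by_contra! hz
  have := h.one_le
  nlinarith [mul_nonneg (Nat.cast_nonneg (α := ℝ) d) (neg_nonneg.2 hz)]

lemma d_pos : (1 : ℝ) ≤ d := by
  rcases Nat.eq_zero_or_pos d with h0 | h0
  · have := h.one_le
    subst h0
    norm_num at this
  · exact_mod_cast h0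

lemma laceB_nonneg : 0 ≤ laceB s K β := Wsaw.laceB_nonneg h.K_nonneg h.beta_nonneg

lemma summable_dec : Summable fun m : ℕ => ((m : ℝ) + 1) ^ (-s) := summable_rpow_neg h.one_lt

lemma zetaSum_pos : 0 < zetaSum s :=
  h.summable_dec.tsum_pos (fun _ => by positivity) 0 (by positivity)

lemma laceB_mul_le : laceB s K β * zetaSum s ≤ 1 / 2 := by
  have h1 := h.small'
  have h2 := mul_nonneg h.laceB_nonneg h.zetaSum_pos.le
  nlinarith [h.d_pos]

lemma piAbs_le (m : ℕ) : piAbs β z (fun _ : Fin d → ℤ => 1) m ≤ laceB s K β * dec s m :=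
  (h.pi_le m).1

lemma piAbs_sqn_le (m : ℕ) :
    piAbs β z (sqn : (Fin d → ℤ) → ℝ) m ≤ laceB s K β * ((m : ℝ) + 1) ^ (-s) := by
  refine (h.pi_le m).2.trans ?_
  rw [← dec_mul]
  have := mul_nonneg h.laceB_nonneg (dec_pos s m).le
  linarith

lemma smallCoeff_of_abs_le {G : (Fin d → ℤ) → ℝ} (hG : ∀ x, |G x| ≤ 1) :
    SmallCoeff s (laceB s K β) fun m => z ^ m * piSum d β m G where
  zero := by simp [piSum]
  one := by simp [piSum]
  bound := fun m => (abs_piSum_mul_le h.z_pos.le hG m).trans (h.piAbs_le m)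

lemma abs_tsum_le_of_abs_le {G : (Fin d → ℤ) → ℝ} (hG : ∀ x, |G x| ≤ 1) :
    |∑' m, z ^ m * piSum d β m G| ≤ laceB s K β * zetaSum s := by
  rw [zetaSum, ← tsum_mul_left, ← Real.norm_eq_abs]
  refine tsum_of_norm_bounded (h.summable_dec.mul_left _).hasSum fun m => ?_
  refine ((h.smallCoeff_of_abs_le hG).bound m).trans
    (mul_le_mul_of_nonneg_left ?_ h.laceB_nonneg)
  exact Real.rpow_le_rpow_of_exponent_le (by linarith [Nat.cast_nonneg (α := ℝ) m]) (by linarith)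

lemma abs_tsum_le_of_le_sqn {G : (Fin d → ℤ) → ℝ} {W : ℝ} (hW : 0 ≤ W)
    (hG : ∀ x, |G x| ≤ W * sqn x) :
    |∑' m, z ^ m * piSum d β m G| ≤ W * (laceB s K β * zetaSum s) := by
  rw [zetaSum, ← tsum_mul_left, ← tsum_mul_left, ← Real.norm_eq_abs]
  refine tsum_of_norm_bounded ((h.summable_dec.mul_left _).mul_left _).hasSum fun m => ?_
  refine (abs_piSum_mul_le h.z_pos.le hG m).trans ?_
  rw [piAbs_mul_left]
  exact mul_le_mul_of_nonneg_left (h.piAbs_sqn_le m) hW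

lemma eta_bounds (h0 : 0 ≤ 1 - 2 * d * z - piTotal d β z) (k : Fin d → ℝ) (hk : symb k ≤ d) :
    symb k / (2 * d) ≤ 1 - 2 * z * ∑ i, Real.cos (k i) - ∑' m, pHat β z k m ∧
      1 - 2 * z * ∑ i, Real.cos (k i) - ∑' m, pHat β z k m ≤ 3 / 2 := by
  have hW := symb_nonneg k
  have hcos : ∑ i, Real.cos (k i) = d - symb k := by
    unfold symb
    rw [Finset.sum_sub_distrib]
    simp
  have hd := h.d_pos
  have h1 : |piTotal d β z - ∑' m, pHat β z k m| ≤ symb k * (laceB s K β * zetaSum s) := by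
    unfold piTotal pHat
    rw [← Summable.tsum_sub
      ((h.smallCoeff_of_abs_le (G := fun _ => 1) (by simp)).summable (by linarith [h.one_lt]))
      ((h.smallCoeff_of_abs_le (G := fun x => Real.cos (dotp k x))
        fun x => Real.abs_cos_le_one _).summable (by linarith [h.one_lt]))]
    have e : ∀ m, z ^ m * piSum d β m (fun _ => 1) - z ^ m * piSum d β m
        (fun x => Real.cos (dotp k x)) = z ^ m * piSum d β m fun x => 1 + Real.cos (dotp k x) * (-1) := by
      intro m
      rw [piSum_add_fun, piSum_mul_right]
      ring
    simp only [e]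
    refine h.abs_tsum_le_of_le_sqn hW fun x => ?_
    rw [abs_of_nonneg (by linarith [Real.cos_le_one (dotp k x)])]
    linarith [one_sub_cos_dotp_le k x]
  have h2 := h.abs_tsum_le_of_abs_le (G := fun x => Real.cos (dotp k x))
    fun x => Real.abs_cos_le_one _
  change |∑' m, pHat β z k m| ≤ _ at h2
  rw [hcos]
  constructor
  · have h3 : laceB s K β * zetaSum s ≤ 1 / (2 * d) := by
      rw [le_div_iff₀ (by linarith)]
      linarith [h.small']
    have h4 := mul_le_mul_of_nonneg_left h3 hW
    have h5 : symb k * (1 / d) ≤ symb k * (2 * z) := by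
      refine mul_le_mul_of_nonneg_left ?_ hW
      rw [div_le_iff₀ (by linarith)]
      linarith [h.one_le]
    have h6 : symb k * (1 / d) = symb k / (2 * d) + symb k * (1 / (2 * d)) := by
      field_simp
      ring
    have := (abs_le.1 h1).1
    linarith
  · have h3 := mul_nonneg h.z_pos.le (sub_nonneg.2 hk)
    have := (abs_le.1 h2).1
    linarith [h.laceB_mul_le]

lemma abs_fHat_le {C b0 : ℝ} (hR : RecBound s C b0) (hC : 0 ≤ C) (hb : laceB s K β ≤ b0)
    (h0 : 0 ≤ 1 - 2 * d * z - piTotal d β z) (k : Fin d → ℝ) (hk : symb k ≤ d) (n : ℕ) :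
    |fHat β z k n| ≤ C * (1 + symb k / (2 * d) * n) ^ (-s) := by
  have hη := h.eta_bounds h0 k hk
  have hW : 0 ≤ symb k / (2 * d) := div_nonneg (symb_nonneg k) (by linarith [h.d_pos])
  have h1 := (hR _ _ _ _ h.laceB_nonneg hb (h.smallCoeff_of_abs_le
    fun x => Real.abs_cos_le_one _) (scalarRec_fHat k) (hW.trans hη.1) hη.2 n).2.1
  refine h1.trans (mul_le_mul_of_nonneg_left ?_ hC)
  have hn : (0 : ℝ) ≤ n := Nat.cast_nonneg n
  unfold pHat at hη
  exact Real.rpow_le_rpow_of_nonpos (by positivity)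
    (by linarith [mul_le_mul_of_nonneg_right hη.1 hn]) (by linarith [h.one_lt])

lemma abs_fHat_le_add {C b0 : ℝ} (hR : RecBound s C b0) (hC : 0 ≤ C) (hb : laceB s K β ≤ b0)
    (h0 : 0 ≤ 1 - 2 * d * z - piTotal d β z) (k : Fin d → ℝ) (n : ℕ) :
    |fHat β z k n| ≤ C * ((1 + symb k / (2 * d) * n) ^ (-s) +
      (1 + symb (fun i => k i + Real.pi) / (2 * d) * n) ^ (-s)) := by
  have hpos : ∀ k : Fin d → ℝ, 0 ≤ C * (1 + symb k / (2 * d) * n) ^ (-s) := fun k => by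
    have := symb_nonneg k
    positivity
  rw [mul_add]
  rcases le_or_gt (symb k) d with hk | hk
  · linarith [h.abs_fHat_le hR hC hb h0 k hk n, hpos fun i => k i + Real.pi]
  · have hk' : symb (fun i => k i + Real.pi) ≤ d := by
      unfold symb at *
      simp only [Real.cos_add_pi, Finset.sum_sub_distrib, Finset.sum_neg_distrib] at *
      simp at *
      linarith
    have := h.abs_fHat_le hR hC hb h0 _ hk' n
    rw [abs_fHat_add_pi] at this
    linarith [hpos k]

lemma total_le {C b0 : ℝ} (hR : RecBound s C b0) (hb : laceB s K β ≤ b0)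
    (h0 : 0 ≤ 1 - 2 * d * z - piTotal d β z) (n : ℕ) :
    z ^ n * cSum d β n (fun _ => 1) ≤ 1 + C * laceB s K β := by
  have h1 : 1 - 2 * d * z - piTotal d β z ≤ 3 / 2 := by
    have := (abs_le.1 (h.abs_tsum_le_of_abs_le (G := fun _ => 1) (by simp))).1
    change _ ≤ piTotal d β z at this
    linarith [h.laceB_mul_le, h.one_le]
  exact (le_abs_self _).trans (hR _ _ _ _ h.laceB_nonneg hb
    (h.smallCoeff_of_abs_le (G := fun _ => 1) (by simp)) scalarRec_total h0 h1 n).1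

lemma two_mul_le (h0 : 0 ≤ 1 - 2 * d * z - piTotal d β z) :
    2 * d * z ≤ 1 + laceB s K β * zetaSum s := by
  have := (abs_le.1 (h.abs_tsum_le_of_abs_le (G := fun _ => 1) (by simp))).1
  change _ ≤ piTotal d β z at this
  linarith

lemma moment_le {C b0 : ℝ} (hR : RecBound s C b0) (hb : laceB s K β ≤ b0)
    (h0 : 0 ≤ 1 - 2 * d * z - piTotal d β z) (n : ℕ) :
    z ^ n * cSum d β n sqn ≤
      (1 + C * laceB s K β) ^ 2 * (1 + 2 * (laceB s K β * zetaSum s)) * n := by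
  have hz := h.z_pos.le
  have h1 := ScalarRec.abs_moment_le (p := fun m => z ^ m * piSum d β m fun _ => 1)
    (r := fun m => z ^ m * piSum d β m sqn) (M := fun n => z ^ n * cSum d β n sqn)
    (by simp [piSum]) (by simp [piSum]) scalarRec_total (by simp [cSum_zero, sqn_zero])
    moment_succ (A := 1 + C * laceB s K β) (fun n => by
      rw [abs_of_nonneg (mul_nonneg (pow_nonneg hz n) (cSum_nonneg h.beta_le fun _ => zero_le_one))]
      exact h.total_le hR hb h0 n) n
  refine (le_abs_self _).trans (h1.trans ?_)
  refine mul_le_mul_of_nonneg_right (mul_le_mul_of_nonneg_left ?_ (sq_nonneg _)) (Nat.cast_nonneg n)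
  have h2 : ∑ m ∈ Finset.range (n + 1), |z ^ m * piSum d β m sqn| ≤ laceB s K β * zetaSum s := by
    calc _ ≤ ∑ m ∈ Finset.range (n + 1), laceB s K β * ((m : ℝ) + 1) ^ (-s) :=
          Finset.sum_le_sum fun m _ => (abs_piSum_mul_le hz
            (fun x => (abs_of_nonneg (sqn_nonneg x)).le) m).trans (h.piAbs_sqn_le m)
      _ = laceB s K β * ∑ m ∈ Finset.range (n + 1), ((m : ℝ) + 1) ^ (-s) :=
          (Finset.mul_sum _ _ _).symm
      _ ≤ _ := mul_le_mul_of_nonneg_left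
          (h.summable_dec.sum_le_tsum _ fun _ _ => by positivity) h.laceB_nonneg
  have h3 : |2 * d * z| = 2 * d * z := abs_of_nonneg (by positivity)
  linarith [h.two_mul_le h0]

end Good

lemma wTheta_zero_beta {X : Type*} [DecidableEq X] (ω : ℕ → X) (t m : ℕ) (u : X) :
    wTheta 0 ω t m u = 0 := by
  rw [wTheta_eq]
  simp

lemma piAbs_zero_beta {ρ : (Fin d → ℤ) → ℝ} (m : ℕ) : piAbs 0 z ρ m = 0 := by
  unfold piAbs
  split_ifs
  · rfl
  · have h : ∀ ω : ℕ → Fin d → ℤ, wV 0 ω 0 1 m = 0 := fun ω => by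
      refine abs_nonpos_iff.1 ((abs_wV_le le_rfl zero_le_one ω 0 1 m).trans (le_of_eq ?_))
      exact Finset.sum_eq_zero fun _ _ => wTheta_zero_beta _ _ _ _
    simp [h, walkSum]

end Wsaw

namespace Wsaw

open MeasureTheory Real

variable {d : ℕ} {β z s K : ℝ}

/-- Lebesgue measure on the Brillouin zone `(-π, π]^d`. -/
noncomputable def zone (d : ℕ) : Measure (Fin d → ℝ) :=
  Measure.pi fun _ => volume.restrict (Set.Ioc (-π) π)

instance : IsFiniteMeasure (zone d) := by
  unfold zone
  infer_instance

lemma continuous_dotp (x : Fin d → ℤ) : Continuous fun k : Fin d → ℝ => dotp k x := by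
  unfold dotp
  fun_prop

lemma continuous_symb : Continuous (symb : (Fin d → ℝ) → ℝ) := by
  unfold symb
  fun_prop

lemma integrable_zone_of_bound {f : (Fin d → ℝ) → ℝ} (hf : Continuous f) (C : ℝ)
    (h : ∀ k, |f k| ≤ C) : Integrable f (zone d) :=
  Integrable.of_bound hf.aestronglyMeasurable C (Filter.Eventually.of_forall h)

lemma integral_exp_int (m : ℤ) :
    ∫ θ : ℝ in Set.Ioc (-π) π, Complex.exp (θ * m * Complex.I) = if m = 0 then 2 * (π : ℂ) else 0 := by
  rw [← intervalIntegral.integral_of_le (by linarith [pi_pos])]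
  split_ifs with h
  · subst h
    simp
    ring
  · have hc : (m : ℂ) * Complex.I ≠ 0 := by simp [h]
    have e : ∀ θ : ℝ, (θ : ℂ) * m * Complex.I = (m * Complex.I) * θ := fun θ => by ring
    simp only [e]
    rw [integral_exp_mul_complex hc, div_eq_zero_iff, sub_eq_zero]
    left
    refine Complex.exp_eq_exp_iff_exists_int.2 ⟨m, ?_⟩
    push_cast
    ring

lemma integral_cos_dotp (x : Fin d → ℤ) :
    ∫ k, cos (dotp k x) ∂(zone d) = if x = 0 then (2 * π) ^ d else 0 := by
  have e : ∀ k : Fin d → ℝ, cos (dotp k x) =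
      RCLike.re (∏ i, Complex.exp (k i * x i * Complex.I)) := fun k => by
    rw [← Complex.exp_sum, ← Finset.sum_mul]
    have : (∑ i, (k i : ℂ) * (x i : ℂ)) = ((dotp k x : ℝ) : ℂ) := by
      unfold dotp
      push_cast
      rfl
    rw [this]
    simp [Complex.exp_ofReal_mul_I_re]
  simp only [e]
  have hInt : Integrable (fun k : Fin d → ℝ => ∏ i, Complex.exp (k i * x i * Complex.I)) (zone d) := by
    refine Integrable.of_bound (Continuous.aestronglyMeasurable (by fun_prop)) 1
      (Filter.Eventually.of_forall fun k => ?_)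
    rw [norm_prod]
    refine le_of_eq (Finset.prod_eq_one fun i _ => ?_)
    have := Complex.norm_exp_ofReal_mul_I (k i * x i)
    push_cast at this
    exact this
  rw [integral_re hInt, zone, integral_fintype_prod_eq_prod (𝕜 := ℂ)
    (fun i (θ : ℝ) => Complex.exp (θ * x i * Complex.I))]
  simp only [integral_exp_int]
  split_ifs with h
  · subst h
    simp only [Pi.zero_apply, if_true, Finset.prod_const, Finset.card_univ, Fintype.card_fin]
    have : (2 * (π : ℂ)) ^ d = (((2 * π) ^ d : ℝ) : ℂ) := by push_cast; rfl
    rw [this]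
    simp only [Complex.ofReal_re, RCLike.re_to_complex]
  · obtain ⟨i, hi⟩ := Function.ne_iff.1 h
    rw [Finset.prod_eq_zero (Finset.mem_univ i) (if_neg hi)]
    simp

lemma integral_cSum {n : ℕ} {G : (Fin d → ℝ) → (Fin d → ℤ) → ℝ}
    (h : ∀ x, Integrable (fun k => G k x) (zone d)) :
    ∫ k, cSum d β n (G k) ∂(zone d) = cSum d β n fun x => ∫ k, G k x ∂(zone d) := by
  unfold cSum walkSum
  rw [integral_finsetSum _ fun s _ => (h _).const_mul _]
  exact Finset.sum_congr rfl fun s _ => integral_const_mul _ _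

lemma integrable_cSum {n : ℕ} {G : (Fin d → ℝ) → (Fin d → ℤ) → ℝ}
    (h : ∀ x, Integrable (fun k => G k x) (zone d)) :
    Integrable (fun k => cSum d β n (G k)) (zone d) := by
  unfold cSum walkSum
  exact integrable_finsetSum _ fun s _ => (h _).const_mul _

/-- Fourier inversion for the convolution of two endpoint distributions. -/
lemma cSum_cSum_eq_integral (z : ℝ) (a b : ℕ) (x : Fin d → ℤ) :
    (2 * π) ^ d * (z ^ (a + b) * cSum d β a fun u => cSum d β b fun v => if u + v = x then 1 else 0) =
      ∫ k, fHat β z k a * fHat β z k b * cos (dotp k x) ∂(zone d) := by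
  have hI : ∀ y : Fin d → ℤ, Integrable (fun k => cos (dotp k y)) (zone d) := fun y =>
    integrable_zone_of_bound (continuous_cos.comp (continuous_dotp y)) 1 fun k => abs_cos_le_one _
  have e : ∀ u v : Fin d → ℤ, (2 * π) ^ d * (if u + v = x then (1 : ℝ) else 0) =
      ∫ k, cos (dotp k (u + v - x)) ∂(zone d) := fun u v => by
    rw [integral_cos_dotp]
    simp only [sub_eq_zero, mul_ite, mul_one, mul_zero]
  have e2 : ∀ k : Fin d → ℝ, fHat β z k a * fHat β z k b * cos (dotp k x) =
      z ^ (a + b) * cSum d β a fun u => cSum d β b fun v => cos (dotp k (u + v - x)) := fun k => by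
    have h1 : ∀ u v : Fin d → ℤ, dotp k (u + v - x) = (-dotp k x + dotp k u) + dotp k v := by
      intro u v
      rw [sub_eq_add_neg, dotp_add, dotp_add, dotp_neg]
      ring
    simp only [h1, cSum_cos_add]
    have h2 : ∀ u : Fin d → ℤ, cos (-dotp k x + dotp k u) * cSum d β b (fun y => cos (dotp k y)) =
        cSum d β b (fun y => cos (dotp k y)) * cos (-dotp k x + dotp k u) := fun u => mul_comm _ _
    simp only [h2]
    rw [cSum_mul_left, cSum_cos_add, cos_neg]
    unfold fHat
    ring
  simp only [e2]
  rw [integral_const_mul, integral_cSum fun u => integrable_cSum fun v => hI _]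
  simp only [integral_cSum fun v => hI _, ← e, cSum_mul_left]
  ring

end Wsaw

namespace Wsaw

open MeasureTheory Real

variable {d : ℕ} {β z s K : ℝ}

/-- The integral `∫ (1 + t²)^(-α) dt`. -/
noncomputable def japInt (α : ℝ) : ℝ := ∫ t : ℝ, (1 + t ^ 2) ^ (-α)

lemma integrable_jap {α : ℝ} (hα : 1 / 2 < α) : Integrable fun t : ℝ => (1 + t ^ 2) ^ (-α) := by
  have h := integrable_rpow_neg_one_add_norm_sq (E := ℝ) (μ := volume) (r := 2 * α)
    (by simp; linarith)
  have e : -(2 * α) / 2 = -α := by ring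
  simpa [e] using h

lemma japInt_nonneg (α : ℝ) : 0 ≤ japInt α := integral_nonneg fun t => by positivity

lemma integral_one_add_one_sub_cos_le {α c : ℝ} (hα : 1 / 2 < α) (hc : 0 < c) :
    ∫ θ : ℝ in Set.Ioc (-π) π, (1 + c * (1 - cos θ)) ^ (-α) ≤ π / √(2 * c) * japInt α := by
  have hr : 0 < √(2 * c) := sqrt_pos.2 (by linarith)
  have ha : √(2 * c) / π ≠ 0 := (div_pos hr pi_pos).ne'
  have e : π / √(2 * c) * japInt α = ∫ θ : ℝ, (1 + (√(2 * c) / π * θ) ^ 2) ^ (-α) := by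
    rw [Measure.integral_comp_mul_left (fun t : ℝ => (1 + t ^ 2) ^ (-α)), japInt, smul_eq_mul,
      abs_of_nonneg (by positivity), inv_div]
  have hInt : Integrable fun θ : ℝ => (1 + (√(2 * c) / π * θ) ^ 2) ^ (-α) :=
    (integrable_jap hα).comp_mul_left' ha
  rw [e]
  refine le_trans (setIntegral_mono_on ?_ hInt.integrableOn measurableSet_Ioc ?_)
    (setIntegral_le_integral hInt (Filter.Eventually.of_forall fun θ => by positivity))
  · refine (ContinuousOn.integrableOn_Icc (Continuous.continuousOn ?_)).mono_set
      Set.Ioc_subset_Icc_self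
    refine Continuous.rpow_const (by fun_prop) fun θ => Or.inl ?_
    have := mul_nonneg hc.le (sub_nonneg.2 (cos_le_one θ))
    positivity
  · intro θ hθ
    have h1 := cos_le_one_sub_mul_cos_sq (abs_le.2 ⟨hθ.1.le, hθ.2⟩)
    refine rpow_le_rpow_of_nonpos (by positivity) ?_ (by linarith)
    have h2 : (√(2 * c) / π * θ) ^ 2 = c * (2 / π ^ 2 * θ ^ 2) := by
      rw [mul_pow, div_pow, sq_sqrt (by linarith)]
      ring
    rw [h2]
    have := mul_le_mul_of_nonneg_left (by linarith : 2 / π ^ 2 * θ ^ 2 ≤ 1 - cos θ) hc.le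
    linarith

lemma integral_cos_add_pi (F : ℝ → ℝ) :
    ∫ θ : ℝ in Set.Ioc (-π) π, F (cos (θ + π)) = ∫ θ : ℝ in Set.Ioc (-π) π, F (cos θ) := by
  have hp : Function.Periodic (fun θ => F (cos θ)) (2 * π) := fun θ => by simp
  have h := hp.intervalIntegral_add_eq 0 (-π)
  rw [← intervalIntegral.integral_of_le (by linarith [pi_pos]),
    ← intervalIntegral.integral_of_le (by linarith [pi_pos]),
    intervalIntegral.integral_comp_add_right (fun θ => F (cos θ))]
  have e1 : -π + π = 0 := by ring
  have e2 : -π + 2 * π = π := by ring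
  have e3 : π + π = 0 + 2 * π := by ring
  rw [e1, e3, h, e2]

lemma rpow_symb_le_prod {c : ℝ} (hc : 0 ≤ c) (hd : 0 < d) (hs : 0 ≤ s) (k : Fin d → ℝ) :
    (1 + c * symb k) ^ (-s) ≤ ∏ i, (1 + c * (1 - cos (k i))) ^ (-(s / d)) := by
  have hW := mul_nonneg hc (symb_nonneg k)
  have h1 : (1 + c * symb k) ^ (-s) = ∏ _i : Fin d, (1 + c * symb k) ^ (-(s / d)) := by
    rw [Finset.prod_const, Finset.card_univ, Fintype.card_fin, ← rpow_mul_natCast (by positivity)]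
    congr 1
    have : (d : ℝ) ≠ 0 := by positivity
    field_simp
  rw [h1]
  refine Finset.prod_le_prod (fun i _ => by positivity) fun i _ => ?_
  have h2 : ∀ j, 0 ≤ 1 - cos (k j) := fun j => sub_nonneg.2 (cos_le_one _)
  refine rpow_le_rpow_of_nonpos (by linarith [mul_nonneg hc (h2 i)]) ?_
    (neg_nonpos.2 (by positivity))
  have := mul_le_mul_of_nonneg_left
    (Finset.single_le_sum (f := fun j => 1 - cos (k j)) (fun j _ => h2 j) (Finset.mem_univ i)) hc
  unfold symb
  linarith

lemma continuous_rpow_symb {c : ℝ} (hc : 0 ≤ c) (s : ℝ) :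
    Continuous fun k : Fin d → ℝ => (1 + c * symb k) ^ (-s) := by
  refine Continuous.rpow_const (by have := continuous_symb (d := d); fun_prop) fun k => Or.inl ?_
  have := mul_nonneg hc (symb_nonneg k)
  positivity

lemma rpow_symb_le_one {c : ℝ} (hc : 0 ≤ c) (hs : 0 ≤ s) (k : Fin d → ℝ) :
    |(1 + c * symb k) ^ (-s)| ≤ 1 := by
  have := mul_nonneg hc (symb_nonneg k)
  rw [abs_of_nonneg (by positivity)]
  exact rpow_le_one_of_one_le_of_nonpos (by linarith) (by linarith)

lemma integral_rpow_symb_le {c : ℝ} (hc : 0 < c) (hd : 0 < d) (hs : (d : ℝ) / 2 < s) (σ : ℝ)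
    (hσ : σ = 0 ∨ σ = π) :
    ∫ k, (1 + c * symb (fun i => k i + σ)) ^ (-s) ∂(zone d) ≤
      (π / √(2 * c) * japInt (s / d)) ^ d := by
  have hd' : (0 : ℝ) < d := by exact_mod_cast hd
  have hs0 : 0 ≤ s := by linarith
  have hsh : Continuous fun k : Fin d → ℝ => fun i => k i + σ := by fun_prop
  have hcp : Continuous fun k : Fin d → ℝ => ∏ i, (1 + c * (1 - cos (k i + σ))) ^ (-(s / d)) := by
    refine continuous_finsetProd _ fun i _ => Continuous.rpow_const (by fun_prop) fun k => Or.inl ?_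
    have := mul_nonneg hc.le (sub_nonneg.2 (cos_le_one (k i + σ)))
    positivity
  calc _ ≤ ∫ k : Fin d → ℝ, ∏ i, (1 + c * (1 - cos (k i + σ))) ^ (-(s / d)) ∂(zone d) := by
        refine integral_mono (integrable_zone_of_bound ((continuous_rpow_symb hc.le s).comp hsh) 1
          fun k => rpow_symb_le_one hc.le hs0 _) (integrable_zone_of_bound hcp 1 fun k => ?_)
          fun k => rpow_symb_le_prod hc.le hd hs0 _
        rw [Finset.abs_prod]
        refine Finset.prod_le_one (fun i _ => abs_nonneg _) fun i _ => ?_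
        have := mul_nonneg hc.le (sub_nonneg.2 (cos_le_one (k i + σ)))
        rw [abs_of_nonneg (by positivity)]
        exact rpow_le_one_of_one_le_of_nonpos (by linarith) (neg_nonpos.2 (by positivity))
    _ = ∏ _i : Fin d, ∫ θ : ℝ in Set.Ioc (-π) π, (1 + c * (1 - cos (θ + σ))) ^ (-(s / d)) := by
        rw [zone, integral_fintype_prod_eq_prod (𝕜 := ℝ)
          (fun _ (θ : ℝ) => (1 + c * (1 - cos (θ + σ))) ^ (-(s / d)))]
    _ = (∫ θ : ℝ in Set.Ioc (-π) π, (1 + c * (1 - cos θ)) ^ (-(s / d))) ^ d := by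
        rw [Finset.prod_const, Finset.card_univ, Fintype.card_fin]
        congr 1
        rcases hσ with rfl | rfl
        · simp
        · exact integral_cos_add_pi fun y => (1 + c * (1 - y)) ^ (-(s / d))
    _ ≤ _ := by
        refine pow_le_pow_left₀ (setIntegral_nonneg measurableSet_Ioc fun θ _ => ?_)
          (integral_one_add_one_sub_cos_le ?_ hc) d
        · have := mul_nonneg hc.le (sub_nonneg.2 (cos_le_one θ))
          positivity
        · rw [lt_div_iff₀ hd']
          linarith

/-- The constant in the local limit bound. -/
noncomputable def pointConst (d : ℕ) (s : ℝ) : ℝ :=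
  4 * ((π * √d * japInt (2 * s / d)) / (2 * π)) ^ d * 4 ^ (s + 1)

lemma pointConst_nonneg (d : ℕ) (s : ℝ) : 0 ≤ pointConst d s := by
  have := japInt_nonneg (2 * s / d)
  unfold pointConst
  positivity

lemma Good.point_le (h : Good d β z s K) (hs : s + 1 = d / 2) {C b0 : ℝ} (hR : RecBound s C b0)
    (hC : 0 ≤ C) (hb : laceB s K β ≤ b0) (h0 : 0 ≤ 1 - 2 * d * z - piTotal d β z) {n : ℕ}
    (hn : 2 ≤ n) (x : Fin d → ℤ) :
    z ^ n * cSum d β n (fun y => if y = x then 1 else 0) ≤ C ^ 2 * pointConst d s * dec s n := by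
  obtain ⟨m, b, hm1, hmb, hmn, hn4⟩ : ∃ m b : ℕ, 1 ≤ m ∧ m ≤ b ∧ m + b = n ∧ n + 1 ≤ 4 * m :=
    ⟨n / 2, n - n / 2, by omega, by omega, by omega, by omega⟩
  have hd : (0 : ℝ) < d := by linarith [h.d_pos]
  have hdn : 0 < d := by exact_mod_cast hd
  have hs1 := h.one_lt
  have hm : (0 : ℝ) < m := by exact_mod_cast hm1
  set c : ℝ := m / (2 * d) with hcdef
  have hc : 0 < c := by positivity
  set g : (Fin d → ℝ) → ℝ := fun k => (1 + c * symb k) ^ (-s)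
  have hg : ∀ k, 0 ≤ g k := fun k => by
    have := mul_nonneg hc.le (symb_nonneg k)
    positivity
  have hF : ∀ j : ℕ, m ≤ j → ∀ k : Fin d → ℝ,
      |fHat β z k j| ≤ C * (g k + g fun i => k i + π) := by
    intro j hj k
    refine (h.abs_fHat_le_add hR hC hb h0 k j).trans (mul_le_mul_of_nonneg_left ?_ hC)
    have : ∀ k : Fin d → ℝ, (1 + symb k / (2 * d) * j) ^ (-s) ≤ g k := fun k => by
      have h1 := symb_nonneg k
      have hj' : (m : ℝ) ≤ j := by exact_mod_cast hj
      refine rpow_le_rpow_of_nonpos (by positivity) ?_ (by linarith)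
      have e : c * symb k = symb k / (2 * d) * m := by rw [hcdef]; ring
      rw [e]
      linarith [mul_le_mul_of_nonneg_left hj' (by positivity : 0 ≤ symb k / (2 * d))]
    exact add_le_add (this _) (this _)
  have hsq : ∀ k, g k ^ 2 = (1 + c * symb k) ^ (-(2 * s)) := fun k => by
    have := mul_nonneg hc.le (symb_nonneg k)
    rw [← rpow_natCast, ← rpow_mul (by positivity)]
    congr 1
    push_cast
    ring
  have hJ : ∀ σ : ℝ, σ = 0 ∨ σ = π → ∫ k, g (fun i => k i + σ) ^ 2 ∂(zone d) ≤
      (π / √(2 * c) * japInt (2 * s / d)) ^ d := fun σ hσ => by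
    simp only [hsq]
    exact integral_rpow_symb_le hc hdn (by linarith) σ hσ
  have hgint : ∀ σ : ℝ, Integrable (fun k => g (fun i => k i + σ) ^ 2) (zone d) := fun σ => by
    simp only [hsq]
    have hsh : Continuous fun k : Fin d → ℝ => fun i => k i + σ := by fun_prop
    exact integrable_zone_of_bound ((continuous_rpow_symb hc.le (2 * s)).comp hsh) 1
      fun k => rpow_symb_le_one hc.le (by linarith) _
  have key : (2 * π) ^ d * (z ^ n * cSum d β n fun y => if y = x then 1 else 0) ≤
      4 * C ^ 2 * (π / √(2 * c) * japInt (2 * s / d)) ^ d := by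
    have h1 := cSum_add_le h.beta_nonneg h.beta_le hmn (G := fun y : Fin d → ℤ =>
      if y = x then 1 else 0) (fun y => by split_ifs <;> norm_num)
    have h2 := cSum_cSum_eq_integral (β := β) z m b x
    rw [hmn] at h2
    have hz := h.z_pos.le
    refine (mul_le_mul_of_nonneg_left (mul_le_mul_of_nonneg_left h1 (pow_nonneg hz n))
      (by positivity)).trans ?_
    rw [h2]
    calc _ ≤ ∫ k, (2 * C ^ 2 * g (fun i => k i + 0) ^ 2 + 2 * C ^ 2 * g (fun i => k i + π) ^ 2)
          ∂(zone d) := by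
          refine (le_abs_self _).trans ?_
          rw [← norm_eq_abs]
          refine norm_integral_le_of_norm_le (((hgint 0).const_mul _).add ((hgint π).const_mul _))
            (Filter.Eventually.of_forall fun k => ?_)
          rw [norm_eq_abs, abs_mul, abs_mul]
          have e0 : (fun i => k i + 0) = k := by simp
          rw [e0]
          have h3 := mul_le_mul (hF m le_rfl k) (hF b hmb k) (abs_nonneg _)
            ((abs_nonneg _).trans (hF m le_rfl k))
          have h4 : |fHat β z k m| * |fHat β z k b| * |cos (dotp k x)| ≤
              |fHat β z k m| * |fHat β z k b| :=
            mul_le_of_le_one_right (by positivity) (abs_cos_le_one _)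
          have h5 := mul_nonneg (sq_nonneg C) (sq_nonneg (g k - g fun i => k i + π))
          linarith
      _ ≤ _ := by
          rw [integral_add ((hgint 0).const_mul _) ((hgint π).const_mul _), integral_const_mul,
            integral_const_mul]
          have h3 := mul_le_mul_of_nonneg_left (hJ 0 (Or.inl rfl)) (sq_nonneg C)
          have h4 := mul_le_mul_of_nonneg_left (hJ π (Or.inr rfl)) (sq_nonneg C)
          linarith
  have hrt : √(2 * c) = √m / √d := by
    rw [hcdef, ← sqrt_div hm.le]
    congr 1
    field_simp
  have hpow : √(m : ℝ) ^ d = (m : ℝ) ^ (s + 1) := by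
    rw [sqrt_eq_rpow, ← rpow_mul_natCast hm.le, hs]
    congr 1
    ring
  have hfin : 4 * C ^ 2 * (π / √(2 * c) * japInt (2 * s / d)) ^ d ≤
      (2 * π) ^ d * (C ^ 2 * pointConst d s * dec s n) := by
    have e1 : (π / √(2 * c) * japInt (2 * s / d)) ^ d =
        (2 * π) ^ d * (π * √d * japInt (2 * s / d) / (2 * π)) ^ d * (m : ℝ) ^ (-(s + 1)) := by
      rw [rpow_neg hm.le, ← hpow, ← mul_pow, ← inv_pow, ← mul_pow, hrt]
      congr 1
      field_simp
    have e2 : (m : ℝ) ^ (-(s + 1)) ≤ 4 ^ (s + 1) * dec s n := by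
      have h1 : (4 * (m : ℝ)) ^ (-(s + 1)) ≤ ((n : ℝ) + 1) ^ (-(s + 1)) :=
        rpow_le_rpow_of_nonpos (by positivity) (by exact_mod_cast hn4) (by linarith)
      rwa [mul_rpow (by norm_num) hm.le, rpow_neg (by norm_num : (0 : ℝ) ≤ 4),
        inv_mul_le_iff₀ (by positivity)] at h1
    rw [e1, pointConst]
    have := japInt_nonneg (2 * s / d)
    have := mul_le_mul_of_nonneg_left e2 (by positivity : 0 ≤ 4 * C ^ 2 *
      ((2 * π) ^ d * (π * √d * japInt (2 * s / d) / (2 * π)) ^ d))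
    linarith
  exact le_of_mul_le_mul_left (key.trans hfin) (by positivity)

end Wsaw

namespace Wsaw

open Finset.HasAntidiagonal (antidiagonal mem_antidiagonal)

variable {d : ℕ} {β z s K C b0 : ℝ}

/-- The constant of the improved bootstrap bound. -/
noncomputable def bootConst (d : ℕ) (s C : ℝ) : ℝ := 8 + C ^ 2 * pointConst d s + 2 * 2 ^ (s + 1)

lemma le_bootConst (d : ℕ) (s C : ℝ) : 8 ≤ bootConst d s C := by
  have := pointConst_nonneg d s
  have : 0 ≤ C ^ 2 * pointConst d s + 2 * 2 ^ (s + 1) := by positivity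
  unfold bootConst
  linarith

/-- The smallness conditions on `β`. -/
structure SmallBeta (d : ℕ) (s C b0 β : ℝ) : Prop where
  beta_nonneg : 0 ≤ β
  beta_le : β ≤ 1
  exponent : s + 1 = d / 2
  one_lt : 1 < s
  recBound : RecBound s C b0
  one_le : 1 ≤ C
  small : 48 * 3 ^ (s + 1) * teleConst s * laceConst s (2 * bootConst d s C) ^ 2 * β ≤ 1
  small_zeta : 2 * d * (laceB s (2 * bootConst d s C) β * zetaSum s) ≤ 1
  small_b0 : laceB s (2 * bootConst d s C) β ≤ b0
  small_C : C * laceB s (2 * bootConst d s C) β ≤ 1 / 10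

namespace SmallBeta

variable (hS : SmallBeta d s C b0 β)
include hS

lemma d_pos : (0 : ℝ) < d := by linarith [hS.exponent, hS.one_lt]

lemma zero : SmallBeta d s C b0 0 := by
  have e : laceB s (2 * bootConst d s C) 0 = 0 := by simp [laceB]
  have h := hS.small_b0
  have h' : 0 ≤ laceB s (2 * bootConst d s C) β :=
    laceB_nonneg (by linarith [le_bootConst d s C]) hS.beta_nonneg
  exact ⟨le_rfl, zero_le_one, hS.exponent, hS.one_lt, hS.recBound, hS.one_le, by simp,
    by simp [e], by rw [e]; linarith, by rw [e]; norm_num⟩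

lemma good_of_pi_le (hz : 1 ≤ 2 * d * z)
    (h : ∀ m, piAbs β z (fun _ : Fin d → ℤ => 1) m ≤
        laceB s (2 * bootConst d s C) β * dec s m ∧ piAbs β z (sqn : (Fin d → ℤ) → ℝ) m ≤
        m * (laceB s (2 * bootConst d s C) β * dec s m)) :
    Good d β z s (2 * bootConst d s C) :=
  ⟨hS.beta_nonneg, hS.beta_le, hz, hS.one_lt, by linarith [le_bootConst d s C], hS.small_zeta, h⟩

lemma pi_le_of_boot (hz : 0 ≤ z) (hz2 : d * z ≤ 1) (h : Boot d β z s (2 * bootConst d s C)) (m : ℕ) :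
    piAbs β z (fun _ : Fin d → ℤ => 1) m ≤
        laceB s (2 * bootConst d s C) β * dec s m ∧ piAbs β z (sqn : (Fin d → ℤ) → ℝ) m ≤
        m * (laceB s (2 * bootConst d s C) β * dec s m) :=
  h.piAbs_le hS.beta_nonneg hS.beta_le hz hz2 hS.one_lt (by linarith [le_bootConst d s C]) hS.small m

lemma improve (h : Good d β z s (2 * bootConst d s C)) (h0 : 0 ≤ 1 - 2 * d * z - piTotal d β z) :
    Boot d β z s (bootConst d s C) ∧ d * z ≤ 3 / 4 := by
  have hC := hS.small_C
  have hCp : 0 ≤ C * laceB s (2 * bootConst d s C) β :=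
    mul_nonneg (by linarith [hS.one_le]) h.laceB_nonneg
  have hzeta := h.laceB_mul_le
  have hzeta0 := mul_nonneg h.laceB_nonneg h.zetaSum_pos.le
  have hpc := pointConst_nonneg d s
  have hpc' : 0 ≤ C ^ 2 * pointConst d s := by positivity
  have h2s : (0 : ℝ) < 2 ^ (s + 1) := by positivity
  have hK : bootConst d s C = 8 + C ^ 2 * pointConst d s + 2 * 2 ^ (s + 1) := rfl
  have htot : ∀ n, z ^ n * cSum d β n (fun _ => 1) ≤ 2 := fun n =>
    (h.total_le hS.recBound hS.small_b0 h0 n).trans (by linarith)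
  refine ⟨⟨fun n => (htot n).trans (by linarith), fun n => ?_, fun n x => ?_⟩, ?_⟩
  · refine (h.moment_le hS.recBound hS.small_b0 h0 n).trans
      (mul_le_mul_of_nonneg_right ?_ (Nat.cast_nonneg n))
    have h1 : (1 + C * laceB s (2 * bootConst d s C) β) ^ 2 ≤ 4 := by nlinarith
    have h2 := mul_le_mul h1 (by linarith : 1 + 2 * (laceB s (2 * bootConst d s C) β * zetaSum s) ≤ 2)
      (by linarith) (by norm_num)
    linarith
  · have hdp := dec_pos s n
    rcases le_or_gt 2 n with hn | hn
    · refine (h.point_le hS.exponent hS.recBound (by linarith [hS.one_le]) hS.small_b0 h0 hn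
        x).trans (mul_le_mul_of_nonneg_right (by linarith) hdp.le)
    · have h1 : z ^ n * cSum d β n (fun y => if y = x then 1 else 0) ≤ 2 :=
        (mul_le_mul_of_nonneg_left (cSum_mono hS.beta_le fun y => by split_ifs <;> norm_num)
          (pow_nonneg h.z_pos.le n)).trans (htot n)
      have h2 : (1 : ℝ) ≤ 2 ^ (s + 1) * dec s n := by
        have := dec_le_mul (s := s) (c := 2) (m := 0) (n := n) (by linarith [h.one_lt]) two_pos (by
          have : (n : ℝ) + 1 ≤ 2 := by exact_mod_cast hn
          simpa using this)
        simpa [dec] using this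
      have h3 : 2 * 2 ^ (s + 1) ≤ bootConst d s C := by linarith
      have := mul_le_mul_of_nonneg_right h3 hdp.le
      linarith
  · linarith [h.two_mul_le h0]

lemma boot_zero : Boot d 0 (1 / (2 * d)) s (bootConst d s C) ∧ (d : ℝ) * (1 / (2 * d)) ≤ 3 / 4 := by
  have hd := hS.d_pos
  have e : 2 * (d : ℝ) * (1 / (2 * d)) = 1 := by field_simp
  have hg : Good d 0 (1 / (2 * d)) s (2 * bootConst d s C) := by
    refine hS.zero.good_of_pi_le e.ge fun m => ?_
    simp [piAbs_zero_beta, laceB]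
  refine hS.zero.improve hg ?_
  have h := hg.abs_tsum_le_of_abs_le (G := fun _ => 1) (by simp)
  have h' : |piTotal d 0 (1 / (2 * d))| ≤ 0 := h.trans (by simp [laceB])
  rw [abs_nonpos_iff] at h'
  rw [h', e]
  norm_num

lemma boot_base : Boot d β (1 / (2 * d)) s (bootConst d s C) := by
  have hd := hS.d_pos
  have hz : 0 ≤ 1 / (2 * (d : ℝ)) := by positivity
  have hm : ∀ n (G : (Fin d → ℤ) → ℝ), (∀ x, 0 ≤ G x) → (1 / (2 * (d : ℝ))) ^ n * cSum d β n G ≤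
      (1 / (2 * (d : ℝ))) ^ n * cSum d 0 n G := fun n G hG => by
    refine mul_le_mul_of_nonneg_left (walkSum_mono fun ω => mul_le_mul_of_nonneg_right ?_ (hG _))
      (pow_nonneg hz n)
    refine (wK_le_one hS.beta_nonneg hS.beta_le _ _ _).trans (le_of_eq ?_)
    simp [wK, wI]
  exact ⟨fun n => (hm n _ fun _ => zero_le_one).trans (hS.boot_zero.1.total n),
    fun n => (hm n _ sqn_nonneg).trans (hS.boot_zero.1.moment n),
    fun n x => (hm n _ fun y => by split_ifs <;> norm_num).trans (hS.boot_zero.1.point n x)⟩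

end SmallBeta

/-- Summing a scalar recursion. -/
lemma ScalarRec.tsum_mul_eq_one {θ : ℝ} {p f : ℕ → ℝ} (h : ScalarRec θ p f) (hp0 : p 0 = 0)
    (hp : Summable fun m => |p m|) (hf : Summable fun n => |f n|) :
    (∑' n, f n) * (1 - θ - ∑' m, p m) = 1 := by
  have h1 := tsum_mul_tsum_eq_tsum_sum_antidiagonal_of_summable_norm (f := p) (g := f)
    (by simpa using hp) (by simpa using hf)
  have h2 := (summable_norm_sum_mul_antidiagonal_of_summable_norm (f := p) (g := f)
    (by simpa using hp) (by simpa using hf)).of_norm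
  rw [h2.tsum_eq_zero_add] at h1
  have hf' := hf.of_abs
  have h3 := hf'.tsum_eq_zero_add
  have h4 : ∑' n, f (n + 1) = θ * ∑' n, f n + ∑' n, ∑ kl ∈ antidiagonal (n + 1), p kl.1 * f kl.2 := by
    rw [← tsum_mul_left, ← (hf'.mul_left θ).tsum_add ((summable_nat_add_iff 1).2 h2)]
    exact tsum_congr h.succ
  rw [h.zero] at h3
  simp [hp0] at h1
  linarith

end Wsaw

namespace Wsaw

open Filter Topology

variable {d : ℕ} {β z μ : ℝ}

lemma cZ_nonneg (hβ1 : β ≤ 1) (n : ℕ) : 0 ≤ cZ d β n := by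
  rw [cZ_eq_cSum]
  exact cSum_nonneg hβ1 fun _ => zero_le_one

lemma cZ_add_le (hβ : 0 ≤ β) (hβ1 : β ≤ 1) (m n : ℕ) :
    cZ d β (m + n) ≤ cZ d β m * cZ d β n := by
  rw [cZ_eq_cSum]
  refine (cSum_add_le hβ hβ1 rfl fun _ => zero_le_one).trans (le_of_eq ?_)
  rw [← cZ_eq_cSum, cSum_const, mul_comm]

lemma cZ_zero : cZ d β 0 = 1 := by rw [cZ_eq_cSum, cSum_zero]

lemma cZ_mul_le (hβ : 0 ≤ β) (hβ1 : β ≤ 1) (n k : ℕ) : cZ d β (n * k) ≤ cZ d β n ^ k := by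
  induction k with
  | zero => simp [cZ_zero]
  | succ k ih =>
    rw [Nat.mul_succ, pow_succ]
    exact (cZ_add_le hβ hβ1 _ _).trans (mul_le_mul_of_nonneg_right ih (cZ_nonneg hβ1 _))

lemma one_le_cZ (hd : 0 < d) (hβ1 : β ≤ 1) (n : ℕ) : 1 ≤ cZ d β n := by
  have hw : ∀ s : Fin n → Fin d × Bool, 0 ≤ wsawWeight β n s := fun s => by
    rw [wsawWeight_eq]
    exact wK_nonneg hβ1 _ _ _
  let s : Fin n → Fin d × Bool := fun _ => (⟨0, hd⟩, true)
  refine le_trans (le_of_eq ?_) (Finset.single_le_sum (fun s _ => hw s) (Finset.mem_univ s))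
  have hpos : ∀ k ≤ n, wsawPos s k ⟨0, hd⟩ = k := fun k hk => by
    have : (Finset.univ.filter fun j : Fin n => (j : ℕ) < k).card = k := by
      rw [Fin.card_filter_val_lt, min_eq_right hk]
    rw [wsawPos, Finset.sum_apply]
    simp [wsawStep, s, this]
  unfold wsawWeight
  refine (Finset.prod_eq_one fun p hp => ?_).symm
  simp only [Finset.mem_filter, Finset.mem_product, Finset.mem_range] at hp
  rw [if_neg fun h => ?_, mul_zero, add_zero]
  have h1 := congrFun h ⟨0, hd⟩
  rw [hpos _ (by omega), hpos _ (by omega)] at h1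
  omega

lemma pow_le_cZ (hβ : 0 ≤ β) (hβ1 : β ≤ 1) (hμ : HasGrowthConst d β μ) (n : ℕ) :
    μ ^ n ≤ cZ d β n := by
  rcases Nat.eq_zero_or_pos n with rfl | hn
  · simp [cZ_zero]
  have hn0 : (n : ℝ) ≠ 0 := by positivity
  have h0 : 0 ≤ μ := ge_of_tendsto' hμ fun m => Real.rpow_nonneg (cZ_nonneg hβ1 m) _
  have hsub : Tendsto (fun k : ℕ => n * k) atTop atTop :=
    tendsto_id.const_mul_atTop' hn
  have h1 : μ ≤ cZ d β n ^ ((n : ℝ)⁻¹) := by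
    refine le_of_tendsto (hμ.comp hsub) ((eventually_gt_atTop 0).mono fun k hk => ?_)
    have hk0 : (k : ℝ) ≠ 0 := by positivity
    have h2 := Real.rpow_le_rpow (cZ_nonneg hβ1 _) (cZ_mul_le (d := d) hβ hβ1 n k)
      (by positivity : (0 : ℝ) ≤ (((n * k : ℕ) : ℝ))⁻¹)
    refine h2.trans (le_of_eq ?_)
    rw [← Real.rpow_natCast, ← Real.rpow_mul (cZ_nonneg hβ1 n)]
    congr 1
    push_cast
    field_simp
  calc μ ^ n ≤ (cZ d β n ^ ((n : ℝ)⁻¹)) ^ n := pow_le_pow_left₀ h0 h1 n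
    _ = cZ d β n := by
      rw [← Real.rpow_natCast, ← Real.rpow_mul (cZ_nonneg hβ1 n), inv_mul_cancel₀ hn0,
        Real.rpow_one]

lemma one_le_growth (hd : 0 < d) (hβ1 : β ≤ 1) (hμ : HasGrowthConst d β μ) : 1 ≤ μ :=
  ge_of_tendsto' hμ fun n => Real.one_le_rpow (one_le_cZ hd hβ1 n) (by positivity)

lemma growth_le (hβ : 0 ≤ β) (hβ1 : β ≤ 1) (hμ : HasGrowthConst d β μ) : μ ≤ 2 * d := by
  have h := pow_le_cZ hβ hβ1 hμ 1
  rw [pow_one] at h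
  refine h.trans ((Finset.sum_le_card_nsmul _ _ 1 fun s _ => ?_).trans (le_of_eq ?_))
  · rw [wsawWeight_eq]
    exact wK_le_one hβ hβ1 _ _ _
  · simp [Finset.card_univ, mul_comm]

lemma eventually_cZ_le (hβ1 : β ≤ 1) (hμ : HasGrowthConst d β μ) (hz : 0 ≤ z)
    (hzμ : z * μ < 1) : ∃ ρ, 0 ≤ ρ ∧ ρ < 1 ∧ ∀ᶠ n : ℕ in atTop, z ^ n * cZ d β n ≤ ρ ^ n := by
  have h0 : 0 ≤ μ := ge_of_tendsto' hμ fun m => Real.rpow_nonneg (cZ_nonneg hβ1 m) _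
  obtain ⟨ρ, h1, h2⟩ := exists_between hzμ
  refine ⟨ρ, (mul_nonneg hz h0).trans h1.le, h2, ?_⟩
  filter_upwards [(hμ.const_mul z).eventually_lt_const h1, eventually_gt_atTop 0] with n hn hn0
  have hn0' : (n : ℝ) ≠ 0 := by positivity
  have h3 := pow_le_pow_left₀ (mul_nonneg hz (Real.rpow_nonneg (cZ_nonneg hβ1 n) _)) hn.le n
  rwa [mul_pow, ← Real.rpow_natCast (cZ d β n ^ _), ← Real.rpow_mul (cZ_nonneg hβ1 n),
    inv_mul_cancel₀ hn0', Real.rpow_one] at h3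

lemma summable_cZ (hβ1 : β ≤ 1) (hμ : HasGrowthConst d β μ) (hz : 0 ≤ z) (hzμ : z * μ < 1) :
    Summable fun n => z ^ n * cZ d β n := by
  obtain ⟨ρ, h0, h1, h2⟩ := eventually_cZ_le hβ1 hμ hz hzμ
  refine summable_of_isBigO_nat (summable_geometric_of_lt_one h0 h1) (Asymptotics.IsBigO.of_bound 1 ?_)
  filter_upwards [h2] with n hn
  rw [Real.norm_of_nonneg (mul_nonneg (pow_nonneg hz n) (cZ_nonneg hβ1 n)),
    Real.norm_of_nonneg (pow_nonneg h0 n), one_mul]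
  exact hn

lemma eventually_poly_mul_cZ_le (hβ1 : β ≤ 1) (hμ : HasGrowthConst d β μ) (hz : 0 ≤ z)
    (hzμ : z * μ < 1) (p : ℕ) {ε : ℝ} (hε : 0 < ε) :
    ∀ᶠ n : ℕ in atTop, (n : ℝ) ^ p * (z ^ n * cZ d β n) ≤ ε := by
  obtain ⟨ρ, h0, h1, h2⟩ := eventually_cZ_le hβ1 hμ hz hzμ
  have h3 := tendsto_pow_const_mul_const_pow_of_abs_lt_one p (by rwa [abs_of_nonneg h0] : |ρ| < 1)
  filter_upwards [h2, h3.eventually_le_const hε] with n hn hn'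
  exact (mul_le_mul_of_nonneg_left hn (by positivity)).trans hn'

lemma abs_wsawPos_le {n : ℕ} (s : Fin n → Fin d × Bool) (k : ℕ) (i : Fin d) :
    |(wsawPos s k i : ℝ)| ≤ n := by
  have h : |wsawPos s k i| ≤ n := by
    rw [wsawPos_eq_sum, Finset.sum_apply]
    refine (Finset.abs_sum_le_sum_abs _ _).trans ((Finset.sum_le_card_nsmul _ _ 1 fun j _ => ?_).trans
      (by simp))
    split_ifs
    · unfold wsawStep
      split_ifs <;> simp
    · simp
  exact_mod_cast h

lemma cSum_sqn_le (hβ1 : β ≤ 1) (n : ℕ) : cSum d β n sqn ≤ d * (n : ℝ) ^ 2 * cZ d β n := by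
  rw [← cSum_const]
  refine walkSum_mono fun s => mul_le_mul_of_nonneg_left ?_ (wK_nonneg hβ1 _ _ _)
  unfold sqn
  refine (Finset.sum_le_card_nsmul _ _ ((n : ℝ) ^ 2) fun i _ => ?_).trans (by simp)
  exact sq_le_sq' (abs_le.1 (abs_wsawPos_le s n i)).1 (abs_le.1 (abs_wsawPos_le s n i)).2

end Wsaw

namespace Wsaw

open Filter Topology

variable {d : ℕ} {β z s K C b0 μ : ℝ}

lemma eta_pos (hβ1 : β ≤ 1) (hμ : HasGrowthConst d β μ) (hz : 0 ≤ z) (hzμ : z * μ < 1)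
    (hp : Summable fun m => |z ^ m * piSum d β m fun _ => 1|) :
    0 < 1 - 2 * d * z - piTotal d β z := by
  have hn : ∀ n, 0 ≤ z ^ n * cSum d β n fun _ => 1 := fun n =>
    mul_nonneg (pow_nonneg hz n) (cSum_nonneg hβ1 fun _ => zero_le_one)
  have hf : Summable fun n => |z ^ n * cSum d β n fun _ => 1| := by
    simp only [abs_of_nonneg (hn _)]
    simpa only [cZ_eq_cSum] using summable_cZ hβ1 hμ hz hzμ
  have h := (scalarRec_total (d := d) (β := β) (z := z)).tsum_mul_eq_one (by simp [piSum]) hp hf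
  have h1 : 0 ≤ ∑' n, z ^ n * cSum d β n fun _ => 1 := tsum_nonneg hn
  change _ * (1 - 2 * d * z - piTotal d β z) = 1 at h
  by_contra! h2
  nlinarith

lemma isClosed_boot (d : ℕ) (β s K : ℝ) : IsClosed {z | Boot d β z s K} := by
  have e : {z | Boot d β z s K} =
      {z | (∀ n, z ^ n * cSum d β n (fun _ => 1) ≤ K) ∧ (∀ n, z ^ n * cSum d β n sqn ≤ K * n) ∧
        ∀ n x, z ^ n * cSum d β n (fun y => if y = x then 1 else 0) ≤ K * dec s n} :=
    Set.ext fun z => ⟨fun h => ⟨h.total, h.moment, h.point⟩, fun h => ⟨h.1, h.2.1, h.2.2⟩⟩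
  rw [e]
  simp only [Set.ofPred_and, Set.ofPred_forall]
  refine (isClosed_iInter fun n => ?_).inter ((isClosed_iInter fun n => ?_).inter
    (isClosed_iInter fun n => isClosed_iInter fun x => ?_))
  all_goals exact isClosed_le (by fun_prop) continuous_const

/-- A bootstrap bound extends a little, at the price of doubling the constant. -/
lemma Boot.eventually_double (h : Boot d β z s K) (hβ1 : β ≤ 1) (hs : 1 < s) (hK : 1 ≤ K)
    (hz : 0 < z) (hμ : HasGrowthConst d β μ) {z₁ : ℝ} (hz₁ : z < z₁) (hz₁μ : z₁ * μ < 1) :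
    ∀ᶠ z' in 𝓝[>] z, Boot d β z' s (2 * K) := by
  obtain ⟨p, hp⟩ := exists_nat_gt (s + 1)
  have hp2 : 2 ≤ p := by
    have : (1 : ℝ) < p := by linarith
    exact_mod_cast this
  obtain ⟨N, hN⟩ := eventually_atTop.1 (eventually_poly_mul_cZ_le hβ1 hμ (hz.trans hz₁).le hz₁μ p
    (by positivity : 0 < 1 / ((d + 1) * (2 : ℝ) ^ p)))
  have hsmall : ∀ᶠ z' in 𝓝[>] z, ∀ n ∈ Finset.range (N + 1), z' ^ n < 2 * z ^ n := by
    refine (Finset.eventually_all _).2 fun n _ => ?_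
    have hc : ContinuousAt (fun y : ℝ => y ^ n) z := by fun_prop
    exact (hc.eventually_lt_const (by linarith [pow_pos hz n])).filter_mono nhdsWithin_le_nhds
  filter_upwards [hsmall, Ioo_mem_nhdsGT hz₁] with z' h1 h2
  have hz' : 0 ≤ z' := hz.le.trans h2.1.le
  have hle : ∀ n < N + 1, ∀ G : (Fin d → ℤ) → ℝ, (∀ x, 0 ≤ G x) →
      z' ^ n * cSum d β n G ≤ 2 * (z ^ n * cSum d β n G) := fun n hn G hG => by
    have := mul_le_mul_of_nonneg_right (h1 n (Finset.mem_range.2 hn)).le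
      (cSum_nonneg (n := n) hβ1 hG)
    linarith
  have hbig : ∀ n, N + 1 ≤ n → ((n : ℝ) + 1) ^ p * ((d + 1) * (z' ^ n * cZ d β n)) ≤ 1 := by
    intro n hn
    have hn1 : (1 : ℝ) ≤ n := by exact_mod_cast (by omega : 1 ≤ n)
    have h3 := hN n (by omega)
    have h4 : ((n : ℝ) + 1) ^ p ≤ 2 ^ p * (n : ℝ) ^ p := by
      rw [← mul_pow]
      exact pow_le_pow_left₀ (by positivity) (by linarith) p
    have h5 := cZ_nonneg (d := d) hβ1 n
    have h6 : z' ^ n ≤ z₁ ^ n := pow_le_pow_left₀ hz' h2.2.le n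
    rw [le_div_iff₀ (by positivity)] at h3
    calc _ ≤ (2 ^ p * (n : ℝ) ^ p) * ((d + 1) * (z₁ ^ n * cZ d β n)) := by gcongr
      _ ≤ 1 := by linarith
  have hdz : ∀ n, 0 ≤ z' ^ n * cZ d β n := fun n => mul_nonneg (pow_nonneg hz' n) (cZ_nonneg hβ1 n)
  have hd0 : (0 : ℝ) ≤ d := Nat.cast_nonneg d
  have hbig1 : ∀ n, N + 1 ≤ n → ((n : ℝ) + 1) ^ p * (z' ^ n * cZ d β n) ≤ 1 := fun n hn => by
    have h3 := hbig n hn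
    have : 0 ≤ ((n : ℝ) + 1) ^ p * (d * (z' ^ n * cZ d β n)) := by have := hdz n; positivity
    linarith
  have hone : ∀ n : ℕ, (1 : ℝ) ≤ ((n : ℝ) + 1) ^ p := fun n =>
    one_le_pow₀ (by linarith [Nat.cast_nonneg (α := ℝ) n])
  refine ⟨fun n => ?_, fun n => ?_, fun n x => ?_⟩
  · rcases lt_or_ge n (N + 1) with hn | hn
    · exact (hle n hn _ fun _ => zero_le_one).trans (by linarith [h.total n])
    · rw [← cZ_eq_cSum]
      nlinarith [hbig1 n hn, hone n, hdz n]
  · rcases lt_or_ge n (N + 1) with hn | hn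
    · exact (hle n hn _ sqn_nonneg).trans (by linarith [h.moment n])
    · have h3 := mul_le_mul_of_nonneg_left (cSum_sqn_le (d := d) hβ1 n) (pow_nonneg hz' n)
      have hn1 : (1 : ℝ) ≤ n := by exact_mod_cast (by omega : 1 ≤ n)
      have h4 : (n : ℝ) ^ 2 ≤ ((n : ℝ) + 1) ^ p :=
        (pow_le_pow_left₀ (by positivity) (by linarith) 2).trans
          (pow_le_pow_right₀ (by linarith) hp2)
      have h5 := hbig n hn
      have h6 : (n : ℝ) ^ 2 * ((d + 1) * (z' ^ n * cZ d β n)) ≤ 1 :=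
        (mul_le_mul_of_nonneg_right h4 (by have := hdz n; positivity)).trans h5
      have h7 : 0 ≤ (n : ℝ) ^ 2 * (z' ^ n * cZ d β n) := by have := hdz n; positivity
      nlinarith
  · rcases lt_or_ge n (N + 1) with hn | hn
    · exact (hle n hn _ fun y => by split_ifs <;> norm_num).trans (by linarith [h.point n x])
    · have h3 : z' ^ n * cSum d β n (fun y => if y = x then 1 else 0) ≤ z' ^ n * cZ d β n := by
        rw [cZ_eq_cSum]
        exact mul_le_mul_of_nonneg_left (cSum_mono hβ1 fun y => by split_ifs <;> norm_num)
          (pow_nonneg hz' n)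
      have hn0 : (0 : ℝ) < (n : ℝ) + 1 := by positivity
      have h4 : z' ^ n * cZ d β n ≤ dec s n := by
        unfold dec
        rw [Real.rpow_neg hn0.le, ← one_div, le_div_iff₀ (by positivity), mul_comm]
        refine le_trans (mul_le_mul_of_nonneg_right ?_ (hdz n)) (hbig1 n hn)
        rw [← Real.rpow_natCast]
        exact Real.rpow_le_rpow_of_exponent_le (by linarith [Nat.cast_nonneg (α := ℝ) n]) hp.le
      have := dec_pos s n
      nlinarith

namespace SmallBeta

variable (hS : SmallBeta d s C b0 β) (hμ : HasGrowthConst d β μ)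
include hS hμ

lemma improve_of_lt (hz : 1 ≤ 2 * d * z) (hz2 : d * z ≤ 1) (hzμ : z * μ < 1)
    (h : Boot d β z s (2 * bootConst d s C)) :
    Boot d β z s (bootConst d s C) ∧ d * z ≤ 3 / 4 := by
  have hd := hS.d_pos
  have hz0 : 0 ≤ z := by
    by_contra! h0
    nlinarith
  have hg := hS.good_of_pi_le hz (hS.pi_le_of_boot hz0 hz2 h)
  refine hS.improve hg (eta_pos hS.beta_le hμ hz0 hzμ ?_).le
  exact ((hg.smallCoeff_of_abs_le (G := fun _ => 1) (by simp)).summable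
    (by linarith [hS.one_lt])).abs

lemma boot_of_lt {z₁ : ℝ} (hz₁ : 1 ≤ 2 * d * z₁) (hzμ : z₁ * μ < 1) :
    Boot d β z₁ s (bootConst d s C) ∧ d * z₁ ≤ 3 / 4 := by
  have hd := hS.d_pos
  have hd' : 0 < d := by exact_mod_cast hd
  have hz01 : 1 / (2 * d) ≤ z₁ := by
    rw [div_le_iff₀ (by positivity)]
    linarith
  have hμ0 : 0 < μ := one_pos.trans_le (one_le_growth hd' hS.beta_le hμ)
  have hK := le_bootConst d s C
  have hcl : IsClosed {z | Boot d β z s (bootConst d s C) ∧ d * z ≤ 3 / 4} :=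
    (isClosed_boot d β s _).inter (isClosed_le (continuous_const.mul continuous_id) continuous_const)
  refine (hcl.inter isClosed_Icc).Icc_subset_of_forall_exists_gt ⟨hS.boot_base, hS.boot_zero.2⟩
    (fun x hx y hy => ?_) (Set.right_mem_Icc.2 hz01)
  have hx0 : 0 < x := lt_of_lt_of_le (by positivity) hx.2.1
  have h1 : ∀ᶠ z' : ℝ in 𝓝[>] x, d * z' < 1 := by
    have hc : ContinuousAt (fun y : ℝ => d * y) x := by fun_prop
    have h2 : (d : ℝ) * x < 1 := hx.1.2.trans_lt (by norm_num)
    exact (hc.eventually_lt_const h2).filter_mono nhdsWithin_le_nhds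
  have h4 : ∀ᶠ z' in 𝓝[>] x, z' ∈ Set.Ioo x z₁ := Ioo_mem_nhdsGT hx.2.2
  have h5 : ∀ᶠ z' in 𝓝[>] x, z' ∈ Set.Ioo x y := Ioo_mem_nhdsGT hy
  obtain ⟨z', ⟨h2, h3⟩, h4, h5⟩ := (((hx.1.1.eventually_double hS.beta_le hS.one_lt (by linarith) hx0
    hμ hx.2.2 hzμ).and h1).and (h4.and h5)).exists
  refine ⟨z', hS.improve_of_lt hμ ?_ h3.le ?_ h2, h5.1, h5.2.le⟩
  · have := hx.2.1.trans h4.1.le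
    rw [div_le_iff₀ (by positivity)] at this
    linarith
  · exact (mul_lt_mul_of_pos_right h4.2 hμ0).trans hzμ

end SmallBeta

end Wsaw

namespace Wsaw

open Filter Topology

variable {d : ℕ} {β z s C b0 μ : ℝ}

namespace SmallBeta

variable (hS : SmallBeta d s C b0 β) (hμ : HasGrowthConst d β μ) (hz : z * μ = 1)
include hS hμ hz

lemma critical_one_le : 1 ≤ 2 * d * z := by
  have hd := hS.d_pos
  have hμ0 : 1 ≤ μ := one_le_growth (by exact_mod_cast hd) hS.beta_le hμ
  have h := growth_le hS.beta_nonneg hS.beta_le hμ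
  have hz0 : 0 ≤ z := by
    by_contra! h0
    nlinarith
  have := mul_le_mul_of_nonneg_left h hz0
  linarith

lemma boot_critical : Boot d β z s (bootConst d s C) ∧ d * z ≤ 3 / 4 := by
  have hd := hS.d_pos
  have hμ0 : 0 < μ := one_pos.trans_le (one_le_growth (by exact_mod_cast hd) hS.beta_le hμ)
  have hz1 := hS.critical_one_le hμ hz
  have hz01 : 1 / (2 * d) ≤ z := by
    rw [div_le_iff₀ (by positivity)]
    linarith
  rcases hz01.eq_or_lt with h | h
  · subst h
    exact ⟨hS.boot_base, hS.boot_zero.2⟩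
  have hcl : IsClosed {z | Boot d β z s (bootConst d s C) ∧ d * z ≤ 3 / 4} :=
    (isClosed_boot d β s _).inter (isClosed_le (continuous_const.mul continuous_id) continuous_const)
  have hsub : Set.Ico (1 / (2 * (d : ℝ))) z ⊆
      {z | Boot d β z s (bootConst d s C) ∧ d * z ≤ 3 / 4} := fun y hy => by
    refine hS.boot_of_lt hμ ?_ ?_
    · have := hy.1
      rw [div_le_iff₀ (by positivity)] at this
      linarith
    · rw [← hz]
      exact mul_lt_mul_of_pos_right hy.2 hμ0
  refine hcl.closure_subset_iff.2 hsub ?_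
  rw [closure_Ico h.ne]
  exact Set.right_mem_Icc.2 h.le

lemma good_critical : Good d β z s (2 * bootConst d s C) := by
  have hd := hS.d_pos
  have hz1 := hS.critical_one_le hμ hz
  have h := hS.boot_critical hμ hz
  have hz0 : 0 ≤ z := by
    by_contra! h0
    nlinarith
  have hK := le_bootConst d s C
  refine hS.good_of_pi_le hz1 (hS.pi_le_of_boot hz0 (by linarith [h.2]) ?_)
  have hle : bootConst d s C ≤ 2 * bootConst d s C := by linarith
  exact ⟨fun n => (h.1.total n).trans hle,
    fun n => (h.1.moment n).trans (mul_le_mul_of_nonneg_right hle (Nat.cast_nonneg n)),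
    fun n x => (h.1.point n x).trans (mul_le_mul_of_nonneg_right hle (dec_pos s n).le)⟩

lemma eta_critical_nonneg : 0 ≤ 1 - 2 * d * z - piTotal d β z := by
  have hg := hS.good_critical hμ hz
  have hz0 := hg.z_pos
  have hμ0 : 0 < μ := by
    by_contra! h
    nlinarith
  have hsum := (hg.smallCoeff_of_abs_le (G := fun _ => 1) (by simp)).summable
    (by linarith [hS.one_lt])
  have hle : ∀ m, ∀ x ∈ Set.Icc 0 z, ‖x ^ m * piSum d β m fun _ => 1‖ ≤
      |z ^ m * piSum d β m fun _ => 1| := fun m x hx => by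
    rw [Real.norm_eq_abs, abs_mul, abs_mul, abs_of_nonneg (pow_nonneg hx.1 m),
      abs_of_nonneg (pow_nonneg hz0.le m)]
    exact mul_le_mul_of_nonneg_right (pow_le_pow_left₀ hx.1 hx.2 m) (abs_nonneg _)
  have hc : ContinuousOn (piTotal d β) (Set.Icc 0 z) :=
    continuousOn_tsum (fun m => by fun_prop) hsum.abs hle
  have hc' : ContinuousOn (fun x => 1 - 2 * d * x - piTotal d β x) (Set.Icc 0 z) :=
    (by fun_prop : ContinuousOn (fun x : ℝ => 1 - 2 * d * x) (Set.Icc 0 z)).sub hc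
  have ht := (hc' z (Set.right_mem_Icc.2 hz0.le)).mono Set.Ioo_subset_Icc_self
  rw [ContinuousWithinAt, nhdsWithin_Ioo_eq_nhdsLT hz0] at ht
  refine ge_of_tendsto ht (mem_of_superset (Ioo_mem_nhdsLT hz0) fun x hx => ?_)
  refine (eta_pos hS.beta_le hμ hx.1.le ?_ ?_).le
  · rw [← hz]
    exact mul_lt_mul_of_pos_right hx.2 hμ0
  · exact Summable.of_nonneg_of_le (fun _ => abs_nonneg _)
      (fun m => hle m x ⟨hx.1.le, hx.2.le⟩) hsum.abs

lemma one_le_critical (n : ℕ) : 1 ≤ z ^ n * cSum d β n fun _ => 1 := by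
  have hz0 := (hS.good_critical hμ hz).z_pos
  rw [← cZ_eq_cSum]
  calc (1 : ℝ) = z ^ n * μ ^ n := by rw [← mul_pow, hz, one_pow]
    _ ≤ _ := mul_le_mul_of_nonneg_left (pow_le_cZ hS.beta_nonneg hS.beta_le hμ n)
      (pow_nonneg hz0.le n)

lemma recBound_critical (n : ℕ) :
    (z ^ n * cSum d β n fun _ => 1) ≤ 1 + C * laceB s (2 * bootConst d s C) β ∧
    (z ^ n * cSum d β n fun _ => 1) ≤ C * (1 + (1 - 2 * d * z - piTotal d β z) * n) ^ (-s) ∧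
    |(z ^ (n + 1) * cSum d β (n + 1) fun _ => 1) -
        (2 * d * z + piTotal d β z) * (z ^ n * cSum d β n fun _ => 1)| ≤
      C * laceB s (2 * bootConst d s C) β * psi s (1 - 2 * d * z - piTotal d β z) (n + 1) := by
  have hg := hS.good_critical hμ hz
  have h1 : 1 - 2 * d * z - piTotal d β z ≤ 3 / 2 := by
    have := (abs_le.1 (hg.abs_tsum_le_of_abs_le (G := fun _ => 1) (by simp))).1
    change _ ≤ piTotal d β z at this
    linarith [hg.laceB_mul_le, hg.one_le]
  have h := hS.recBound _ _ _ _ hg.laceB_nonneg hS.small_b0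
    (hg.smallCoeff_of_abs_le (G := fun _ => 1) (by simp)) scalarRec_total
    (hS.eta_critical_nonneg hμ hz) h1 n
  exact ⟨(le_abs_self _).trans h.1, (le_abs_self _).trans h.2.1, h.2.2⟩

lemma eta_critical : 1 - 2 * d * z - piTotal d β z = 0 := by
  rcases (hS.eta_critical_nonneg hμ hz).eq_or_lt with h | h
  · exact h.symm
  exfalso
  have ht : Tendsto (fun n : ℕ => C * (1 + (1 - 2 * d * z - piTotal d β z) * n) ^ (-s)) atTop
      (𝓝 (C * 0)) :=
    ((tendsto_rpow_neg_atTop (by linarith [hS.one_lt])).comp (tendsto_atTop_add_const_left _ _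
      (tendsto_natCast_atTop_atTop.const_mul_atTop h))).const_mul C
  rw [mul_zero] at ht
  have := ge_of_tendsto' ht fun n =>
    (hS.one_le_critical hμ hz n).trans (hS.recBound_critical hμ hz n).2.1
  norm_num at this

lemma exists_amplitude : ∃ A : ℝ, 1 ≤ A ∧
    Tendsto (fun n => z ^ n * cSum d β n fun _ => 1) atTop (𝓝 A) ∧
    ∀ n : ℕ, |(z ^ n * cSum d β n fun _ => 1) - A| ≤
      C * laceB s (2 * bootConst d s C) β * teleConst s * ((n : ℝ) + 1) ^ (1 - s) := by
  have hg := hS.good_critical hμ hz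
  have hCb : 0 ≤ C * laceB s (2 * bootConst d s C) β :=
    mul_nonneg (by linarith [hS.one_le]) hg.laceB_nonneg
  have hs := hS.one_lt
  set f : ℕ → ℝ := fun n => z ^ n * cSum d β n fun _ => 1 with hf
  have hstep : ∀ n, dist (f n) (f n.succ) ≤
      C * laceB s (2 * bootConst d s C) β * ((n : ℝ) + 1) ^ (-s) := fun n => by
    have h := (hS.recBound_critical hμ hz n).2.2
    have h0 := hS.eta_critical hμ hz
    rw [h0, show 2 * d * z + piTotal d β z = 1 by linarith, one_mul] at h
    rw [dist_comm, Real.dist_eq]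
    refine h.trans (mul_le_mul_of_nonneg_left ?_ hCb)
    simp only [psi, zero_mul, add_zero]
    exact Real.rpow_le_rpow_of_nonpos (by positivity) (by push_cast; linarith) (by linarith)
  have hsum := (summable_rpow_neg hs).mul_left (C * laceB s (2 * bootConst d s C) β)
  obtain ⟨A, hA⟩ := cauchySeq_tendsto_of_complete (cauchySeq_of_dist_le_of_summable _ hstep hsum)
  refine ⟨A, ge_of_tendsto' hA (hS.one_le_critical hμ hz), hA, fun n => ?_⟩
  have h := dist_le_tsum_of_dist_le_of_tendsto _ hstep hsum hA n
  rw [Real.dist_eq, tsum_mul_left] at h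
  refine h.trans ?_
  rw [mul_assoc (C * _)]
  refine mul_le_mul_of_nonneg_left ?_ hCb
  have := tsum_rpow_tail_le (s := s - 1) (by linarith) n
  simpa [add_comm] using this

end SmallBeta

end Wsaw

namespace Wsaw

/-- Moments which are nearly submultiplicative, with diffusive second moment. -/
structure MomentFamily (K : ℝ) (M : ℕ → ℕ → ℝ) : Prop where
  nonneg : ∀ p n, 0 ≤ M p n
  zero_le : ∀ n, M 0 n ≤ 11 / 10
  one_le : ∀ n : ℕ, M 1 n ≤ K * √n
  two_le : ∀ n : ℕ, M 2 n ≤ K * n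
  time_zero : ∀ p, M (p + 1) 0 = 0
  time_one : ∀ p, M p 1 ≤ 2
  conv : ∀ p a b, M p (a + b) ≤ ∑ j ∈ Finset.range (p + 1), p.choose j * (M j a * M (p - j) b)

lemma sqrt_pow_add_le {a b n : ℕ} (q : ℕ) (h : a + b = n) (ha : 3 * a ≤ 2 * n) (hb : 3 * b ≤ 2 * n) :
    √a ^ (q + 3) + √b ^ (q + 3) ≤ 9 / 11 * √n ^ (q + 3) := by
  have key : ∀ c : ℕ, 3 * c ≤ 2 * n → √c ^ (q + 3) ≤ c * (9 / 11 * √n ^ (q + 1)) := fun c hc => by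
    have hc' : (3 : ℝ) * c ≤ 2 * n := by exact_mod_cast hc
    have h1 : √(c : ℝ) ≤ 9 / 11 * √n := by
      rw [Real.sqrt_le_left (by positivity), mul_pow, Real.sq_sqrt (Nat.cast_nonneg n)]
      linarith [Nat.cast_nonneg (α := ℝ) n]
    have h2 : √(c : ℝ) ≤ √n := h1.trans (by linarith [Real.sqrt_nonneg (n : ℝ)])
    calc √(c : ℝ) ^ (q + 3) = √(c : ℝ) ^ 2 * (√c * √c ^ q) := by ring
      _ ≤ c * ((9 / 11 * √n) * √n ^ q) := by
        rw [Real.sq_sqrt (Nat.cast_nonneg c)]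
        gcongr
      _ = _ := by ring
  have hn : (a : ℝ) + b = n := by exact_mod_cast h
  calc _ ≤ a * (9 / 11 * √n ^ (q + 1)) + b * (9 / 11 * √n ^ (q + 1)) := add_le_add (key a ha) (key b hb)
    _ = 9 / 11 * (√n ^ 2 * √n ^ (q + 1)) := by rw [Real.sq_sqrt (Nat.cast_nonneg n), ← hn]; ring
    _ = _ := by ring

/-- All moments of a moment family are diffusive, uniformly in the family. -/
theorem MomentFamily.exists_bound (K : ℝ) (p : ℕ) :
    ∃ B : ℝ, 0 ≤ B ∧ ∀ M, MomentFamily K M → ∀ n : ℕ, M p n ≤ B * √n ^ p := by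
  induction p using Nat.strong_induction_on with
  | _ p ih =>
  match p with
  | 0 => exact ⟨11 / 10, by norm_num, fun M hM n => by simpa using hM.zero_le n⟩
  | 1 => exact ⟨max K 0, le_max_right _ _, fun M hM n => (hM.one_le n).trans (by
      rw [pow_one]
      exact mul_le_mul_of_nonneg_right (le_max_left _ _) (Real.sqrt_nonneg _))⟩
  | 2 => exact ⟨max K 0, le_max_right _ _, fun M hM n => (hM.two_le n).trans (by
      rw [Real.sq_sqrt (Nat.cast_nonneg n)]
      exact mul_le_mul_of_nonneg_right (le_max_left _ _) (Nat.cast_nonneg n))⟩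
  | q + 3 =>
    choose! B hB0 hB using ih
    set D := ∑ j ∈ Finset.range (q + 2), ((q + 3).choose (j + 1) : ℝ) * (B (j + 1) * B (q + 2 - j))
      with hD
    have hD0 : 0 ≤ D := Finset.sum_nonneg fun j hj => by
      have := Finset.mem_range.1 hj
      exact mul_nonneg (Nat.cast_nonneg _)
        (mul_nonneg (hB0 _ (by omega)) (hB0 _ (by omega)))
    refine ⟨10 * D + 2, by positivity, fun M hM n => ?_⟩
    induction n using Nat.strong_induction_on with
    | _ n ihn =>
    rcases (by omega : n = 0 ∨ n = 1 ∨ 2 ≤ n) with rfl | rfl | hn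
    · rw [hM.time_zero]
      positivity
    · refine (hM.time_one _).trans ?_
      simp
      linarith
    obtain ⟨a, b, hab, ha, hb⟩ : ∃ a b, a + b = n ∧ 3 * a ≤ 2 * n ∧ 3 * b ≤ 2 * n :=
      ⟨n / 2, n - n / 2, by omega, by omega, by omega⟩
    have hconv := hM.conv (q + 3) a b
    rw [hab, Finset.sum_range_succ, Finset.sum_range_succ'] at hconv
    have hmid : ∑ j ∈ Finset.range (q + 2), ((q + 3).choose (j + 1) : ℝ) *
        (M (j + 1) a * M (q + 3 - (j + 1)) b) ≤ D * √n ^ (q + 3) := by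
      rw [hD, Finset.sum_mul]
      refine Finset.sum_le_sum fun j hj => ?_
      have hj := Finset.mem_range.1 hj
      rw [mul_assoc, show q + 3 - (j + 1) = q + 2 - j by omega]
      refine mul_le_mul_of_nonneg_left ?_ (Nat.cast_nonneg _)
      have hsa : √(a : ℝ) ≤ √n := Real.sqrt_le_sqrt (by exact_mod_cast (by omega : a ≤ n))
      have hsb : √(b : ℝ) ≤ √n := Real.sqrt_le_sqrt (by exact_mod_cast (by omega : b ≤ n))
      have h1 := hB0 (j + 1) (by omega)
      have h2 := hB0 (q + 2 - j) (by omega)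
      calc _ ≤ (B (j + 1) * √a ^ (j + 1)) * (B (q + 2 - j) * √b ^ (q + 2 - j)) :=
            mul_le_mul (hB _ (by omega) M hM a) (hB _ (by omega) M hM b) (hM.nonneg _ _)
              (by positivity)
        _ ≤ (B (j + 1) * √n ^ (j + 1)) * (B (q + 2 - j) * √n ^ (q + 2 - j)) := by gcongr
        _ = _ := by
          rw [mul_mul_mul_comm, ← pow_add, show j + 1 + (q + 2 - j) = q + 3 by omega]
    have hea : M (q + 3) a * M 0 b ≤ (11 / 10) * ((10 * D + 2) * √a ^ (q + 3)) := by
      rw [mul_comm]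
      exact mul_le_mul (hM.zero_le b) (ihn a (by omega)) (hM.nonneg _ _) (by norm_num)
    have heb : M 0 a * M (q + 3) b ≤ (11 / 10) * ((10 * D + 2) * √b ^ (q + 3)) :=
      mul_le_mul (hM.zero_le a) (ihn b (by omega)) (hM.nonneg _ _) (by norm_num)
    have hs := mul_le_mul_of_nonneg_left (sqrt_pow_add_le q hab ha hb)
      (by positivity : 0 ≤ 11 / 10 * (10 * D + 2))
    have hpos : 0 ≤ √(n : ℝ) ^ (q + 3) := by positivity
    simp only [Nat.choose_zero_right, Nat.choose_self, Nat.cast_one, one_mul, Nat.sub_self,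
      Nat.sub_zero] at hconv
    linarith

end Wsaw

namespace Wsaw

variable {d r : ℕ} {β : ℝ}

/-- The indicator of the nonzero points of `ℤ ^ d` which vanish on the torus. -/
noncomputable def wrap (r : ℕ) (x : Fin d → ℤ) : ℝ := if x ≠ 0 ∧ ∀ i, (r : ℤ) ∣ x i then 1 else 0

lemma wrap_nonneg (x : Fin d → ℤ) : 0 ≤ wrap r x := by
  unfold wrap
  split_ifs <;> norm_num

/-- The projection to the torus. -/
def proj (r : ℕ) (x : Fin d → ℤ) : Fin d → ZMod r := fun i => (x i : ZMod r)

lemma proj_eq_iff (x y : Fin d → ℤ) : proj r x = proj r y ↔ ∀ i, (r : ℤ) ∣ (y - x) i := by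
  rw [funext_iff]
  exact forall_congr' fun i => ZMod.intCast_eq_intCast_iff_dvd_sub _ _ _

lemma wI_proj (ω : ℕ → Fin d → ℤ) (a b : ℕ) :
    wI β (fun k => proj r (ω k)) a b = wI β ω a b * (1 - β * wrap r (ω b - ω a)) := by
  unfold wI wrap
  simp only [proj_eq_iff, sub_ne_zero]
  by_cases h : ω a = ω b
  · simp [h]
  · simp [h, Ne.symm h]

lemma wK_proj (ω : ℕ → Fin d → ℤ) (n : ℕ) :
    wK β (fun k => proj r (ω k)) 0 n = wK β ω 0 n *
      ∏ b ∈ Finset.Ioc 0 n, ∏ a ∈ Finset.Ico 0 b, (1 - β * wrap r (ω b - ω a)) := by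
  unfold wK
  rw [← Finset.prod_mul_distrib]
  refine Finset.prod_congr rfl fun b _ => ?_
  rw [← Finset.prod_mul_distrib]
  exact Finset.prod_congr rfl fun a _ => wI_proj ω a b

lemma wrap_le_one (x : Fin d → ℤ) : wrap r x ≤ 1 := by
  unfold wrap
  split_ifs <;> norm_num

lemma wK_proj_le (hβ : 0 ≤ β) (hβ1 : β ≤ 1) (ω : ℕ → Fin d → ℤ) (n : ℕ) :
    wK β (fun k => proj r (ω k)) 0 n ≤ wK β ω 0 n := by
  have h : ∀ x : Fin d → ℤ, 0 ≤ 1 - β * wrap r x := fun x => by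
    nlinarith [wrap_nonneg (r := r) x, wrap_le_one (r := r) x]
  have h' : ∀ x : Fin d → ℤ, 1 - β * wrap r x ≤ 1 := fun x => by
    nlinarith [wrap_nonneg (r := r) x]
  rw [wK_proj]
  exact mul_le_of_le_one_right (wK_nonneg hβ1 _ _ _)
    (Finset.prod_le_one (fun _ _ => Finset.prod_nonneg fun _ _ => h _) fun _ _ =>
      Finset.prod_le_one (fun _ _ => h _) fun _ _ => h' _)

lemma wK_sub_proj_le (hβ : 0 ≤ β) (hβ1 : β ≤ 1) (ω : ℕ → Fin d → ℤ) (n : ℕ) :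
    wK β ω 0 n - wK β (fun k => proj r (ω k)) 0 n ≤
      β * ∑ b ∈ Finset.Ioc 0 n, ∑ a ∈ Finset.Ico 0 b, wK β ω 0 n * wrap r (ω b - ω a) := by
  rw [wK_proj, Finset.prod_sigma', Finset.sum_sigma', ← Finset.mul_sum]
  have h := one_sub_prod_le ((Finset.Ioc 0 n).sigma fun b => Finset.Ico 0 b)
    (fun x => 1 - β * wrap r (ω x.1 - ω x.2))
    (fun x _ => by nlinarith [wrap_nonneg (r := r) (ω x.1 - ω x.2), wrap_le_one (r := r) (ω x.1 - ω x.2)])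
    (fun x _ => by nlinarith [wrap_nonneg (r := r) (ω x.1 - ω x.2)])
  simp only [sub_sub_cancel] at h
  rw [← Finset.mul_sum] at h
  have := mul_le_mul_of_nonneg_left h (wK_nonneg hβ1 ω 0 n)
  linarith

lemma walkSum_increment_le (hβ : 0 ≤ β) (hβ1 : β ≤ 1) {G : (Fin d → ℤ) → ℝ} (hG : ∀ x, 0 ≤ G x)
    {a b n : ℕ} (hab : a ≤ b) (hbn : b ≤ n) :
    walkSum d n (fun ω => wK β ω 0 n * G (ω b - ω a)) ≤
      cZ d β a * cSum d β (b - a) G * cZ d β (n - b) := by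
  have h1 : walkSum d n (fun ω => wK β ω 0 n * G (ω b - ω a)) ≤
      walkSum d b (fun ω => wK β ω 0 b * G (ω b - ω a)) * cZ d β (n - b) := by
    rw [walkSum_add (Nat.add_sub_cancel' hbn), ← walkSum_mul_right]
    refine walkSum_mono fun s => ?_
    rw [cZ_eq_cSum, cSum, ← walkSum_mul_left]
    refine walkSum_mono fun t => ?_
    rw [cat_of_le le_rfl, cat_of_le hab, mul_one, mul_right_comm]
    refine mul_le_mul_of_nonneg_right ((wK_le_mul hβ hβ1 _ (Nat.zero_le b) hbn).trans (le_of_eq ?_))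
      (hG _)
    rw [wK_cat_left le_rfl, wK_cat_right (Nat.sub_add_cancel hbn) _ (wsawPos_zero t)]
  have h2 : walkSum d b (fun ω => wK β ω 0 b * G (ω b - ω a)) ≤
      cZ d β a * cSum d β (b - a) G := by
    rw [walkSum_add (Nat.add_sub_cancel' hab), cZ_eq_cSum, cSum, ← walkSum_mul_right]
    refine walkSum_mono fun s => ?_
    rw [cSum, ← walkSum_mul_left]
    refine walkSum_mono fun t => ?_
    have e := cat_add (wsawPos s) (wsawPos_zero t) (m := a) (b - a)
    rw [Nat.sub_add_cancel hab] at e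
    rw [e, cat_of_le le_rfl, add_sub_cancel_left, mul_one, ← mul_assoc]
    refine mul_le_mul_of_nonneg_right ((wK_le_mul hβ hβ1 _ (Nat.zero_le a) hab).trans (le_of_eq ?_))
      (hG _)
    rw [wK_cat_left le_rfl, wK_cat_right (Nat.sub_add_cancel hab) _ (wsawPos_zero t)]
  exact h1.trans (mul_le_mul_of_nonneg_right h2 (cZ_nonneg hβ1 _))

lemma cT_eq (r n : ℕ) : cT d r β n = walkSum d n fun ω => wK β (fun k => proj r (ω k)) 0 n :=
  Finset.sum_congr rfl fun s _ => prod_pairs_eq_wK β (wsawPosT r s) n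

lemma cT_le (hβ : 0 ≤ β) (hβ1 : β ≤ 1) (n : ℕ) : cT d r β n ≤ cZ d β n := by
  rw [cT_eq, cZ_eq_cSum]
  exact walkSum_mono fun s => by simpa using wK_proj_le hβ hβ1 _ n

lemma cZ_sub_cT_le (hβ : 0 ≤ β) (hβ1 : β ≤ 1) (n : ℕ) :
    cZ d β n - cT d r β n ≤ β * ∑ b ∈ Finset.Ioc 0 n, ∑ a ∈ Finset.Ico 0 b,
      cZ d β a * cSum d β (b - a) (wrap r) * cZ d β (n - b) := by
  have e : cZ d β n - cT d r β n =
      walkSum d n fun ω => wK β ω 0 n - wK β (fun k => proj r (ω k)) 0 n := by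
    rw [cT_eq, cZ_eq_cSum]
    simp [cSum, walkSum]
  rw [e]
  refine (walkSum_mono (G := fun ω => β * ∑ b ∈ Finset.Ioc 0 n, ∑ a ∈ Finset.Ico 0 b,
    wK β ω 0 n * wrap r (ω b - ω a)) fun s => wK_sub_proj_le hβ hβ1 _ n).trans ?_
  rw [walkSum_mul_left, walkSum_finset_sum]
  refine mul_le_mul_of_nonneg_left (Finset.sum_le_sum fun b hb => ?_) hβ
  rw [walkSum_finset_sum]
  exact Finset.sum_le_sum fun a ha => walkSum_increment_le hβ hβ1 wrap_nonneg
    (Finset.mem_Ico.1 ha).2.le (Finset.mem_Ioc.1 hb).2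

end Wsaw

namespace Wsaw

variable {d r : ℕ} {β z s C b0 μ K : ℝ}

lemma exists_wrap_cover (d : ℕ) (hr : 0 < r) {R : ℝ} (hR : 0 ≤ R) :
    ∃ S : Finset (Fin d → ℤ), (∀ x, x ≠ 0 → (∀ i, (r : ℤ) ∣ x i) → ‖x‖ ≤ R → x ∈ S) ∧
      (S.card : ℝ) ≤ (3 * R / r) ^ d := by
  have hr' : (0 : ℝ) < r := by exact_mod_cast hr
  have key : ∀ x : Fin d → ℤ, (∀ i, (r : ℤ) ∣ x i) → ‖x‖ ≤ R →
      ∃ y : Fin d → ℤ, x = (fun i => r * y i) ∧ ∀ i, (|y i| : ℝ) ≤ R / r := fun x hx hxR => by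
    choose y hy using hx
    refine ⟨y, funext hy, fun i => ?_⟩
    have h1 := (norm_le_pi_norm x i).trans hxR
    rw [hy i, Int.norm_eq_abs] at h1
    push_cast at h1
    rw [abs_mul, abs_of_pos hr'] at h1
    rw [le_div_iff₀ hr']
    linarith
  rcases lt_or_ge R r with h | h
  · refine ⟨∅, fun x h0 hx hxR => ?_, by simpa using by positivity⟩
    obtain ⟨y, rfl, hy⟩ := key x hx hxR
    exfalso
    apply h0
    funext i
    have h1 : (|y i| : ℝ) < 1 := (hy i).trans_lt ((div_lt_one hr').2 h)
    have h2 : |y i| < 1 := by exact_mod_cast h1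
    simp [Int.abs_lt_one_iff.1 h2]
  · set m := ⌊R / r⌋ with hm
    have hm1 : 1 ≤ m := Int.le_floor.2 (by rw [Int.cast_one, one_le_div hr']; exact h)
    refine ⟨(Fintype.piFinset fun _ : Fin d => Finset.Icc (-m) m).image fun y i => r * y i,
      fun x _ hx hxR => ?_, ?_⟩
    · obtain ⟨y, rfl, hy⟩ := key x hx hxR
      refine Finset.mem_image_of_mem _ (Fintype.mem_piFinset.2 fun i => ?_)
      have : |y i| ≤ m := Int.le_floor.2 (by exact_mod_cast hy i)
      exact Finset.mem_Icc.2 (abs_le.1 this)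
    · have h1 : (((Fintype.piFinset fun _ : Fin d => Finset.Icc (-m) m).image
          fun (y : Fin d → ℤ) i => (r : ℤ) * y i).card : ℝ) ≤ (2 * m + 1 : ℝ) ^ d := by
        refine (Nat.cast_le.2 Finset.card_image_le).trans (le_of_eq ?_)
        rw [Fintype.card_piFinset]
        simp only [Int.card_Icc, Finset.prod_const, Finset.card_univ, Fintype.card_fin]
        push_cast
        congr 1
        have : ((m + 1 - -m).toNat : ℤ) = 2 * m + 1 := by omega
        exact_mod_cast this
      refine h1.trans (pow_le_pow_left₀ (by positivity) ?_ d)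
      have h2 : (m : ℝ) ≤ R / r := Int.floor_le _
      have h3 : (1 : ℝ) ≤ m := by exact_mod_cast hm1
      rw [mul_div_assoc]
      linarith

lemma norm_sq_le_sqn (x : Fin d → ℤ) : ‖x‖ ^ 2 ≤ sqn x := by
  have h : ‖x‖ ≤ √(sqn x) := (pi_norm_le_iff_of_nonneg (Real.sqrt_nonneg _)).2 fun i => by
    rw [Int.norm_eq_abs]
    exact Real.abs_le_sqrt (Finset.single_le_sum (f := fun i => (x i : ℝ) ^ 2)
      (fun i _ => sq_nonneg _) (Finset.mem_univ i))
  calc _ ≤ √(sqn x) ^ 2 := pow_le_pow_left₀ (norm_nonneg _) h 2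
    _ = _ := Real.sq_sqrt (sqn_nonneg x)

lemma Boot.momentFamily (h : Boot d β z s K) (hβ : 0 ≤ β) (hβ1 : β ≤ 1) (hz : 0 ≤ z) (hK : 2 ≤ K)
    (htot : ∀ n, (z ^ n * cSum d β n fun _ => 1) ≤ 11 / 10) :
    MomentFamily K fun p n => z ^ n * cSum d β n fun x => ‖x‖ ^ p := by
  have htwo : ∀ n : ℕ, (z ^ n * cSum d β n fun x => ‖x‖ ^ 2) ≤ K * n := fun n =>
    (mul_le_mul_of_nonneg_left (cSum_mono hβ1 norm_sq_le_sqn) (pow_nonneg hz n)).trans (h.moment n)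
  refine ⟨fun p n => mul_nonneg (pow_nonneg hz n) (cSum_nonneg hβ1 fun x => by positivity),
    fun n => by simpa using htot n, fun n => ?_, htwo, fun p => by simp [cSum_zero],
    fun p => ?_, fun p a b => ?_⟩
  · rcases Nat.eq_zero_or_pos n with rfl | hn
    · simp [cSum_zero]
    have hn' : (0 : ℝ) < √n := Real.sqrt_pos.2 (by exact_mod_cast hn)
    have hsq : √(n : ℝ) ^ 2 = n := Real.sq_sqrt (Nat.cast_nonneg n)
    have h1 : (2 * √n) * (cSum d β n fun x => ‖x‖ ^ 1) ≤
        n * (cSum d β n fun _ => 1) + cSum d β n fun x => ‖x‖ ^ 2 := by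
      rw [← cSum_mul_left, ← cSum_mul_left, ← cSum_add_fun]
      refine cSum_mono hβ1 fun x => ?_
      nlinarith [sq_nonneg (√(n : ℝ) - ‖x‖)]
    have h2 := mul_le_mul_of_nonneg_left h1 (pow_nonneg hz n)
    have h3 := mul_le_mul_of_nonneg_left (htot n) (Nat.cast_nonneg (α := ℝ) n)
    have h4 := mul_le_mul_of_nonneg_right hK (Nat.cast_nonneg (α := ℝ) n)
    have h5 : (2 * √n) * (z ^ n * cSum d β n fun x => ‖x‖ ^ 1) ≤ (2 * √n) * (K * √n) := by
      have e : (2 * √n) * (K * √n) = 2 * (K * n) := by linear_combination 2 * K * hsq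
      rw [e]
      linarith [htwo n]
    exact le_of_mul_le_mul_left h5 (by positivity)
  · have h1 : (cSum d β 1 fun x => ‖x‖ ^ p) ≤ cSum d β 1 fun _ => 1 := by
      refine walkSum_mono fun t => mul_le_mul_of_nonneg_left ?_ (wK_nonneg hβ1 _ _ _)
      refine pow_le_one₀ (norm_nonneg _) ((pi_norm_le_iff_of_nonneg zero_le_one).2 fun i => ?_)
      rw [Int.norm_eq_abs]
      exact_mod_cast abs_wsawPos_le t 1 i
    linarith [mul_le_mul_of_nonneg_left h1 (pow_nonneg hz 1), htot 1]
  · have h1 := cSum_add_le (d := d) hβ hβ1 (rfl : a + b = a + b) (G := fun x => ‖x‖ ^ p)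
      fun x => by positivity
    have h2 : (cSum d β a fun x => cSum d β b fun y => ‖x + y‖ ^ p) ≤
        ∑ j ∈ Finset.range (p + 1), p.choose j *
          ((cSum d β a fun x => ‖x‖ ^ j) * cSum d β b fun y => ‖y‖ ^ (p - j)) := by
      have e : ∀ j, (p.choose j : ℝ) * ((cSum d β a fun x => ‖x‖ ^ j) * cSum d β b fun y =>
          ‖y‖ ^ (p - j)) = cSum d β a fun x => cSum d β b fun y =>
            p.choose j * (‖x‖ ^ j * ‖y‖ ^ (p - j)) := fun j => by
        rw [mul_comm (cSum d β a _), ← cSum_mul_left, ← cSum_mul_left]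
        congr 1
        funext x
        rw [← mul_assoc, mul_right_comm, ← cSum_mul_left]
        congr 1
        funext y
        ring
      simp only [e]
      rw [← cSum_finset_sum]
      refine cSum_mono hβ1 fun x => ?_
      rw [← cSum_finset_sum]
      refine cSum_mono hβ1 fun y => ?_
      refine (pow_le_pow_left₀ (norm_nonneg _) (norm_add_le x y) p).trans (le_of_eq ?_)
      rw [add_pow]
      exact Finset.sum_congr rfl fun j _ => by ring
    refine (mul_le_mul_of_nonneg_left (h1.trans h2) (pow_nonneg hz _)).trans (le_of_eq ?_)
    rw [Finset.mul_sum]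
    refine Finset.sum_congr rfl fun j _ => ?_
    rw [pow_add]
    ring

lemma Boot.wrap_point_le (h : Boot d β z s K) (hβ1 : β ≤ 1) (hz : 0 ≤ z) (hr : 0 < r)
    (u : Fin d → ℤ) (n : ℕ) :
    (z ^ n * cSum d β n fun v => if ‖v‖ ≤ ‖u‖ then wrap r (u + v) else 0) ≤
      (6 / r) ^ d * (K * dec s n) * ‖u‖ ^ d := by
  obtain ⟨S, hS, hcard⟩ := exists_wrap_cover (r := r) d hr
    (by positivity : 0 ≤ 2 * ‖u‖)
  have h1 : (cSum d β n fun v => if ‖v‖ ≤ ‖u‖ then wrap r (u + v) else 0) ≤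
      ∑ x ∈ S, cSum d β n fun v => if v = x - u then 1 else 0 := by
    rw [← cSum_finset_sum]
    refine cSum_mono hβ1 fun v => ?_
    have hnn : ∀ x ∈ S, (0 : ℝ) ≤ if v = x - u then 1 else 0 := fun x _ => by
      split_ifs <;> norm_num
    by_cases hv : ‖v‖ ≤ ‖u‖ ∧ (u + v ≠ 0 ∧ ∀ i, (r : ℤ) ∣ (u + v) i)
    · have hmem := hS (u + v) hv.2.1 hv.2.2 ((norm_add_le u v).trans (by linarith [hv.1]))
      refine le_trans (le_of_eq ?_) (Finset.single_le_sum hnn hmem)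
      rw [if_pos hv.1, wrap, if_pos hv.2, if_pos (by simp)]
    · refine le_trans (le_of_eq ?_) (Finset.sum_nonneg hnn)
      by_cases h' : ‖v‖ ≤ ‖u‖
      · rw [if_pos h', wrap, if_neg fun h'' => hv ⟨h', h''⟩]
      · rw [if_neg h']
  have hK : 0 ≤ K * dec s n := (mul_nonneg (pow_nonneg hz n)
    (cSum_nonneg hβ1 fun y => by split_ifs <;> norm_num)).trans (h.point n 0)
  calc _ ≤ z ^ n * ∑ x ∈ S, cSum d β n fun v => if v = x - u then 1 else 0 :=
        mul_le_mul_of_nonneg_left h1 (pow_nonneg hz n)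
    _ ≤ ∑ x ∈ S, K * dec s n := by
        rw [Finset.mul_sum]
        exact Finset.sum_le_sum fun x _ => h.point n (x - u)
    _ = S.card * (K * dec s n) := by simp
    _ ≤ (3 * (2 * ‖u‖) / r) ^ d * (K * dec s n) := mul_le_mul_of_nonneg_right hcard hK
    _ = _ := by
        rw [show 3 * (2 * ‖u‖) / r = 6 / r * ‖u‖ by ring, mul_pow]
        ring

lemma dec_mul_sqrt_pow_le (hs : s + 1 = d / 2) {a b : ℕ} (hab : a ≤ b + 1) :
    dec s b * √a ^ d ≤ 1 := by
  have hb : (0 : ℝ) < b + 1 := by positivity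
  have h1 : √(a : ℝ) ^ d ≤ √((b : ℝ) + 1) ^ d :=
    pow_le_pow_left₀ (Real.sqrt_nonneg _) (Real.sqrt_le_sqrt (by exact_mod_cast hab)) d
  have h2 : √((b : ℝ) + 1) ^ d = ((b : ℝ) + 1) ^ (s + 1) := by
    rw [hs, Real.sqrt_eq_rpow, ← Real.rpow_natCast, ← Real.rpow_mul hb.le]
    congr 1
    ring
  calc _ ≤ dec s b * ((b : ℝ) + 1) ^ (s + 1) := by
        rw [← h2]
        exact mul_le_mul_of_nonneg_left h1 (dec_pos s b).le
    _ = 1 := by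
        rw [dec, ← Real.rpow_add hb, neg_add_cancel, Real.rpow_zero]

lemma Boot.wrap_half_le (h : Boot d β z s K) (hβ1 : β ≤ 1) (hz : 0 ≤ z) (hr : 0 < r)
    (hK : 0 ≤ K) (hs : s + 1 = d / 2) {B : ℝ} (hB0 : 0 ≤ B)
    (hB : ∀ n : ℕ, (z ^ n * cSum d β n fun x => ‖x‖ ^ d) ≤ B * √n ^ d) {a b : ℕ} (hab : a ≤ b + 1) :
    (z ^ (a + b) * cSum d β a fun u => cSum d β b fun v => if ‖v‖ ≤ ‖u‖ then wrap r (u + v) else 0) ≤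
      6 ^ d * K * B / (r : ℝ) ^ d := by
  have hdec := dec_pos s b
  calc _ = z ^ a * cSum d β a fun u => z ^ b * cSum d β b fun v =>
        if ‖v‖ ≤ ‖u‖ then wrap r (u + v) else 0 := by rw [cSum_mul_left]; ring
    _ ≤ z ^ a * cSum d β a fun u => (6 / r) ^ d * (K * dec s b) * ‖u‖ ^ d :=
        mul_le_mul_of_nonneg_left (cSum_mono hβ1 fun u => h.wrap_point_le hβ1 hz hr u b)
          (pow_nonneg hz a)
    _ = (6 / r) ^ d * (K * dec s b) * (z ^ a * cSum d β a fun u => ‖u‖ ^ d) := by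
        rw [cSum_mul_left]; ring
    _ ≤ (6 / r) ^ d * (K * dec s b) * (B * √a ^ d) :=
        mul_le_mul_of_nonneg_left (hB a) (by positivity)
    _ = 6 ^ d * K * B / (r : ℝ) ^ d * (dec s b * √a ^ d) := by rw [div_pow]; ring
    _ ≤ _ := mul_le_of_le_one_right (by positivity) (dec_mul_sqrt_pow_le hs hab)

lemma Boot.wrap_le (h : Boot d β z s K) (hβ : 0 ≤ β) (hβ1 : β ≤ 1) (hz : 0 ≤ z)
    (hr : 0 < r) (hK : 0 ≤ K) (hs : s + 1 = d / 2) {B : ℝ} (hB0 : 0 ≤ B)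
    (hB : ∀ n : ℕ, (z ^ n * cSum d β n fun x => ‖x‖ ^ d) ≤ B * √n ^ d) (m : ℕ) :
    z ^ m * cSum d β m (wrap r) ≤ 2 * (6 ^ d * K * B) / (r : ℝ) ^ d := by
  obtain ⟨a, b, hm, hab, hba⟩ : ∃ a b, a + b = m ∧ a ≤ b + 1 ∧ b ≤ a + 1 :=
    ⟨m / 2, m - m / 2, by omega, by omega, by omega⟩
  have h1 := cSum_add_le (d := d) hβ hβ1 hm (wrap_nonneg (r := r))
  have h2 : (cSum d β a fun u => cSum d β b fun v => wrap r (u + v)) ≤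
      (cSum d β a fun u => cSum d β b fun v => if ‖v‖ ≤ ‖u‖ then wrap r (u + v) else 0) +
        cSum d β b fun u => cSum d β a fun v => if ‖v‖ ≤ ‖u‖ then wrap r (u + v) else 0 := by
    rw [cSum_comm (a := b), ← cSum_add_fun]
    refine cSum_mono hβ1 fun u => ?_
    rw [← cSum_add_fun]
    refine cSum_mono hβ1 fun v => ?_
    have := wrap_nonneg (r := r) (u + v)
    rw [add_comm v u]
    split_ifs <;> linarith
  have h3 := h.wrap_half_le hβ1 hz hr hK hs hB0 hB hab
  have h4 := h.wrap_half_le hβ1 hz hr hK hs hB0 hB hba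
  rw [hm] at h3
  rw [add_comm, hm] at h4
  have h5 := mul_le_mul_of_nonneg_left (h1.trans h2) (pow_nonneg hz m)
  have e : 2 * (6 ^ d * K * B) / (r : ℝ) ^ d =
    6 ^ d * K * B / (r : ℝ) ^ d + 6 ^ d * K * B / (r : ℝ) ^ d := by ring
  rw [e]
  linarith

end Wsaw

namespace Wsaw

open Filter Topology

variable {d r : ℕ} {β z s C b0 μ : ℝ}

lemma exists_smallBeta (d : ℕ) (hd : 4 < d) : ∃ s C b0 β0 : ℝ, 0 < β0 ∧
    ∀ β, 0 ≤ β → β ≤ β0 → SmallBeta d s C b0 β := by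
  have hd' : (4 : ℝ) < d := by exact_mod_cast hd
  have hs : (1 : ℝ) < d / 2 - 1 := by linarith
  obtain ⟨C, b0, hC, hb0, hR⟩ := ScalarRec.exists_bound hs
  set s : ℝ := d / 2 - 1 with hsdef
  set L := laceB s (2 * bootConst d s C) with hL
  have hLc : Continuous L := by
    rw [hL]
    unfold laceB
    fun_prop
  have hL0 : L 0 = 0 := by simp [hL, laceB]
  have hev : ∀ (f : ℝ → ℝ) (e : ℝ), Continuous f → f 0 = 0 → 0 < e → ∀ᶠ β in 𝓝 0, f β < e :=
    fun f e hf h0 he => hf.continuousAt.eventually_lt_const (by rwa [h0])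
  obtain ⟨ε, hε, h⟩ := Metric.eventually_nhds_iff.1 <|
    (hev id 1 continuous_id rfl one_pos).and <|
    (hev (fun β => 48 * 3 ^ (s + 1) * teleConst s * laceConst s (2 * bootConst d s C) ^ 2 * β) 1
      (by fun_prop) (by simp) one_pos).and <|
    (hev (fun β => 2 * d * (L β * zetaSum s)) 1 (by fun_prop) (by simp [hL0]) one_pos).and <|
    (hev L b0 hLc hL0 hb0).and (hev (fun β => C * L β) (1 / 10) (by fun_prop) (by simp [hL0])
      (by norm_num))
  refine ⟨s, C, b0, ε / 2, by positivity, fun β h0 hβ => ?_⟩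
  obtain ⟨h1, h2, h3, h4, h5⟩ := h (y := β) (by
    rw [Real.dist_eq, sub_zero, abs_of_nonneg h0]
    linarith)
  exact ⟨h0, h1.le, by rw [hsdef]; ring, hs, hR, hC, h2.le, h3.le, h4.le, h5.le⟩

lemma SmallBeta.torus_le (hS : SmallBeta d s C b0 β) (hμ : HasGrowthConst d β μ) (hz : z * μ = 1)
    {B : ℝ} (hB0 : 0 ≤ B) (hB : ∀ M, MomentFamily (bootConst d s C) M → ∀ n : ℕ, M d n ≤ B * √n ^ d)
    (hr : 0 < r) (n : ℕ) :
    z ^ n * (cZ d β n - cT d r β n) ≤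
      4 * (6 ^ d * bootConst d s C * B) * β * ((n : ℝ) ^ 2 / (r : ℝ) ^ d) := by
  have hβ := hS.beta_nonneg
  have hβ1 := hS.beta_le
  have hz0 := (hS.good_critical hμ hz).z_pos.le
  have hK := le_bootConst d s C
  have htot : ∀ n, (z ^ n * cSum d β n fun _ => 1) ≤ 11 / 10 := fun n =>
    (hS.recBound_critical hμ hz n).1.trans (by linarith [hS.small_C])
  have hboot := (hS.boot_critical hμ hz).1
  have hwrap := hboot.wrap_le hβ hβ1 hz0 hr (by linarith) hS.exponent hB0
    (hB _ (hboot.momentFamily hβ hβ1 hz0 (by linarith) htot))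
  set W := 2 * (6 ^ d * bootConst d s C * B) / (r : ℝ) ^ d with hW
  have hW0 : 0 ≤ W := by positivity
  have hc0 : ∀ n, 0 ≤ z ^ n * cZ d β n := fun n => mul_nonneg (pow_nonneg hz0 n) (cZ_nonneg hβ1 n)
  simp only [← cZ_eq_cSum] at htot
  have hterm : ∀ b ∈ Finset.Ioc 0 n, ∀ a ∈ Finset.Ico 0 b,
      z ^ n * (cZ d β a * cSum d β (b - a) (wrap r) * cZ d β (n - b)) ≤ 2 * W := fun b hb a ha => by
    have hb := Finset.mem_Ioc.1 hb
    have ha := Finset.mem_Ico.1 ha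
    have e : z ^ n * (cZ d β a * cSum d β (b - a) (wrap r) * cZ d β (n - b)) =
        (z ^ (b - a) * cSum d β (b - a) (wrap r)) *
          ((z ^ a * cZ d β a) * (z ^ (n - b) * cZ d β (n - b))) := by
      rw [show n = (b - a) + a + (n - b) by omega, pow_add, pow_add,
        show b - a + a + (n - b) - b = n - b by omega]
      ring
    have h1 := mul_le_mul (htot a) (htot (n - b)) (hc0 _) (by norm_num)
    rw [e, mul_comm 2]
    exact mul_le_mul (hwrap _) (h1.trans (by norm_num)) (mul_nonneg (hc0 _) (hc0 _)) hW0
  have hsum : z ^ n * ∑ b ∈ Finset.Ioc 0 n, ∑ a ∈ Finset.Ico 0 b,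
      cZ d β a * cSum d β (b - a) (wrap r) * cZ d β (n - b) ≤ n * (n * (2 * W)) := by
    rw [Finset.mul_sum]
    refine (Finset.sum_le_card_nsmul _ _ (n * (2 * W)) fun b hb => ?_).trans (by simp)
    rw [Finset.mul_sum]
    refine (Finset.sum_le_card_nsmul _ _ _ (hterm b hb)).trans ?_
    rw [nsmul_eq_mul, Nat.card_Ico]
    have : ((b - 0 : ℕ) : ℝ) ≤ n := by exact_mod_cast (Finset.mem_Ioc.1 hb).2
    exact mul_le_mul_of_nonneg_right this (by positivity)
  have h1 := mul_le_mul_of_nonneg_left (cZ_sub_cT_le (d := d) (r := r) hβ hβ1 n) (pow_nonneg hz0 n)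
  refine h1.trans ?_
  rw [mul_left_comm]
  refine (mul_le_mul_of_nonneg_left hsum hβ).trans (le_of_eq ?_)
  rw [hW]
  ring

end Wsaw

/-- for `d > 4`, small `β > 0` and `1 ≤ n ≤ C0 V^{1/2}`,
`c_n^𝕋 = A μ^n (1 + O(β)(n^{-(d-4)/2} + n²/V))`, with the same `A`, `μ` as on `ℤ^d`. -/
theorem statement0 (d : ℕ) (hd : 4 < d) :
    ∃ β0 : ℝ, 0 < β0 ∧
      ∀ C0 : ℝ, 0 < C0 →
        ∃ K : ℝ, 0 < K ∧
          ∀ β : ℝ, 0 < β → β ≤ β0 →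
            ∀ μ : ℝ, HasGrowthConst d β μ →
              ∃ A : ℝ, 0 < A ∧
                Filter.Tendsto (fun n : ℕ => cZ d β n / μ ^ n) Filter.atTop (nhds A) ∧
                ∀ r : ℕ, 3 ≤ r → ∀ n : ℕ, 1 ≤ n →
                  (n : ℝ) ≤ C0 * Real.sqrt ((r : ℝ) ^ d) →
                  |cT d r β n - A * μ ^ n| ≤
                    K * β * (A * μ ^ n) *
                      ((n : ℝ) ^ (-(((d : ℝ) - 4) / 2)) + (n : ℝ) ^ 2 / (r : ℝ) ^ d) := by
  obtain ⟨s, C, b0, β0, hβ0, hsmall⟩ := Wsaw.exists_smallBeta d hd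
  have hS0 := hsmall 0 le_rfl hβ0.le
  have hC : 0 ≤ C := zero_le_one.trans hS0.one_le
  have hK := Wsaw.le_bootConst d s C
  obtain ⟨B, hB0, hB⟩ := Wsaw.MomentFamily.exists_bound (Wsaw.bootConst d s C) d
  refine ⟨β0, hβ0, fun _ _ => ?_⟩
  set K1 := C * Wsaw.laceB s (2 * Wsaw.bootConst d s C) 1 * Wsaw.teleConst s with hK1
  set K2 := 4 * (6 ^ d * Wsaw.bootConst d s C * B) with hK2
  have hK1' : 0 ≤ K1 := mul_nonneg (mul_nonneg hC (Wsaw.laceB_nonneg (by linarith) zero_le_one))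
    (Wsaw.teleConst_pos hS0.one_lt).le
  have hK2' : 0 ≤ K2 := by positivity
  refine ⟨K1 + K2 + 1, by positivity, fun β hβ hβle μ hμ => ?_⟩
  have hS := hsmall β hβ.le hβle
  have hμ0 : 0 < μ := zero_lt_one.trans_le (Wsaw.one_le_growth (by omega) hS.beta_le hμ)
  have hz : μ⁻¹ * μ = 1 := inv_mul_cancel₀ hμ0.ne'
  obtain ⟨A, hA1, hlim, hrate⟩ := hS.exists_amplitude hμ hz
  simp only [← Wsaw.cZ_eq_cSum] at hlim hrate
  refine ⟨A, by linarith, hlim.congr fun n => by rw [inv_pow, div_eq_inv_mul], ?_⟩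
  intro r hr n hn _
  have hn0 : (0 : ℝ) < n := by exact_mod_cast hn
  have hP : 0 < μ ^ n := pow_pos hμ0 n
  set x := (n : ℝ) ^ (-(((d : ℝ) - 4) / 2)) with hx
  set y := (n : ℝ) ^ 2 / (r : ℝ) ^ d with hy
  have hx0 : 0 ≤ x := by positivity
  have hy0 : 0 ≤ y := by positivity
  have hdecay : ((n : ℝ) + 1) ^ (1 - s) ≤ x := by
    rw [hx, show -(((d : ℝ) - 4) / 2) = 1 - s by linarith [hS.exponent]]
    exact Real.rpow_le_rpow_of_nonpos hn0 (by linarith) (by linarith [hS.one_lt])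
  have h1 : |μ⁻¹ ^ n * cZ d β n - A| ≤ K1 * β * x := by
    refine (hrate n).trans ?_
    rw [show C * Wsaw.laceB s (2 * Wsaw.bootConst d s C) β * Wsaw.teleConst s = K1 * β by
      rw [hK1, Wsaw.laceB, Wsaw.laceB]; ring]
    exact mul_le_mul_of_nonneg_left hdecay (by positivity)
  have h2 : μ⁻¹ ^ n * (cZ d β n - cT d r β n) ≤ K2 * β * y :=
    hS.torus_le hμ hz hB0 hB (by omega) n
  have h3 : 0 ≤ μ⁻¹ ^ n * (cZ d β n - cT d r β n) :=
    mul_nonneg (by positivity) (sub_nonneg.2 (Wsaw.cT_le hβ.le hS.beta_le n))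
  have hmul : μ⁻¹ ^ n * μ ^ n = 1 := by rw [← mul_pow, hz, one_pow]
  have hfac : cT d r β n - A * μ ^ n =
      μ ^ n * ((μ⁻¹ ^ n * cZ d β n - A) - μ⁻¹ ^ n * (cZ d β n - cT d r β n)) := by
    linear_combination (-cT d r β n) * hmul
  rw [hfac, abs_mul, abs_of_pos hP]
  have h4 : |(μ⁻¹ ^ n * cZ d β n - A) - μ⁻¹ ^ n * (cZ d β n - cT d r β n)| ≤
      (K1 + K2 + 1) * β * (x + y) := by
    refine (abs_sub _ _).trans ?_
    rw [abs_of_nonneg h3]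
    have : 0 ≤ K2 * (β * x) + K1 * (β * y) + β * (x + y) := by positivity
    linarith
  calc _ ≤ μ ^ n * ((K1 + K2 + 1) * β * (x + y)) := mul_le_mul_of_nonneg_left h4 hP.le
    _ ≤ A * (μ ^ n * ((K1 + K2 + 1) * β * (x + y))) :=
        le_mul_of_one_le_left (by positivity) hA1
    _ = _ := by ring
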